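/- arXiv:1508.06766 — 2 statements merged into one kernel-verified Lean document; each statement's English description precedes it below -/
import Mathlib

section
/- Let p>2, let u be a nonnegative classical solution of u_t−Δu=|∇u|^p in Q_T with u=0 on Γ_T, having an isolated gradient blowup point at (0,0,T) and satisfying the monotonicity condition x·u_x≤0 in Q_T, and let v:=u(·,·,T) be the final profile. Then there exist constants c₀>0 and ρ∈(0,L) such that v_y(x,0) ≥ c₀·x^{−2/(p−2)} for all 0<x<ρ. -/
open Real Set Filter MeasureTheory

noncomputable section

/-- Partial derivative of `u(x,y,t)` with respect to `x`. -/
def pdx (u : ℝ → ℝ → ℝ → ℝ) (x y t : ℝ) : ℝ := deriv (fun s => u s y t) x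

/-- Partial derivative with respect to `y`. -/
def pdy (u : ℝ → ℝ → ℝ → ℝ) (x y t : ℝ) : ℝ := deriv (fun s => u x s t) y

/-- Partial derivative with respect to `t`. -/
def pdt (u : ℝ → ℝ → ℝ → ℝ) (x y t : ℝ) : ℝ := deriv (fun s => u x y s) t

/-- Second partial derivative with respect to `x`. -/
def pdxx (u : ℝ → ℝ → ℝ → ℝ) (x y t : ℝ) : ℝ := deriv (fun s => pdx u s y t) x

/-- Second partial derivative with respect to `y`. -/
def pdyy (u : ℝ → ℝ → ℝ → ℝ) (x y t : ℝ) : ℝ := deriv (fun s => pdy u x s t) y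

/-- Mixed second partial derivative `u_{xy}` (first `x`, then `y`). -/
def pdxy (u : ℝ → ℝ → ℝ → ℝ) (x y t : ℝ) : ℝ := deriv (fun s => pdx u x s t) y

/-- The norm of the spatial gradient, `|∇u| = (u_x² + u_y²)^{1/2}`. -/
def gradNorm (u : ℝ → ℝ → ℝ → ℝ) (x y t : ℝ) : ℝ :=
  Real.sqrt ((pdx u x y t) ^ 2 + (pdy u x y t) ^ 2)

/-- `C^{2,1}`-type regularity of `u` at the point `(x,y,t)`: twice (continuously)
differentiable in the space variables and once in time. -/
def C21At (u : ℝ → ℝ → ℝ → ℝ) (x y t : ℝ) : Prop :=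
  DifferentiableAt ℝ (fun s => u s y t) x ∧
  DifferentiableAt ℝ (fun s => u x s t) y ∧
  DifferentiableAt ℝ (fun s => u x y s) t ∧
  DifferentiableAt ℝ (fun s => pdx u s y t) x ∧
  DifferentiableAt ℝ (fun s => pdy u x s t) y ∧
  DifferentiableAt ℝ (fun s => pdx u x s t) y ∧
  ContinuousAt (fun q : ℝ × ℝ × ℝ => u q.1 q.2.1 q.2.2) (x, y, t) ∧
  ContinuousAt (fun q : ℝ × ℝ × ℝ => pdx u q.1 q.2.1 q.2.2) (x, y, t) ∧
  ContinuousAt (fun q : ℝ × ℝ × ℝ => pdy u q.1 q.2.1 q.2.2) (x, y, t) ∧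
  ContinuousAt (fun q : ℝ × ℝ × ℝ => pdt u q.1 q.2.1 q.2.2) (x, y, t) ∧
  ContinuousAt (fun q : ℝ × ℝ × ℝ => pdxx u q.1 q.2.1 q.2.2) (x, y, t) ∧
  ContinuousAt (fun q : ℝ × ℝ × ℝ => pdyy u q.1 q.2.1 q.2.2) (x, y, t) ∧
  ContinuousAt (fun q : ℝ × ℝ × ℝ => pdxy u q.1 q.2.1 q.2.2) (x, y, t)

/-- `u` is a nonnegative classical solution of `u_t - Δu = |∇u|^p` in
`Q_T = ω × (0,T)`, `ω = (-L,L) × (0,L)`, with `u = 0` on `Γ_T = (-L,L) × {0} × (0,T)`. -/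
structure ClassicalSolution (p L T : ℝ) (u : ℝ → ℝ → ℝ → ℝ) : Prop where
  nonneg : ∀ ⦃x y t : ℝ⦄, |x| ≤ L → y ∈ Icc (0:ℝ) L → t ∈ Ioo 0 T → 0 ≤ u x y t
  smooth : ∀ ⦃x y t : ℝ⦄, |x| ≤ L → y ∈ Icc (0:ℝ) L → t ∈ Ioo 0 T → C21At u x y t
  pde : ∀ ⦃x y t : ℝ⦄, |x| < L → y ∈ Ioo (0:ℝ) L → t ∈ Ioo 0 T →
    pdt u x y t - (pdxx u x y t + pdyy u x y t) = gradNorm u x y t ^ p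
  bc : ∀ ⦃x t : ℝ⦄, |x| < L → t ∈ Ioo 0 T → u x 0 t = 0

/-- `u` has an isolated gradient blow-up point at `(0,0,T)`:
`limsup |∇u| = ∞` at `(0,0,T)` while `∇u` stays bounded on `K × (0,T)` for every
compact `K ⊆ ω̄ \ {(0,0)}`. -/
structure IsolatedGBU (L T : ℝ) (u : ℝ → ℝ → ℝ → ℝ) : Prop where
  blowup : ∀ M : ℝ, ∀ δ > (0:ℝ), ∃ x y t : ℝ, |x| ≤ L ∧ y ∈ Icc (0:ℝ) L ∧
    t ∈ Ioo 0 T ∧ |x| < δ ∧ |y| < δ ∧ T - δ < t ∧ M < gradNorm u x y t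
  bounded : ∀ K : Set (ℝ × ℝ), IsCompact K →
    K ⊆ (Icc (-L) L ×ˢ Icc (0:ℝ) L) \ {((0:ℝ), (0:ℝ))} →
    ∃ M : ℝ, ∀ q ∈ K, ∀ t ∈ Ioo (0:ℝ) T, gradNorm u q.1 q.2 t ≤ M

/-- `u` extends as a `C^{2,1}` function to `(ω̄' × [T/2,T]) \ {(0,0,T)}`,
`ω' = (-L/2,L/2) × (0,L/2)`; values and derivatives at `t = T` refer to this extension. -/
def ExtC21 (L T : ℝ) (u : ℝ → ℝ → ℝ → ℝ) : Prop :=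
  ∀ ⦃x y t : ℝ⦄, |x| ≤ L / 2 → y ∈ Icc (0:ℝ) (L / 2) → t ∈ Icc (T / 2) T →
    ¬(x = 0 ∧ y = 0 ∧ t = T) → C21At u x y t

/-- The monotonicity condition `x·u_x ≤ 0` in `Q_T`. -/
def MonCond (L T : ℝ) (u : ℝ → ℝ → ℝ → ℝ) : Prop :=
  ∀ ⦃x y t : ℝ⦄, |x| < L → y ∈ Ioo (0:ℝ) L → t ∈ Ioo 0 T → x * pdx u x y t ≤ 0

theorem aux_right {f : ℝ → ℝ} {d c x : ℝ} (h : HasDerivAt f d x)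
    (hm : ∀ᶠ s in nhdsWithin x (Ioi x), f x + c * (s - x) ≤ f s) : c ≤ d := by
  have h1 := (hasDerivAt_iff_tendsto_slope.1 h)
  have h2 : Tendsto (slope f x) (nhdsWithin x (Ioi x)) (nhds d) :=
    h1.mono_left (nhdsWithin_mono _ (fun s hs => ne_of_gt hs))
  refine ge_of_tendsto h2 ?_
  filter_upwards [hm, self_mem_nhdsWithin] with s hs hs'
  have : 0 < s - x := sub_pos.2 hs'
  rw [slope_def_field, le_div_iff₀ this]
  linarith

theorem aux_left {f : ℝ → ℝ} {d x : ℝ} (h : HasDerivAt f d x)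
    (hm : ∀ᶠ s in nhdsWithin x (Iio x), f s ≤ f x) : 0 ≤ d := by
  have h1 := (hasDerivAt_iff_tendsto_slope.1 h)
  have h2 : Tendsto (slope f x) (nhdsWithin x (Iio x)) (nhds d) :=
    h1.mono_left (nhdsWithin_mono _ (fun s hs => ne_of_lt hs))
  refine ge_of_tendsto h2 ?_
  filter_upwards [hm, self_mem_nhdsWithin] with s hs hs'
  have : s - x < 0 := sub_neg.2 hs'
  rw [slope_def_field]
  exact div_nonneg_of_nonpos (by linarith) this.le

theorem aux_sd {f f' : ℝ → ℝ} {d x : ℝ} (h : ∀ᶠ s in nhds x, HasDerivAt f (f' s) s)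
    (h1 : f' x = 0) (h2 : HasDerivAt f' d x)
    (hm : ∀ᶠ s in nhdsWithin x (Ioi x), f x ≤ f s) : 0 ≤ d := by
  by_contra hd
  push Not at hd
  have hs := (hasDerivAt_iff_tendsto_slope.1 h2).mono_left
    (nhdsWithin_mono x (fun s (hs : s ∈ Ioi x) => ne_of_gt hs))
  have hneg : ∀ᶠ s in nhdsWithin x (Ioi x), f' s < 0 := by
    filter_upwards [hs.eventually (gt_mem_nhds hd), self_mem_nhdsWithin] with s h3 h4
    rw [slope_def_field, h1, sub_zero] at h3
    by_contra h5
    exact absurd (div_nonneg (not_lt.1 h5) (sub_pos.2 h4).le) (not_le.2 h3)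
  have hall := (hneg.and hm).and (h.filter_mono nhdsWithin_le_nhds)
  rw [eventually_nhdsWithin_iff] at hall
  obtain ⟨e, he, hb⟩ := Metric.eventually_nhds_iff.1 hall
  have hx := h.self_of_nhds
  have key : ∀ s ∈ Ioo x (x + e), f' s < 0 ∧ f x ≤ f s ∧ HasDerivAt f (f' s) s := by
    intro s hs
    have := hb (y := s) (by rw [Real.dist_eq, abs_lt]; constructor <;> linarith [hs.1, hs.2]) hs.1
    exact ⟨this.1.1, this.1.2, this.2⟩
  have hlt : x < x + e / 2 := by linarith
  obtain ⟨c, hc, hc'⟩ := exists_hasDerivAt_eq_slope f f' hlt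
    (fun s hs => by
      rcases eq_or_lt_of_le hs.1 with h6 | h6
      · rw [← h6]; exact hx.continuousAt.continuousWithinAt
      · exact (key s ⟨h6, by linarith [hs.2]⟩).2.2.continuousAt.continuousWithinAt)
    (fun s hs => (key s ⟨hs.1, by linarith [hs.2]⟩).2.2)
  have h7 := (key c ⟨hc.1, by linarith [hc.2]⟩).1
  have h8 := (key (x + e/2) ⟨hlt, by linarith⟩).2.1
  have : 0 ≤ f' c := by
    rw [hc']; exact div_nonneg (by linarith) (by linarith)
  linarith

section
variable {p L T : ℝ} {u : ℝ → ℝ → ℝ → ℝ}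

theorem C21At.hx {x y t : ℝ} (h : C21At u x y t) : HasDerivAt (fun s => u s y t) (pdx u x y t) x :=
  h.1.hasDerivAt
theorem C21At.hy {x y t : ℝ} (h : C21At u x y t) : HasDerivAt (fun s => u x s t) (pdy u x y t) y :=
  h.2.1.hasDerivAt
theorem C21At.ht {x y t : ℝ} (h : C21At u x y t) : HasDerivAt (fun s => u x y s) (pdt u x y t) t :=
  h.2.2.1.hasDerivAt
theorem C21At.hxx {x y t : ℝ} (h : C21At u x y t) :
    HasDerivAt (fun s => pdx u s y t) (pdxx u x y t) x := h.2.2.2.1.hasDerivAt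
theorem C21At.hyy {x y t : ℝ} (h : C21At u x y t) :
    HasDerivAt (fun s => pdy u x s t) (pdyy u x y t) y := h.2.2.2.2.1.hasDerivAt
theorem C21At.c0 {x y t : ℝ} (h : C21At u x y t) :
    ContinuousAt (fun q : ℝ × ℝ × ℝ => u q.1 q.2.1 q.2.2) (x, y, t) := h.2.2.2.2.2.2.1
theorem C21At.cx {x y t : ℝ} (h : C21At u x y t) :
    ContinuousAt (fun q : ℝ × ℝ × ℝ => pdx u q.1 q.2.1 q.2.2) (x, y, t) := h.2.2.2.2.2.2.2.1
theorem C21At.cy {x y t : ℝ} (h : C21At u x y t) :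
    ContinuousAt (fun q : ℝ × ℝ × ℝ => pdy u q.1 q.2.1 q.2.2) (x, y, t) := h.2.2.2.2.2.2.2.2.1
theorem C21At.ct {x y t : ℝ} (h : C21At u x y t) :
    ContinuousAt (fun q : ℝ × ℝ × ℝ => pdt u q.1 q.2.1 q.2.2) (x, y, t) := h.2.2.2.2.2.2.2.2.2.1
theorem C21At.cxx {x y t : ℝ} (h : C21At u x y t) :
    ContinuousAt (fun q : ℝ × ℝ × ℝ => pdxx u q.1 q.2.1 q.2.2) (x, y, t) := h.2.2.2.2.2.2.2.2.2.2.1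
theorem C21At.cyy {x y t : ℝ} (h : C21At u x y t) :
    ContinuousAt (fun q : ℝ × ℝ × ℝ => pdyy u q.1 q.2.1 q.2.2) (x, y, t) :=
  h.2.2.2.2.2.2.2.2.2.2.2.1

theorem shift_comp (hsol : ClassicalSolution p L T u) (a b c a' b' c' x1 y1 t0 t1 N : ℝ)
    (ha : x1 + |a| ≤ L) (hb : 0 ≤ b) (hbL : y1 + b ≤ L) (hc : 0 ≤ c) (hcT : t1 + c < T)
    (ha' : x1 + |a'| ≤ L) (hb' : 0 ≤ b') (hbL' : y1 + b' ≤ L) (hc' : 0 ≤ c') (hcT' : t1 + c' < T)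
    (ht0 : 0 < t0)
    (hside : ∀ x y t, |x| ≤ x1 → y ∈ Icc 0 y1 → t ∈ Icc t0 t1 →
      (|x| = x1 ∨ y = 0 ∨ y = y1 ∨ t = t0) →
      u (x + a) (y + b) (t + c) - u (x + a') (y + b') (t + c') ≤ N)
    (x y t : ℝ) (hx : |x| ≤ x1) (hy : y ∈ Icc 0 y1) (ht : t ∈ Icc t0 t1) :
    u (x + a) (y + b) (t + c) - u (x + a') (y + b') (t + c') ≤ N := by
  have reg : ∀ x y t, |x| ≤ x1 → y ∈ Icc 0 y1 → t ∈ Icc t0 t1 →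
      C21At u (x + a) (y + b) (t + c) := fun x y t hx hy ht =>
    hsol.smooth (by linarith [abs_add_le x a]) ⟨by linarith [hy.1], by linarith [hy.2]⟩
      ⟨by linarith [ht.1], by linarith [ht.2]⟩
  have reg' : ∀ x y t, |x| ≤ x1 → y ∈ Icc 0 y1 → t ∈ Icc t0 t1 →
      C21At u (x + a') (y + b') (t + c') := fun x y t hx hy ht =>
    hsol.smooth (by linarith [abs_add_le x a']) ⟨by linarith [hy.1], by linarith [hy.2]⟩
      ⟨by linarith [ht.1], by linarith [ht.2]⟩
  by_contra hcon
  push Not at hcon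
  set D0 := u (x + a) (y + b) (t + c) - u (x + a') (y + b') (t + c') with hD0
  obtain ⟨ε, hε, hε2⟩ : ∃ ε : ℝ, 0 < ε ∧ ε * (t - t0) < D0 - N := by
    refine ⟨(D0 - N) / (t - t0 + 1), div_pos (by linarith) (by linarith [ht.1]), ?_⟩
    have h1 : 0 < t - t0 + 1 := by linarith [ht.1]
    rw [div_mul_eq_mul_div, div_lt_iff₀ h1]
    nlinarith
  let F : ℝ × ℝ × ℝ → ℝ := fun q => u (q.1 + a) (q.2.1 + b) (q.2.2 + c)
    - u (q.1 + a') (q.2.1 + b') (q.2.2 + c') - ε * (q.2.2 - t0)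
  have hK : IsCompact (Icc (-x1) x1 ×ˢ (Icc 0 y1 ×ˢ Icc t0 t1)) :=
    isCompact_Icc.prod (isCompact_Icc.prod isCompact_Icc)
  have hF : ContinuousOn F (Icc (-x1) x1 ×ˢ (Icc 0 y1 ×ˢ Icc t0 t1)) := by
    rintro ⟨x, y, t⟩ ⟨h1, h2, h3⟩
    apply ContinuousAt.continuousWithinAt
    have e1 := (reg x y t (abs_le.2 h1) h2 h3).c0
    have e2 := (reg' x y t (abs_le.2 h1) h2 h3).c0
    have g1 : ContinuousAt (fun q : ℝ × ℝ × ℝ => u (q.1 + a) (q.2.1 + b) (q.2.2 + c)) (x, y, t) :=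
      ContinuousAt.comp_of_eq (f := fun q : ℝ × ℝ × ℝ => (q.1 + a, q.2.1 + b, q.2.2 + c)) e1
        (by fun_prop) rfl
    have g2 : ContinuousAt (fun q : ℝ × ℝ × ℝ => u (q.1 + a') (q.2.1 + b') (q.2.2 + c')) (x, y, t) :=
      ContinuousAt.comp_of_eq (f := fun q : ℝ × ℝ × ℝ => (q.1 + a', q.2.1 + b', q.2.2 + c')) e2
        (by fun_prop) rfl
    exact (g1.sub g2).sub (by fun_prop)
  obtain ⟨⟨X, Y, S⟩, ⟨hX, hY, hS⟩, hmax⟩ := hK.exists_isMaxOn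
    ⟨(x, y, t), abs_le.1 hx, hy, ht⟩ hF
  have hmax' : ∀ x y t, |x| ≤ x1 → y ∈ Icc 0 y1 → t ∈ Icc t0 t1 → F (x, y, t) ≤ F (X, Y, S) :=
    fun x y t h1 h2 h3 => hmax (show (x, y, t) ∈ _ from ⟨abs_le.1 h1, h2, h3⟩)
  simp only at hX hY hS
  have hXa := abs_le.2 hX
  have hb0 : N < u (X + a) (Y + b) (S + c) - u (X + a') (Y + b') (S + c') := by
    have h1 := hmax' x y t hx hy ht
    simp only [F] at h1
    have h2 : 0 ≤ ε * (S - t0) := mul_nonneg hε.le (by linarith [hS.1])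
    linarith
  have hint : ¬ (|X| = x1 ∨ Y = 0 ∨ Y = y1 ∨ S = t0) := fun h =>
    absurd (hside X Y S hXa hY hS h) (not_le.2 hb0)
  push Not at hint
  obtain ⟨i1, i2, i3, i4⟩ := hint
  have i1 : |X| < x1 := lt_of_le_of_ne hXa i1
  have i2 : 0 < Y := lt_of_le_of_ne hY.1 (Ne.symm i2)
  have i3 : Y < y1 := lt_of_le_of_ne hY.2 i3
  have i4 : t0 < S := lt_of_le_of_ne hS.1 (Ne.symm i4)
  have rX := reg X Y S hXa hY hS
  have rX' := reg' X Y S hXa hY hS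
  have nx : ∀ᶠ s in nhds X, |s| ≤ x1 := by
    have : ContinuousAt (fun s : ℝ => |s|) X := by fun_prop
    filter_upwards [this.eventually (gt_mem_nhds i1)] with s hs using le_of_lt hs
  have ny : ∀ᶠ s in nhds Y, s ∈ Icc 0 y1 := Icc_mem_nhds i2 i3
  have mx : ∀ᶠ s in nhds X, F (s, Y, S) ≤ F (X, Y, S) := by
    filter_upwards [nx] with s hs using hmax' _ _ _ hs hY hS
  have my : ∀ᶠ s in nhds Y, F (X, s, S) ≤ F (X, Y, S) := by
    filter_upwards [ny] with s hs using hmax' _ _ _ hXa hs hS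
  have dx : ∀ s, |s| ≤ x1 → HasDerivAt (fun s => -F (s, Y, S))
      (-(pdx u (s + a) (Y + b) (S + c) - pdx u (s + a') (Y + b') (S + c'))) s := by
    intro s hs
    have := (((reg s Y S hs hY hS).hx.comp_add_const s a).sub
      ((reg' s Y S hs hY hS).hx.comp_add_const s a')).sub_const (ε * (S - t0)) |>.neg
    exact this
  have dy : ∀ s, s ∈ Icc 0 y1 → HasDerivAt (fun s => -F (X, s, S))
      (-(pdy u (X + a) (s + b) (S + c) - pdy u (X + a') (s + b') (S + c'))) s := by
    intro s hs
    have := (((reg X s S hXa hs hS).hy.comp_add_const s b).sub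
      ((reg' X s S hXa hs hS).hy.comp_add_const s b')).sub_const (ε * (S - t0)) |>.neg
    exact this
  have zx : -(pdx u (X + a) (Y + b) (S + c) - pdx u (X + a') (Y + b') (S + c')) = 0 :=
    IsLocalMin.hasDerivAt_eq_zero (by filter_upwards [mx] with s hs using neg_le_neg hs) (dx X hXa)
  have zy : -(pdy u (X + a) (Y + b) (S + c) - pdy u (X + a') (Y + b') (S + c')) = 0 :=
    IsLocalMin.hasDerivAt_eq_zero (by filter_upwards [my] with s hs using neg_le_neg hs) (dy Y hY)
  have sx := aux_sd (f := fun s => -F (s, Y, S)) (x := X) (nx.mono dx) zx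
    (((rX.hxx.comp_add_const X a).sub (rX'.hxx.comp_add_const X a')).neg)
    ((mx.filter_mono nhdsWithin_le_nhds).mono fun s hs => neg_le_neg hs)
  have sy := aux_sd (f := fun s => -F (X, s, S)) (x := Y) (ny.mono dy) zy
    (((rX.hyy.comp_add_const Y b).sub (rX'.hyy.comp_add_const Y b')).neg)
    ((my.filter_mono nhdsWithin_le_nhds).mono fun s hs => neg_le_neg hs)
  have st := aux_left (f := fun s => F (X, Y, s)) (x := S)
    (((rX.ht.comp_add_const S c).sub (rX'.ht.comp_add_const S c')).sub
      (((hasDerivAt_id S).sub_const t0).const_mul ε))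
    (by
      filter_upwards [Ioo_mem_nhdsLT i4] with s hs
      exact hmax' _ _ _ hXa hY ⟨hs.1.le, by linarith [hs.2, hS.2]⟩)
  have p1 := hsol.pde (x := X + a) (y := Y + b) (t := S + c) (by linarith [abs_add_le X a])
    ⟨by linarith, by linarith⟩ ⟨by linarith, by linarith [hS.2]⟩
  have p2 := hsol.pde (x := X + a') (y := Y + b') (t := S + c') (by linarith [abs_add_le X a'])
    ⟨by linarith, by linarith⟩ ⟨by linarith, by linarith [hS.2]⟩
  have ge : gradNorm u (X + a) (Y + b) (S + c) = gradNorm u (X + a') (Y + b') (S + c') := by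
    unfold gradNorm
    rw [show pdx u (X + a) (Y + b) (S + c) = pdx u (X + a') (Y + b') (S + c') by linarith,
      show pdy u (X + a) (Y + b) (S + c) = pdy u (X + a') (Y + b') (S + c') by linarith]
  rw [ge] at p1
  linarith

theorem lip_aux {f f' : ℝ → ℝ} {a b M : ℝ} (hab : a ≤ b)
    (h : ∀ s ∈ Icc a b, HasDerivAt f (f' s) s) (hM : ∀ s ∈ Icc a b, |f' s| ≤ M) :
    |f b - f a| ≤ M * (b - a) := by
  have := Convex.norm_image_sub_le_of_norm_hasDerivWithin_le (f := f) (f' := f') (s := Icc a b)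
    (C := M) (fun x hx => (h x hx).hasDerivWithinAt) hM (convex_Icc a b)
    (left_mem_Icc.2 hab) (right_mem_Icc.2 hab)
  rw [Real.norm_eq_abs, Real.norm_eq_abs, abs_of_nonneg (sub_nonneg.2 hab)] at this
  exact this

def GoodPt (L T x y t : ℝ) : Prop :=
  |x| ≤ L / 2 ∧ y ∈ Icc (0:ℝ) (L / 2) ∧ t ∈ Icc (T / 2) T ∧
    (L / 8 ≤ |x| ∨ L / 8 ≤ y ∨ t ≤ 3 * T / 4)

theorem good_bound (hL : 0 < L) (hT : 0 < T) (hext : ExtC21 L T u) :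
    ∃ M : ℝ, 0 < M ∧ ∀ x y t, GoodPt L T x y t → C21At u x y t ∧
      |pdx u x y t| ≤ M ∧ |pdy u x y t| ≤ M ∧ |pdt u x y t| ≤ M ∧ |pdxx u x y t| ≤ M := by
  have reg : ∀ x y t, GoodPt L T x y t → C21At u x y t := by
    rintro x y t ⟨h1, h2, h3, h4⟩
    refine hext h1 h2 h3 ?_
    rintro ⟨rfl, rfl, rfl⟩
    rw [abs_zero] at h4
    rcases h4 with h | h | h <;> linarith
  let G : Set (ℝ × ℝ × ℝ) := {q | GoodPt L T q.1 q.2.1 q.2.2}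
  have hG : IsCompact G := by
    have hK : IsCompact (Icc (-(L/2)) (L/2) ×ˢ (Icc 0 (L/2) ×ˢ Icc (T/2) T)) :=
      isCompact_Icc.prod (isCompact_Icc.prod isCompact_Icc)
    have hc : IsClosed {q : ℝ × ℝ × ℝ | L / 8 ≤ |q.1| ∨ L / 8 ≤ q.2.1 ∨ q.2.2 ≤ 3 * T / 4} :=
      IsClosed.union (s₁ := {q : ℝ × ℝ × ℝ | L / 8 ≤ |q.1|})
        (s₂ := {q : ℝ × ℝ × ℝ | L / 8 ≤ q.2.1 ∨ q.2.2 ≤ 3 * T / 4})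
        (isClosed_le (by fun_prop) (by fun_prop))
        (IsClosed.union (s₁ := {q : ℝ × ℝ × ℝ | L / 8 ≤ q.2.1})
          (s₂ := {q : ℝ × ℝ × ℝ | q.2.2 ≤ 3 * T / 4})
          (isClosed_le (by fun_prop) (by fun_prop)) (isClosed_le (by fun_prop) (by fun_prop)))
    convert hK.inter_right hc using 1
    ext ⟨x, y, t⟩
    constructor
    · rintro ⟨h1, h2, h3, h4⟩
      exact ⟨⟨abs_le.1 h1, h2, h3⟩, h4⟩
    · rintro ⟨⟨h1, h2, h3⟩, h4⟩
      exact ⟨abs_le.2 h1, h2, h3, h4⟩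
  obtain ⟨M1, h1⟩ := hG.exists_bound_of_continuousOn
    (f := fun q : ℝ × ℝ × ℝ => pdx u q.1 q.2.1 q.2.2)
    (fun q hq => (reg _ _ _ hq).cx.continuousWithinAt)
  obtain ⟨M2, h2⟩ := hG.exists_bound_of_continuousOn
    (f := fun q : ℝ × ℝ × ℝ => pdy u q.1 q.2.1 q.2.2)
    (fun q hq => (reg _ _ _ hq).cy.continuousWithinAt)
  obtain ⟨M3, h3⟩ := hG.exists_bound_of_continuousOn
    (f := fun q : ℝ × ℝ × ℝ => pdt u q.1 q.2.1 q.2.2)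
    (fun q hq => (reg _ _ _ hq).ct.continuousWithinAt)
  obtain ⟨M4, h4⟩ := hG.exists_bound_of_continuousOn
    (f := fun q : ℝ × ℝ × ℝ => pdxx u q.1 q.2.1 q.2.2)
    (fun q hq => (reg _ _ _ hq).cxx.continuousWithinAt)
  refine ⟨|M1| + |M2| + |M3| + |M4| + 1, by positivity, fun x y t hg => ⟨reg x y t hg, ?_⟩⟩
  have g1 := h1 (x, y, t) hg
  have g2 := h2 (x, y, t) hg
  have g3 := h3 (x, y, t) hg
  have g4 := h4 (x, y, t) hg
  simp only [Real.norm_eq_abs] at g1 g2 g3 g4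
  have := le_abs_self M1
  have := le_abs_self M2
  have := le_abs_self M3
  have := le_abs_self M4
  have := abs_nonneg M1
  have := abs_nonneg M2
  have := abs_nonneg M3
  have := abs_nonneg M4
  refine ⟨?_, ?_, ?_, ?_⟩ <;> linarith

theorem shift_abs (hsol : ClassicalSolution p L T u) (hL : 0 < L) (hT : 0 < T) (a b c t1 N : ℝ)
    (ha0 : 0 ≤ a) (ha : a ≤ L / 8) (hb : 0 ≤ b) (hbL : b ≤ L / 8) (hc : 0 ≤ c) (hcT : t1 + c < T)
    (hside : ∀ x y t, |x| ≤ L / 4 → y ∈ Icc 0 (L / 4) → t ∈ Icc (T / 2) t1 →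
      (|x| = L / 4 ∨ y = 0 ∨ y = L / 4 ∨ t = T / 2) →
      |u (x + a) (y + b) (t + c) - u x y t| ≤ N)
    (x y t : ℝ) (hx : |x| ≤ L / 4) (hy : y ∈ Icc 0 (L / 4)) (ht : t ∈ Icc (T / 2) t1) :
    |u (x + a) (y + b) (t + c) - u x y t| ≤ N := by
  have haa := abs_of_nonneg ha0
  have h00 : |(0:ℝ)| = 0 := abs_zero
  rw [abs_le]
  constructor
  · have := shift_comp hsol 0 0 0 a b c (L/4) (L/4) (T/2) t1 N (by linarith) le_rfl (by linarith)
      le_rfl (by linarith) (by linarith) hb (by linarith) hc hcT (by linarith)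
      (fun x y t h1 h2 h3 h4 => by
        have := (abs_le.1 (hside x y t h1 h2 h3 h4)).1
        simp only [add_zero]; linarith) x y t hx hy ht
    simp only [add_zero] at this; linarith
  · have := shift_comp hsol a b c 0 0 0 (L/4) (L/4) (T/2) t1 N (by linarith) hb (by linarith)
      hc (by linarith) (by linarith) le_rfl (by linarith) le_rfl (by linarith) (by linarith)
      (fun x y t h1 h2 h3 h4 => by
        have := (abs_le.1 (hside x y t h1 h2 h3 h4)).2
        simp only [add_zero]; linarith) x y t hx hy ht
    simp only [add_zero] at this; linarith

/-- passing from Lipschitz bound to derivative bound -/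
theorem deriv_abs_aux {f : ℝ → ℝ} {d x M e : ℝ} (h : HasDerivAt f d x) (he : 0 < e)
    (hm : ∀ h, 0 ≤ h → h ≤ e → |f (x + h) - f x| ≤ M * h) : |d| ≤ M := by
  have hm' : ∀ᶠ s in nhdsWithin x (Ioi x), |f s - f x| ≤ M * (s - x) := by
    filter_upwards [Ioo_mem_nhdsGT (show x < x + e by linarith)] with s hs
    have := hm (s - x) (by linarith [hs.1]) (by linarith [hs.2])
    rwa [add_sub_cancel] at this
  rw [abs_le]
  constructor
  · exact aux_right h (hm'.mono fun s hs => by linarith [(abs_le.1 hs).1])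
  · have := aux_right (c := -M) h.neg (hm'.mono fun s hs => by
      simp only [Pi.neg_apply]; linarith [(abs_le.1 hs).2])
    linarith

theorem ux_bound (hsol : ClassicalSolution p L T u) (hL : 0 < L) (hT : 0 < T) {M : ℝ} (hM0 : 0 < M)
    (hM : ∀ x y t, GoodPt L T x y t → C21At u x y t ∧
      |pdx u x y t| ≤ M ∧ |pdy u x y t| ≤ M ∧ |pdt u x y t| ≤ M ∧ |pdxx u x y t| ≤ M)
    (x y t : ℝ) (hx : |x| ≤ L / 4) (hy : y ∈ Icc 0 (L / 4)) (ht : t ∈ Ico (T / 2) T) :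
    |pdx u x y t| ≤ M := by
  have hr := hsol.smooth (x := x) (y := y) (t := t) (by linarith) ⟨hy.1, by linarith [hy.2]⟩
    ⟨by linarith [ht.1], ht.2⟩
  refine deriv_abs_aux hr.hx (show 0 < L / 8 by linarith) fun h h0 h1 => ?_
  have := shift_abs hsol hL hT h 0 0 t (M * h) h0 h1 le_rfl (by linarith) le_rfl (by linarith [ht.2])
    (fun x y t' hx hy ht' hs => by
      simp only [add_zero]
      have hxx := abs_le.1 hx
      rcases eq_or_ne y 0 with hy0 | hy0
      · subst hy0
        rw [hsol.bc (x := x + h) (by rw [abs_lt]; constructor <;> linarith)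
          ⟨by linarith [ht'.1], by linarith [ht'.2, ht.2]⟩,
          hsol.bc (x := x) (by linarith) ⟨by linarith [ht'.1], by linarith [ht'.2, ht.2]⟩]
        simp only [sub_zero, abs_zero]; positivity
      · have hg : ∀ s ∈ Icc x (x + h), GoodPt L T s y t' := by
          intro s hs'
          refine ⟨abs_le.2 ⟨by linarith [hs'.1], by linarith [hs'.2]⟩, ⟨hy.1, by linarith [hy.2]⟩,
            ⟨ht'.1, by linarith [ht'.2, ht.2]⟩, ?_⟩
          rcases hs with hs | hs | hs | hs
          · left
            rcases abs_choice x with h2 | h2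
            · exact le_trans (by linarith [hs'.1]) (le_abs_self s)
            · exact le_trans (by linarith [hs'.2]) (neg_le_abs s)
          · exact absurd hs hy0
          · right; left; linarith
          · right; right; linarith
        have := lip_aux (f := fun s => u s y t') (f' := fun s => pdx u s y t') (a := x) (b := x + h)
          (M := M) (by linarith) (fun s hs => (hM _ _ _ (hg s hs)).1.hx)
          (fun s hs => (hM _ _ _ (hg s hs)).2.1)
        simpa using this)
    x y t hx hy ⟨ht.1, le_rfl⟩
  simpa only [add_zero] using this

theorem ut_bound (hsol : ClassicalSolution p L T u) (hL : 0 < L) (hT : 0 < T) {M : ℝ} (hM0 : 0 < M)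
    (hM : ∀ x y t, GoodPt L T x y t → C21At u x y t ∧
      |pdx u x y t| ≤ M ∧ |pdy u x y t| ≤ M ∧ |pdt u x y t| ≤ M ∧ |pdxx u x y t| ≤ M)
    (x y t : ℝ) (hx : |x| ≤ L / 4) (hy : y ∈ Icc 0 (L / 4)) (ht : t ∈ Ico (T / 2) T) :
    |pdt u x y t| ≤ M := by
  have hr := hsol.smooth (x := x) (y := y) (t := t) (by linarith) ⟨hy.1, by linarith [hy.2]⟩
    ⟨by linarith [ht.1], ht.2⟩
  refine deriv_abs_aux hr.ht (show 0 < (T - t) / 2 by linarith [ht.2]) fun h h0 h1 => ?_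
  have hh : t + h < T := by linarith [ht.2]
  have := shift_abs hsol hL hT 0 0 h t (M * h) le_rfl (by linarith) le_rfl (by linarith) h0 hh
    (fun x y t' hx hy ht' hs => by
      simp only [add_zero]
      have hxx := abs_le.1 hx
      rcases eq_or_ne y 0 with hy0 | hy0
      · subst hy0
        rw [hsol.bc (x := x) (by linarith) 
          ⟨by linarith [ht'.1], by linarith [ht'.2, ht.2]⟩,
          hsol.bc (x := x) (by linarith) ⟨by linarith [ht'.1], by linarith [ht'.2, ht.2]⟩]
        simp only [sub_zero, abs_zero]; positivity
      · have hg : ∀ s ∈ Icc t' (t' + h), GoodPt L T x y s := by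
          intro s hs'
          refine ⟨by linarith, ⟨hy.1, by linarith [hy.2]⟩,
            ⟨by linarith [ht'.1, hs'.1], by linarith [ht'.2, hs'.2]⟩, ?_⟩
          rcases hs with hs | hs | hs | hs
          · left; linarith
          · exact absurd hs hy0
          · right; left; linarith
          · right; right; linarith [hs'.2, ht.1]
        have := lip_aux (f := fun s => u x y s) (f' := fun s => pdt u x y s) (a := t') (b := t' + h)
          (M := M) (by linarith) (fun s hs => (hM _ _ _ (hg s hs)).1.ht)
          (fun s hs => (hM _ _ _ (hg s hs)).2.2.2.1)
        simpa using this)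
    x y t hx hy ⟨ht.1, le_rfl⟩
  simpa only [add_zero] using this

theorem uy_bound (hsol : ClassicalSolution p L T u) (hL : 0 < L) (hT : 0 < T) {M N : ℝ} (hM0 : 0 < M)
    (hM : ∀ x y t, GoodPt L T x y t → C21At u x y t ∧
      |pdx u x y t| ≤ M ∧ |pdy u x y t| ≤ M ∧ |pdt u x y t| ≤ M ∧ |pdxx u x y t| ≤ M)
    (hMN : M ≤ N)
    (hN : ∀ x h t, |x| ≤ L / 4 → 0 ≤ h → h ≤ L / 8 → t ∈ Ico (T / 2) T → u x h t ≤ N * h)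
    (x y t : ℝ) (hx : |x| ≤ L / 4) (hy : y ∈ Icc 0 (L / 4)) (ht : t ∈ Ico (T / 2) T) :
    |pdy u x y t| ≤ N := by
  have hr := hsol.smooth (x := x) (y := y) (t := t) (by linarith) ⟨hy.1, by linarith [hy.2]⟩
    ⟨by linarith [ht.1], ht.2⟩
  refine deriv_abs_aux hr.hy (show 0 < L / 8 by linarith) fun h h0 h1 => ?_
  have := shift_abs hsol hL hT 0 h 0 t (N * h) le_rfl (by linarith) h0 h1 le_rfl
    (by linarith [ht.2])
    (fun x y t' hx hy ht' hs => by
      simp only [add_zero]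
      rcases eq_or_ne y 0 with hy0 | hy0
      · subst hy0
        have htt : t' ∈ Ioo 0 T := ⟨by linarith [ht'.1], by linarith [ht'.2, ht.2]⟩
        rw [hsol.bc (x := x) (by linarith) htt, zero_add, sub_zero, abs_of_nonneg
          (hsol.nonneg (by linarith) ⟨h0, by linarith⟩ htt)]
        exact hN x h t' hx h0 h1 ⟨ht'.1, htt.2⟩
      · have hg : ∀ s ∈ Icc y (y + h), GoodPt L T x s t' := by
          intro s hs'
          refine ⟨by linarith, ⟨by linarith [hy.1, hs'.1], by linarith [hy.2, hs'.2]⟩,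
            ⟨by linarith [ht'.1], by linarith [ht'.2, ht.2]⟩, ?_⟩
          rcases hs with hs | hs | hs | hs
          · left; linarith
          · exact absurd hs hy0
          · right; left; linarith [hs'.1]
          · right; right; linarith
        have := lip_aux (f := fun s => u x s t') (f' := fun s => pdy u x s t') (a := y) (b := y + h)
          (M := M) (by linarith) (fun s hs => (hM _ _ _ (hg s hs)).1.hy)
          (fun s hs => (hM _ _ _ (hg s hs)).2.2.1)
        simp only [add_sub_cancel_left] at this
        exact this.trans (by gcongr))
    x y t hx hy ⟨ht.1, le_rfl⟩
  simpa only [add_zero] using this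

theorem mono_zero (hsol : ClassicalSolution p L T u) (hmon : MonCond L T u) {x y t : ℝ}
    (hx : |x| < L) (hy : y ∈ Ioo 0 L) (ht : t ∈ Ioo 0 T) : u x y t ≤ u 0 y t := by
  have hx' := abs_lt.1 hx
  have d : ∀ s, |s| < L → HasDerivAt (fun s => u s y t) (pdx u s y t) s := fun s hs =>
    (hsol.smooth hs.le ⟨hy.1.le, hy.2.le⟩ ht).hx
  rcases le_total 0 x with h | h
  · have := antitoneOn_of_deriv_nonpos (convex_Icc 0 x) (f := fun s => u s y t)
      (fun s hs => (d s (abs_lt.2 ⟨by linarith [hs.1], by linarith [hs.2]⟩)).continuousAt.continuousWithinAt)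
      (fun s hs => by
        rw [interior_Icc] at hs
        exact (d s (abs_lt.2 ⟨by linarith [hs.1], by linarith [hs.2]⟩)).differentiableAt.differentiableWithinAt)
      (fun s hs => by
        rw [interior_Icc] at hs
        have := hmon (x := s) (abs_lt.2 ⟨by linarith [hs.1], by linarith [hs.2]⟩) hy ht
        have h3 := hs.1
        show pdx u s y t ≤ 0
        by_contra h4
        push Not at h4
        linarith [mul_pos h3 h4])
    exact this (left_mem_Icc.2 h) (right_mem_Icc.2 h) h
  · have := monotoneOn_of_deriv_nonneg (convex_Icc x 0) (f := fun s => u s y t)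
      (fun s hs => (d s (abs_lt.2 ⟨by linarith [hs.1], by linarith [hs.2]⟩)).continuousAt.continuousWithinAt)
      (fun s hs => by
        rw [interior_Icc] at hs
        exact (d s (abs_lt.2 ⟨by linarith [hs.1], by linarith [hs.2]⟩)).differentiableAt.differentiableWithinAt)
      (fun s hs => by
        rw [interior_Icc] at hs
        have := hmon (x := s) (abs_lt.2 ⟨by linarith [hs.1], by linarith [hs.2]⟩) hy ht
        have h3 := hs.2
        show 0 ≤ pdx u s y t
        by_contra h4
        push Not at h4
        linarith [mul_pos_of_neg_of_neg h3 h4])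
    exact this (left_mem_Icc.2 h) (right_mem_Icc.2 h) h

theorem zero_facts (hL : 0 < L) (hsol : ClassicalSolution p L T u) (hmon : MonCond L T u) {y t : ℝ}
    (hy : y ∈ Ioo 0 L) (ht : t ∈ Ioo 0 T) : pdx u 0 y t = 0 ∧ pdxx u 0 y t ≤ 0 := by
  have hy' : y ∈ Icc 0 L := ⟨hy.1.le, hy.2.le⟩
  have hr := hsol.smooth (x := 0) (by rw [abs_zero]; exact hL.le) hy' ht
  have nx : ∀ᶠ s in nhds (0:ℝ), |s| < L := by
    have : ContinuousAt (fun s : ℝ => |s|) 0 := by fun_prop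
    exact this.eventually (gt_mem_nhds (by simpa using hL))
  have h0 : pdx u 0 y t = 0 := IsLocalMax.hasDerivAt_eq_zero (f := fun s => u s y t)
    (nx.mono fun s hs => mono_zero hsol hmon hs hy ht) hr.hx
  refine ⟨h0, ?_⟩
  have := aux_sd (f := fun s => - u s y t) (f' := fun s => - pdx u s y t) (x := 0)
    (nx.mono fun s hs => (hsol.smooth hs.le hy' ht).hx.neg) (by simp [h0]) hr.hxx.neg
    ((nx.filter_mono nhdsWithin_le_nhds).mono fun s hs =>
      neg_le_neg (mono_zero hsol hmon hs hy ht))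
  linarith

theorem doubling (hp : 2 < p) (hsol : ClassicalSolution p L T u) (hmon : MonCond L T u)
    (hL : 0 < L) (hT : 0 < T) {M C : ℝ} (hM0 : 0 < M)
    (hM : ∀ x y t, GoodPt L T x y t → C21At u x y t ∧
      |pdx u x y t| ≤ M ∧ |pdy u x y t| ≤ M ∧ |pdt u x y t| ≤ M ∧ |pdxx u x y t| ≤ M)
    (hC : M ≤ C) (hC2 : 2 * M ≤ C * (L / 4))
    (x x' y t : ℝ) (hx'0 : 0 ≤ x') (hxx' : x' ≤ x) (hx : x ≤ L / 4)
    (hy : y ∈ Icc 0 (L / 4)) (ht : t ∈ Ico (T / 2) T) :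
    0 ≤ (u x y t + C / 2 * x ^ 2) - (u x' y t + C / 2 * x' ^ 2) := by
  have hC0 : 0 < C := by linarith
  have reg : ∀ x y s, x ∈ Icc (-(L / 2)) (L / 2) → y ∈ Icc 0 (L / 4) → s ∈ Icc (T / 2) t → C21At u x y s :=
    fun x y s h1 h2 h3 => hsol.smooth (by have := abs_le.2 h1; linarith)
      ⟨h2.1, by linarith [h2.2]⟩ ⟨by linarith [h3.1], by linarith [h3.2, ht.2]⟩
  have hside : ∀ x x' y s, 0 ≤ x' → x' ≤ x → x ≤ L / 4 → y ∈ Icc 0 (L / 4) → s ∈ Icc (T / 2) t →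
      (x = x' ∨ x = L / 4 ∨ y = 0 ∨ y = L / 4 ∨ s = T / 2) →
      0 ≤ (u x y s + C / 2 * x ^ 2) - (u x' y s + C / 2 * x' ^ 2) := by
    intro x x' y s h1 h2 h3 h4 h5 h6
    have hs : s ∈ Ioo 0 T := ⟨by linarith [h5.1], by linarith [h5.2, ht.2]⟩
    rcases eq_or_lt_of_le h4.1 with h0 | h0
    · subst h0
      rw [hsol.bc (abs_lt.2 ⟨by linarith, by linarith⟩) hs,
        hsol.bc (abs_lt.2 ⟨by linarith, by linarith⟩) hs]
      have h7 : x' ^ 2 ≤ x ^ 2 := pow_le_pow_left₀ h1 h2 2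
      have h8 := mul_le_mul_of_nonneg_left h7 (half_pos hC0).le
      linarith
    · have hmono : (y = L / 4 ∨ s = T / 2) →
          0 ≤ (u x y s + C / 2 * x ^ 2) - (u x' y s + C / 2 * x' ^ 2) := by
        intro h7
        have hg : ∀ r ∈ Icc 0 (L / 4), GoodPt L T r y s := by
          intro r hr
          refine ⟨abs_le.2 ⟨by linarith [hr.1], by linarith [hr.2]⟩, ⟨h4.1, by linarith [h4.2]⟩,
            ⟨h5.1, hs.2.le⟩, ?_⟩
          rcases h7 with h7 | h7
          · right; left; linarith
          · right; right; linarith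
        have hz := (zero_facts hL hsol hmon (y := y) (t := s) ⟨h0, by linarith [h4.2]⟩ hs).1
        have hd : ∀ r ∈ Icc 0 (L / 4), 0 ≤ pdx u r y s + C * r := by
          intro r hr
          have := lip_aux (f := fun r => pdx u r y s) (f' := fun r => pdxx u r y s) (a := 0) (b := r)
            (M := M) hr.1 (fun q hq => (hM _ _ _ (hg q ⟨hq.1, hq.2.trans hr.2⟩)).1.hxx)
            (fun q hq => (hM _ _ _ (hg q ⟨hq.1, hq.2.trans hr.2⟩)).2.2.2.2)
          simp only [hz, sub_zero] at this
          have h8 := (abs_le.1 this).1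
          have : M * r ≤ C * r := mul_le_mul_of_nonneg_right hC hr.1
          linarith
        have hder : ∀ r ∈ Icc 0 (L / 4), HasDerivAt (fun r => u r y s + C / 2 * r ^ 2)
            (pdx u r y s + C * r) r := by
          intro r hr
          have h9 := ((hM _ _ _ (hg r hr)).1.hx).add (((hasDerivAt_id r).pow 2).const_mul (C / 2))
          refine HasDerivAt.congr_deriv h9 ?_
          simp; ring
        have := monotoneOn_of_deriv_nonneg (convex_Icc 0 (L / 4))
          (f := fun r => u r y s + C / 2 * r ^ 2)
          (fun r hr => (hder r hr).continuousAt.continuousWithinAt)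
          (fun r hr => (hder r (interior_subset hr)).differentiableAt.differentiableWithinAt)
          (fun r hr => by
            rw [(hder r (interior_subset hr)).deriv]; exact hd r (interior_subset hr))
        have := this ⟨h1, by linarith⟩ ⟨by linarith, h3⟩ h2
        simp only at this
        linarith
      rcases h6 with h6 | h6 | h6 | h6 | h6
      · subst h6; simp
      · have := lip_aux (f := fun r => u r y s) (f' := fun r => pdx u r y s) (a := x') (b := x)
          (M := M) h2
          (fun q hq => (reg q y s ⟨by linarith [hq.1], by linarith [hq.2]⟩ h4 h5).hx)
          (fun q hq => ux_bound hsol hL hT hM0 hM q y s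
            (abs_le.2 ⟨by linarith [hq.1], by linarith [hq.2]⟩) h4 ⟨h5.1, hs.2⟩)
        have h8 := (abs_le.1 this).1
        have h9 : 0 ≤ (C * x - 2 * M + C * x') * (x - x') := by
          apply mul_nonneg
          · rw [h6]; have := mul_nonneg hC0.le h1; linarith
          · linarith
        nlinarith
      · exact absurd h6 h0.ne'
      · exact hmono (Or.inl h6)
      · exact hmono (Or.inr h6)
  by_contra hcon
  push Not at hcon
  let F : ℝ × ℝ × ℝ × ℝ → ℝ := fun q => (u q.1 q.2.2.1 q.2.2.2 + C / 2 * q.1 ^ 2) -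
    (u q.2.1 q.2.2.1 q.2.2.2 + C / 2 * q.2.1 ^ 2)
  have hK : IsCompact ((Icc 0 (L/4) ×ˢ (Icc 0 (L/4) ×ˢ (Icc 0 (L/4) ×ˢ Icc (T/2) t))) ∩
      {q : ℝ × ℝ × ℝ × ℝ | q.2.1 ≤ q.1}) :=
    (isCompact_Icc.prod (isCompact_Icc.prod (isCompact_Icc.prod isCompact_Icc))).inter_right
      (isClosed_le (by fun_prop) (by fun_prop))
  have hF : ContinuousOn F ((Icc 0 (L/4) ×ˢ (Icc 0 (L/4) ×ˢ (Icc 0 (L/4) ×ˢ Icc (T/2) t))) ∩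
      {q : ℝ × ℝ × ℝ × ℝ | q.2.1 ≤ q.1}) := by
    rintro ⟨x, x', y, t⟩ ⟨⟨h1, h2, h3, h4⟩, h5⟩
    simp only at h1 h2 h3 h4
    apply ContinuousAt.continuousWithinAt
    have e1 := (reg x y t ⟨by linarith [h1.1], by linarith [h1.2]⟩ h3 h4).c0
    have e2 := (reg x' y t ⟨by linarith [h2.1], by linarith [h2.2]⟩ h3 h4).c0
    have g1 : ContinuousAt (fun q : ℝ × ℝ × ℝ × ℝ => u q.1 q.2.2.1 q.2.2.2) (x, x', y, t) :=
      ContinuousAt.comp_of_eq (f := fun q : ℝ × ℝ × ℝ × ℝ => (q.1, q.2.2.1, q.2.2.2)) e1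
        (by fun_prop) rfl
    have g2 : ContinuousAt (fun q : ℝ × ℝ × ℝ × ℝ => u q.2.1 q.2.2.1 q.2.2.2) (x, x', y, t) :=
      ContinuousAt.comp_of_eq (f := fun q : ℝ × ℝ × ℝ × ℝ => (q.2.1, q.2.2.1, q.2.2.2)) e2
        (by fun_prop) rfl
    exact (g1.add (by fun_prop)).sub (g2.add (by fun_prop))
  obtain ⟨⟨X, X', Y, S⟩, ⟨⟨hX, hX', hY, hS⟩, hXX⟩, hmin⟩ := hK.exists_isMinOn
    ⟨(x, x', y, t), ⟨⟨by linarith, hx⟩, ⟨hx'0, by linarith⟩, hy, ⟨ht.1, le_rfl⟩⟩, hxx'⟩ hF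
  have hmin' : ∀ x x' y s, x ∈ Icc 0 (L / 4) → x' ∈ Icc 0 (L / 4) → y ∈ Icc 0 (L / 4) →
      s ∈ Icc (T / 2) t → x' ≤ x → F (X, X', Y, S) ≤ F (x, x', y, s) :=
    fun x x' y s h1 h2 h3 h4 h5 => hmin (show (x, x', y, s) ∈ _ from ⟨⟨h1, h2, h3, h4⟩, h5⟩)
  simp only [Set.mem_ofPred_eq] at hX hX' hY hS hXX
  have hneg : (u X Y S + C / 2 * X ^ 2) - (u X' Y S + C / 2 * X' ^ 2) < 0 :=
    lt_of_le_of_lt (hmin' x x' y t ⟨by linarith, hx⟩ ⟨hx'0, by linarith⟩ hy ⟨ht.1, le_rfl⟩ hxx') hcon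
  have hint : ¬ (X = X' ∨ X = L / 4 ∨ Y = 0 ∨ Y = L / 4 ∨ S = T / 2) := fun h =>
    absurd (hside X X' Y S hX'.1 hXX hX.2 hY hS h) (not_le.2 hneg)
  push Not at hint
  obtain ⟨i0, i1, i2, i3, i4⟩ := hint
  have i0 : X' < X := lt_of_le_of_ne hXX (Ne.symm i0)
  have i1 : X < L / 4 := lt_of_le_of_ne hX.2 i1
  have i2 : 0 < Y := lt_of_le_of_ne hY.1 (Ne.symm i2)
  have i3 : Y < L / 4 := lt_of_le_of_ne hY.2 i3
  have i4 : T / 2 < S := lt_of_le_of_ne hS.1 (Ne.symm i4)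
  have hSo : S ∈ Ioo 0 T := ⟨by linarith, by linarith [hS.2, ht.2]⟩
  have rX := reg X Y S ⟨by linarith [hX.1], by linarith⟩ hY hS
  have rX' := reg X' Y S ⟨by linarith [hX'.1], by linarith⟩ hY hS
  have dq : ∀ r : ℝ, HasDerivAt (fun r : ℝ => C / 2 * r ^ 2) (C * r) r := fun r => by
    refine (((hasDerivAt_id r).pow 2).const_mul (C / 2)).congr_deriv ?_
    simp; ring
  have dq2 : ∀ r : ℝ, HasDerivAt (fun r : ℝ => C * r) C r := fun r => by
    simpa using (hasDerivAt_id r).const_mul C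
  have df : ∀ r, r ∈ Icc (-(L / 2)) (L / 2) → HasDerivAt (fun r => u r Y S + C / 2 * r ^ 2)
      (pdx u r Y S + C * r) r := fun r hr => (reg r Y S hr hY hS).hx.add (dq r)
  have nX : ∀ᶠ s in nhds X, s ∈ Icc X' (L / 4) := Icc_mem_nhds i0 i1
  have mX : ∀ᶠ s in nhds X, u X Y S + C / 2 * X ^ 2 ≤ u s Y S + C / 2 * s ^ 2 := by
    filter_upwards [nX] with s hs
    have := hmin' s X' Y S ⟨by linarith [hs.1, hX'.1], hs.2⟩ hX' hY hS hs.1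
    simp only [F] at this
    linarith
  have mX' : ∀ s ∈ Icc 0 X, -(u X' Y S + C / 2 * X' ^ 2) ≤ -(u s Y S + C / 2 * s ^ 2) := by
    intro s hs
    have := hmin' X s Y S hX ⟨hs.1, by linarith [hs.2]⟩ hY hS hs.2
    simp only [F] at this
    linarith
  have zX : pdx u X Y S + C * X = 0 := IsLocalMin.hasDerivAt_eq_zero
    (f := fun r => u r Y S + C / 2 * r ^ 2) mX (df X ⟨by linarith [hX.1], by linarith⟩)
  have zX' : pdx u X' Y S + C * X' = 0 := by
    rcases eq_or_lt_of_le hX'.1 with h | h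
    · rw [← h, (zero_facts hL hsol hmon (y := Y) (t := S) ⟨i2, by linarith⟩ hSo).1]; simp
    · have := IsLocalMin.hasDerivAt_eq_zero
        (f := fun r => -(u r Y S + C / 2 * r ^ 2))
        (by filter_upwards [Icc_mem_nhds h i0] with s hs using mX' s hs)
        (df X' ⟨by linarith [hX'.1], by linarith⟩).neg
      linarith
  have sX := aux_sd (f := fun r => u r Y S + C / 2 * r ^ 2) (f' := fun r => pdx u r Y S + C * r)
    (x := X) (by
      filter_upwards [Icc_mem_nhds (show -(L/2) < X by linarith [hX.1]) (show X < L/2 by linarith)]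
        with s hs using df s hs) zX (rX.hxx.add (dq2 X)) (mX.filter_mono nhdsWithin_le_nhds)
  have sX' := aux_sd (f := fun r => -(u r Y S + C / 2 * r ^ 2))
    (f' := fun r => -(pdx u r Y S + C * r))
    (x := X') (by
      filter_upwards [Icc_mem_nhds (show -(L/2) < X' by linarith [hX'.1]) (show X' < L/2 by linarith)]
        with s hs using (df s hs).neg) (by simp only [zX', neg_zero]) (rX'.hxx.add (dq2 X')).neg
        (by filter_upwards [Ioo_mem_nhdsGT i0] with s hs using
          mX' s ⟨by linarith [hs.1, hX'.1], hs.2.le⟩)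
  have dy : ∀ s ∈ Icc 0 (L / 4), HasDerivAt (fun s => u X s S - u X' s S)
      (pdy u X s S - pdy u X' s S) s := fun s hs =>
    (reg X s S ⟨by linarith [hX.1], by linarith⟩ hs hS).hy.sub
      (reg X' s S ⟨by linarith [hX'.1], by linarith⟩ hs hS).hy
  have nY : ∀ᶠ s in nhds Y, s ∈ Icc 0 (L / 4) := Icc_mem_nhds i2 i3
  have mY : ∀ᶠ s in nhds Y, u X Y S - u X' Y S ≤ u X s S - u X' s S := by
    filter_upwards [nY] with s hs
    have := hmin' X X' s S hX hX' hs hS hXX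
    simp only [F] at this
    linarith
  have zY : pdy u X Y S - pdy u X' Y S = 0 := IsLocalMin.hasDerivAt_eq_zero
    (f := fun s => u X s S - u X' s S) mY (dy Y hY)
  have sY := aux_sd (f := fun s => u X s S - u X' s S) (x := Y) (nY.mono dy) zY
    (rX.hyy.sub rX'.hyy) (mY.filter_mono nhdsWithin_le_nhds)
  have sT := aux_left (f := fun s => -(u X Y s - u X' Y s)) (x := S) (rX.ht.sub rX'.ht).neg
    (by
      filter_upwards [Ioo_mem_nhdsLT i4] with s hs
      have := hmin' X X' Y s hX hX' hY ⟨hs.1.le, by linarith [hs.2, hS.2]⟩ hXX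
      simp only [F] at this
      linarith)
  have p1 := hsol.pde (x := X) (y := Y) (t := S) (abs_lt.2 ⟨by linarith [hX.1], by linarith⟩)
    ⟨by linarith, by linarith⟩ hSo
  have p2 := hsol.pde (x := X') (y := Y) (t := S) (abs_lt.2 ⟨by linarith [hX'.1], by linarith⟩)
    ⟨by linarith, by linarith⟩ hSo
  have hlt : gradNorm u X' Y S ^ p < gradNorm u X Y S ^ p := by
    apply Real.rpow_lt_rpow (Real.sqrt_nonneg _) _ (by linarith)
    unfold gradNorm
    apply Real.sqrt_lt_sqrt (by positivity)
    rw [show pdx u X Y S = -(C * X) by linarith, show pdx u X' Y S = -(C * X') by linarith,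
      show pdy u X Y S = pdy u X' Y S by linarith]
    have h1 : C * X' < C * X := mul_lt_mul_of_pos_left i0 hC0
    have h2 : 0 ≤ C * X' := mul_nonneg hC0.le hX'.1
    nlinarith
  linarith

theorem uxx_zero (hp : 2 < p) (hsol : ClassicalSolution p L T u) (hmon : MonCond L T u)
    (hL : 0 < L) (hT : 0 < T) {M C : ℝ} (hM0 : 0 < M)
    (hM : ∀ x y t, GoodPt L T x y t → C21At u x y t ∧
      |pdx u x y t| ≤ M ∧ |pdy u x y t| ≤ M ∧ |pdt u x y t| ≤ M ∧ |pdxx u x y t| ≤ M)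
    (hC : M ≤ C) (hC2 : 2 * M ≤ C * (L / 4)) (y t : ℝ)
    (hy : y ∈ Ioo 0 (L / 4)) (ht : t ∈ Ico (T / 2) T) : -C ≤ pdxx u 0 y t := by
  have hto : t ∈ Ioo 0 T := ⟨by linarith [ht.1], ht.2⟩
  have reg : ∀ x, x ∈ Icc (-L) L → C21At u x y t := fun x hx =>
    hsol.smooth (abs_le.2 hx) ⟨hy.1.le, by linarith [hy.2]⟩ hto
  have dq : ∀ r : ℝ, HasDerivAt (fun r : ℝ => C / 2 * r ^ 2) (C * r) r := fun r => by
    refine (((hasDerivAt_id r).pow 2).const_mul (C / 2)).congr_deriv ?_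
    simp; ring
  have dq2 : ∀ r : ℝ, HasDerivAt (fun r : ℝ => C * r) C r := fun r => by
    simpa using (hasDerivAt_id r).const_mul C
  have h0 : -L < 0 := by linarith
  have := aux_sd (f := fun r => u r y t + C / 2 * r ^ 2) (f' := fun r => pdx u r y t + C * r)
    (x := 0) (by
      filter_upwards [Icc_mem_nhds h0 hL] with s hs using (reg s hs).hx.add (dq s))
    (by simp only [(zero_facts hL hsol hmon (y := y) (t := t) ⟨hy.1, by linarith [hy.2]⟩ hto).1]; simp)
    ((reg 0 ⟨h0.le, hL.le⟩).hxx.add (dq2 0))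
    (by
      filter_upwards [Ioo_mem_nhdsGT (show (0:ℝ) < L / 4 by linarith)] with s hs
      have := doubling hp hsol hmon hL hT hM0 hM hC hC2 s 0 y t le_rfl hs.1.le hs.2.le
        ⟨hy.1.le, hy.2.le⟩ ht
      linarith)
  linarith

theorem grad_zero (hL : 0 < L) (hsol : ClassicalSolution p L T u) (hmon : MonCond L T u) {y t : ℝ}
    (hy : y ∈ Ioo 0 L) (ht : t ∈ Ioo 0 T) :
    pdt u 0 y t - (pdxx u 0 y t + pdyy u 0 y t) = |pdy u 0 y t| ^ p := by
  have := hsol.pde (x := 0) (by simpa using hL) hy ht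
  rw [this, gradNorm, (zero_facts hL hsol hmon hy ht).1]
  simp [Real.sqrt_sq_eq_abs]

theorem uy_unbdd (hp : 2 < p) (hsol : ClassicalSolution p L T u) (hmon : MonCond L T u)
    (hgbu : IsolatedGBU L T u)
    (hL : 0 < L) (hT : 0 < T) {M C : ℝ} (hM0 : 0 < M)
    (hM : ∀ x y t, GoodPt L T x y t → C21At u x y t ∧
      |pdx u x y t| ≤ M ∧ |pdy u x y t| ≤ M ∧ |pdt u x y t| ≤ M ∧ |pdxx u x y t| ≤ M)
    (hC : M ≤ C) (hC2 : 2 * M ≤ C * (L / 4)) (m : ℝ) : ∃ t ∈ Ico (T / 2) T, m < pdy u 0 0 t := by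
  by_contra hcon
  push Not at hcon
  have h0L : |(0:ℝ)| ≤ L := by simpa using hL.le
  set N0 := m + (M + C) * L with hN0
  have hw : ∀ t ∈ Ico (T / 2) T, ∀ y, 0 ≤ y → y ≤ L / 8 → pdy u 0 y t ≤ N0 := by
    intro t ht y hy0 hy1
    have hto : t ∈ Ioo 0 T := ⟨by linarith [ht.1], ht.2⟩
    have hmc : 0 ≤ (M + C) := by linarith
    rcases eq_or_lt_of_le hy0 with h | h
    · rw [← h]; have := hcon t ht; have := mul_nonneg hmc hL.le; linarith
    have d : ∀ s ∈ Icc 0 y, HasDerivAt (fun s => pdy u 0 s t) (pdyy u 0 s t) s := fun s hs =>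
      (hsol.smooth h0L ⟨hs.1, by linarith [hs.2]⟩ hto).hyy
    obtain ⟨c, hc, hc'⟩ := exists_hasDerivAt_eq_slope (fun s => pdy u 0 s t)
      (fun s => pdyy u 0 s t) h (fun s hs => (d s hs).continuousAt.continuousWithinAt)
      (fun s hs => d s ⟨hs.1.le, hs.2.le⟩)
    have h1 := grad_zero hL hsol hmon (y := c) (t := t) ⟨hc.1, by linarith [hc.2]⟩ hto
    have h2 : 0 ≤ |pdy u 0 c t| ^ p := by positivity
    have h3 := uxx_zero hp hsol hmon hL hT hM0 hM hC hC2 c t ⟨hc.1, by linarith [hc.2]⟩ ht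
    have h4 := (abs_le.1 (ut_bound hsol hL hT hM0 hM 0 c t (by rw [abs_zero]; linarith)
      ⟨hc.1.le, by linarith [hc.2]⟩ ht)).2
    have h5 : pdyy u 0 c t ≤ M + C := by linarith
    rw [hc', sub_zero, div_le_iff₀ h] at h5
    have := hcon t ht
    have : (M + C) * y ≤ (M + C) * L := mul_le_mul_of_nonneg_left (by linarith) hmc
    linarith
  set N := max N0 M
  have hN : ∀ x h t, |x| ≤ L / 4 → 0 ≤ h → h ≤ L / 8 → t ∈ Ico (T / 2) T → u x h t ≤ N * h := by
    intro x h t hx h0 h1 ht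
    have hto : t ∈ Ioo 0 T := ⟨by linarith [ht.1], ht.2⟩
    rcases eq_or_lt_of_le h0 with h2 | h2
    · rw [← h2, hsol.bc (by linarith) hto]; simp
    have d : ∀ s ∈ Icc 0 h, HasDerivAt (fun s => u 0 s t) (pdy u 0 s t) s := fun s hs =>
      (hsol.smooth h0L ⟨hs.1, by linarith [hs.2]⟩ hto).hy
    obtain ⟨c, hc, hc'⟩ := exists_hasDerivAt_eq_slope (fun s => u 0 s t)
      (fun s => pdy u 0 s t) h2 (fun s hs => (d s hs).continuousAt.continuousWithinAt)
      (fun s hs => d s ⟨hs.1.le, hs.2.le⟩)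
    have h3 := (hw t ht c hc.1.le (by linarith [hc.2])).trans (le_max_left N0 M)
    rw [hc', hsol.bc (by simpa using hL) hto, sub_zero, sub_zero, div_le_iff₀ h2] at h3
    exact (mono_zero hsol hmon (by linarith) ⟨h2, by linarith⟩ hto).trans h3
  obtain ⟨x, y, t, h1, h2, h3, h4, h5, h6, h7⟩ := hgbu.blowup (Real.sqrt (M ^ 2 + N ^ 2))
    (min (L / 4) (T / 2)) (by positivity)
  have h4 := h4.trans_le (min_le_left _ _)
  have h5 := (le_abs_self y).trans_lt (h5.trans_le (min_le_left _ _))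
  have h6 : T / 2 < t := by linarith [min_le_right (L / 4) (T / 2)]
  have g1 := ux_bound hsol hL hT hM0 hM x y t h4.le ⟨h2.1, h5.le⟩ ⟨h6.le, h3.2⟩
  have g2 := uy_bound hsol hL hT hM0 hM (le_max_right N0 M) hN x y t h4.le ⟨h2.1, h5.le⟩
    ⟨h6.le, h3.2⟩
  have : gradNorm u x y t ≤ Real.sqrt (M ^ 2 + N ^ 2) := by
    apply Real.sqrt_le_sqrt
    exact add_le_add (sq_le_sq' (abs_le.1 g1).1 (abs_le.1 g1).2)
      (sq_le_sq' (abs_le.1 g2).1 (abs_le.1 g2).2)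
  linarith

theorem uy_freq (hL : 0 < L) (hT : 0 < T) (hsol : ClassicalSolution p L T u)
    (h : ∀ m, ∃ t ∈ Ico (T / 2) T, m < pdy u 0 0 t) (m τ : ℝ) (hτ : τ < T) :
    ∃ t ∈ Ico (T / 2) T, τ < t ∧ m < pdy u 0 0 t := by
  obtain ⟨B, hB⟩ := (isCompact_Icc (a := T / 2) (b := τ)).exists_bound_of_continuousOn
    (f := fun t => pdy u 0 0 t) (fun t ht => by
      have := (hsol.smooth (x := 0) (y := 0) (t := t) (by simpa using hL.le) ⟨le_rfl, hL.le⟩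
        ⟨by linarith [ht.1], by linarith [ht.2]⟩).cy
      exact (ContinuousAt.comp_of_eq (f := fun t : ℝ => ((0:ℝ), (0:ℝ), t)) this
        (by fun_prop) rfl).continuousWithinAt)
  obtain ⟨t, ht, h1⟩ := h (max m B)
  refine ⟨t, ht, ?_, (le_max_left _ _).trans_lt h1⟩
  by_contra h2
  have := hB t ⟨ht.1, not_lt.1 h2⟩
  rw [Real.norm_eq_abs] at this
  linarith [le_abs_self (pdy u 0 0 t), le_max_right m B]

theorem ode_part (hp : 2 < p) (hsol : ClassicalSolution p L T u) (hmon : MonCond L T u)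
    (hL : 0 < L) (hT : 0 < T) {M : ℝ} (hM0 : 0 < M)
    (hM : ∀ x y t, GoodPt L T x y t → C21At u x y t ∧
      |pdx u x y t| ≤ M ∧ |pdy u x y t| ≤ M ∧ |pdt u x y t| ≤ M ∧ |pdxx u x y t| ≤ M)
    (m t : ℝ) (hm : 0 < m) (h16 : 16 * M < m ^ p) (hmL : m ^ (1 - p) < L / 4)
    (ht : t ∈ Ico (T / 2) T) (hmt : m ≤ pdy u 0 0 t) :
    m ^ (2 - p) / 8 ≤ u 0 (m ^ (1 - p)) t := by
  have hto : t ∈ Ioo 0 T := ⟨by linarith [ht.1], ht.2⟩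
  have h0L : |(0:ℝ)| ≤ L := by simpa using hL.le
  set δ := m ^ (1 - p) with hδ
  have hδ0 : 0 < δ := Real.rpow_pos_of_pos hm _
  have e1 : m ^ p * δ = m := by
    rw [hδ, ← Real.rpow_add hm]; simp
  have e2 : m ^ (2 - p) = m * δ := by
    rw [show 2 - p = 1 + (1 - p) by ring, Real.rpow_add hm, Real.rpow_one]
  have reg : ∀ y ∈ Icc 0 (L / 4), C21At u 0 y t := fun y hy =>
    hsol.smooth h0L ⟨hy.1, by linarith [hy.2]⟩ hto
  have star0 : ∀ y ∈ Ioo 0 (L / 4), -M ≤ pdyy u 0 y t + |pdy u 0 y t| ^ p := by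
    intro y hy
    have h1 := grad_zero hL hsol hmon (y := y) (t := t) ⟨hy.1, by linarith [hy.2]⟩ hto
    have h2 := (zero_facts hL hsol hmon (y := y) (t := t) ⟨hy.1, by linarith [hy.2]⟩ hto).2
    have h3 := (abs_le.1 (ut_bound hsol hL hT hM0 hM 0 y t (by rw [abs_zero]; linarith)
      ⟨hy.1.le, hy.2.le⟩ ht)).1
    linarith
  have star : ∀ y ∈ Ico 0 (L / 4), -M ≤ pdyy u 0 y t + |pdy u 0 y t| ^ p := by
    intro y hy
    rcases eq_or_lt_of_le hy.1 with h | h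
    · subst h
      have r := reg 0 ⟨le_rfl, by linarith⟩
      have c1 : ContinuousAt (fun y => pdyy u 0 y t) 0 :=
        ContinuousAt.comp_of_eq (f := fun y : ℝ => ((0:ℝ), y, t)) r.cyy (by fun_prop) rfl
      have c2 : ContinuousAt (fun y => pdy u 0 y t) 0 :=
        ContinuousAt.comp_of_eq (f := fun y : ℝ => ((0:ℝ), y, t)) r.cy (by fun_prop) rfl
      have c3 : ContinuousAt (fun y => pdyy u 0 y t + |pdy u 0 y t| ^ p) 0 :=
        c1.add (c2.abs.rpow_const (Or.inr (by linarith)))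
      refine ge_of_tendsto (c3.tendsto.mono_left (nhdsWithin_le_nhds (s := Ioi 0))) ?_
      filter_upwards [Ioo_mem_nhdsGT (show (0:ℝ) < L / 4 by linarith)] with s hs using star0 s hs
    · exact star0 y ⟨h, hy.2⟩
  have dψ : ∀ s : ℝ, HasDerivAt (fun s : ℝ => m / 4 - m ^ p / 8 * s) (-(m ^ p / 8)) s := by
    intro s
    simpa using ((hasDerivAt_id s).const_mul (m ^ p / 8)).const_sub (m / 4)
  have key : ∀ s ∈ Icc 0 δ, m / 4 - m ^ p / 8 * s ≤ pdy u 0 s t := by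
    intro s hs
    refine image_le_of_deriv_right_lt_deriv_boundary' (f := fun s : ℝ => m / 4 - m ^ p / 8 * s)
      (f' := fun _ => -(m ^ p / 8)) (B := fun s => pdy u 0 s t) (B' := fun s => pdyy u 0 s t)
      (a := 0) (b := δ) (fun s _ => (dψ s).continuousAt.continuousWithinAt)
      (fun s _ => (dψ s).hasDerivWithinAt) (by linarith)
      (fun s hs => (reg s ⟨hs.1, by linarith [hs.2]⟩).hyy.continuousAt.continuousWithinAt)
      (fun s hs => (reg s ⟨hs.1, by linarith [hs.2]⟩).hyy.hasDerivWithinAt)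
      ?_ hs
    intro r hr heq
    have h1 := star r ⟨hr.1, by linarith [hr.2]⟩
    have hmp : 0 < m ^ p := Real.rpow_pos_of_pos hm p
    have h2 : m ^ p * r ≤ m := by
      exact (mul_le_mul_of_nonneg_left hr.2.le hmp.le).trans_eq e1
    have h3 : 0 ≤ m ^ p * r := mul_nonneg hmp.le hr.1
    have h4 : |pdy u 0 r t| ^ p ≤ m ^ p / 16 := by
      rw [← heq, abs_of_nonneg (by linarith)]
      calc (m / 4 - m ^ p / 8 * r) ^ p ≤ (m / 4) ^ p :=
            Real.rpow_le_rpow (by linarith) (by linarith) (by linarith)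
        _ = m ^ p / 4 ^ p := Real.div_rpow hm.le (by norm_num) p
        _ ≤ m ^ p / 16 := by
            apply div_le_div_of_nonneg_left hmp.le (by norm_num)
            calc (16:ℝ) = 4 ^ (2:ℝ) := by norm_num
              _ ≤ 4 ^ p := Real.rpow_le_rpow_of_exponent_le (by norm_num) hp.le
    linarith
  obtain ⟨c, hc, hc'⟩ := exists_hasDerivAt_eq_slope (fun s => u 0 s t)
      (fun s => pdy u 0 s t) hδ0
      (fun s hs => (reg s ⟨hs.1, by linarith [hs.2]⟩).hy.continuousAt.continuousWithinAt)
      (fun s hs => (reg s ⟨hs.1.le, by linarith [hs.2]⟩).hy)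
  have h5 := key c ⟨hc.1.le, hc.2.le⟩
  have h6 : m ^ p * c ≤ m := by
    have hmp : 0 < m ^ p := Real.rpow_pos_of_pos hm p
    exact (mul_le_mul_of_nonneg_left hc.2.le hmp.le).trans_eq e1
  have h7 : m / 8 ≤ pdy u 0 c t := by linarith
  rw [hc', hsol.bc (by simpa using hL) hto, sub_zero, sub_zero, le_div_iff₀ hδ0] at h7
  rw [e2]; linarith

theorem barrier (hsol : ClassicalSolution p L T u)
    (hL : 0 < L) (hT : 0 < T) {M : ℝ} (hM0 : 0 < M)
    (hM : ∀ x y t, GoodPt L T x y t → C21At u x y t ∧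
      |pdx u x y t| ≤ M ∧ |pdy u x y t| ≤ M ∧ |pdt u x y t| ≤ M ∧ |pdxx u x y t| ≤ M)
    (t x0 δ h : ℝ) (ht : t ∈ Ico (T / 2) T) (hx0 : 0 < x0) (hx0L : x0 < L / 8) (hδ : 0 < δ)
    (hδL : δ < L / 4) (hh : 0 < h) (hu : ∀ x ∈ Icc (x0 / 2) (3 * x0 / 2), h ≤ u x δ t)
    (hbig : M < h / δ ^ 2 - 8 * h / x0 ^ 2) : h / (2 * δ) ≤ pdy u x0 0 t := by
  have hto : t ∈ Ioo 0 T := ⟨by linarith [ht.1], ht.2⟩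
  have reg : ∀ x y, x ∈ Icc 0 (L / 4) → y ∈ Icc 0 (L / 4) → C21At u x y t := fun x y hx hy =>
    hsol.smooth (abs_le.2 ⟨by linarith [hx.1], by linarith [hx.2]⟩) ⟨hy.1, by linarith [hy.2]⟩ hto
  set A := h / (2 * δ) with hA
  set B := h / (2 * δ ^ 2) with hB
  set E := 4 * h / x0 ^ 2 with hE
  have hA0 : 0 < A := by positivity
  have hB0 : 0 < B := by positivity
  have hE0 : 0 < E := by positivity
  have eAB : A * δ + B * δ ^ 2 = h := by rw [hA, hB]; field_simp; norm_num
  have eE : E * (x0 / 2) ^ 2 = h := by rw [hE]; field_simp; norm_num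
  have hbig' : M < 2 * B - 2 * E := by
    have : 2 * B - 2 * E = h / δ ^ 2 - 8 * h / x0 ^ 2 := by rw [hB, hE]; field_simp; ring
    linarith
  let F : ℝ × ℝ → ℝ := fun q => u q.1 q.2 t - (A * q.2 + B * q.2 ^ 2) + E * (q.1 - x0) ^ 2
  have key : ∀ x y, x ∈ Icc (x0 / 2) (3 * x0 / 2) → y ∈ Icc 0 δ → 0 ≤ F (x, y) := by
    by_contra hcon
    push Not at hcon
    obtain ⟨x, y, hx, hy, hneg⟩ := hcon
    have hK : IsCompact (Icc (x0 / 2) (3 * x0 / 2) ×ˢ Icc 0 δ) := isCompact_Icc.prod isCompact_Icc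
    have hF : ContinuousOn F (Icc (x0 / 2) (3 * x0 / 2) ×ˢ Icc 0 δ) := by
      rintro ⟨x, y⟩ ⟨h1, h2⟩
      simp only at h1 h2
      apply ContinuousAt.continuousWithinAt
      have g : ContinuousAt (fun q : ℝ × ℝ => u q.1 q.2 t) (x, y) :=
        ContinuousAt.comp_of_eq (f := fun q : ℝ × ℝ => (q.1, q.2, t))
          (reg x y ⟨by linarith [h1.1], by linarith [h1.2]⟩ ⟨h2.1, by linarith [h2.2]⟩).c0
          (by fun_prop) rfl
      exact (g.sub (by fun_prop)).add (by fun_prop)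
    obtain ⟨⟨X, Y⟩, ⟨hX, hY⟩, hmin⟩ := hK.exists_isMinOn ⟨(x, y), hx, hy⟩ hF
    have hmin' : ∀ x y, x ∈ Icc (x0 / 2) (3 * x0 / 2) → y ∈ Icc 0 δ → F (X, Y) ≤ F (x, y) :=
      fun x y h1 h2 => hmin (show (x, y) ∈ _ from ⟨h1, h2⟩)
    simp only at hX hY
    have hn : F (X, Y) < 0 := (hmin' x y hx hy).trans_lt hneg
    have hXL : X ∈ Icc 0 (L / 4) := ⟨by linarith [hX.1], by linarith [hX.2]⟩
    have hYL : Y ∈ Icc 0 (L / 4) := ⟨by linarith [hY.1], by linarith [hY.2]⟩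
    have hpos := hsol.nonneg (x := X) (y := Y) (t := t) 
      (abs_le.2 ⟨by linarith [hXL.1], by linarith [hXL.2]⟩) ⟨hY.1, by linarith [hYL.2]⟩ hto
    have hsqE : 0 ≤ E * (X - x0) ^ 2 := by positivity
    have hle : A * Y + B * Y ^ 2 ≤ h := by
      rw [← eAB]
      have := pow_le_pow_left₀ hY.1 hY.2 2
      exact add_le_add (mul_le_mul_of_nonneg_left hY.2 hA0.le) (mul_le_mul_of_nonneg_left this hB0.le)
    have i1 : 0 < Y := by
      refine lt_of_le_of_ne hY.1 fun h0 => ?_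
      rw [← h0] at hn hpos
      simp only [F] at hn
      nlinarith
    have i2 : Y < δ := by
      refine lt_of_le_of_ne hY.2 fun h0 => ?_
      simp only [F] at hn
      have := hu X hX
      rw [← h0] at this
      linarith
    have i3 : X ≠ x0 / 2 := by
      intro h0
      simp only [F] at hn
      have : E * (X - x0) ^ 2 = h := by rw [← eE, h0]; ring
      linarith
    have i4 : X ≠ 3 * x0 / 2 := by
      intro h0
      simp only [F] at hn
      have : E * (X - x0) ^ 2 = h := by rw [← eE, h0]; ring
      linarith
    have i3 : x0 / 2 < X := lt_of_le_of_ne hX.1 (Ne.symm i3)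
    have i4 : X < 3 * x0 / 2 := lt_of_le_of_ne hX.2 i4
    have nX : ∀ᶠ s in nhds X, s ∈ Icc (x0 / 2) (3 * x0 / 2) := Icc_mem_nhds i3 i4
    have nY : ∀ᶠ s in nhds Y, s ∈ Icc 0 δ := Icc_mem_nhds i1 i2
    have dX : ∀ s ∈ Icc (x0 / 2) (3 * x0 / 2), HasDerivAt (fun s => F (s, Y))
        (pdx u s Y t + E * (2 * (s - x0))) s := by
      intro s hs
      have h1 := ((reg s Y ⟨by linarith [hs.1], by linarith [hs.2]⟩ hYL).hx.sub_const
        (A * Y + B * Y ^ 2)).add ((((hasDerivAt_id s).sub_const x0).pow 2).const_mul E)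
      refine HasDerivAt.congr_deriv h1 ?_
      simp
    have dXX : HasDerivAt (fun s => pdx u s Y t + E * (2 * (s - x0))) (pdxx u X Y t + E * 2) X := by
      have h1 := (reg X Y hXL hYL).hxx.add
        ((((hasDerivAt_id X).sub_const x0).const_mul 2).const_mul E)
      refine HasDerivAt.congr_deriv h1 ?_
      simp
    have dY : ∀ s ∈ Icc 0 δ, HasDerivAt (fun s => F (X, s))
        (pdy u X s t - (A + B * (2 * s))) s := by
      intro s hs
      have h1 := ((reg X s hXL ⟨hs.1, by linarith [hs.2]⟩).hy.sub
        (((hasDerivAt_id s).const_mul A).add (((hasDerivAt_id s).pow 2).const_mul B))).add_const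
          (E * (X - x0) ^ 2)
      refine HasDerivAt.congr_deriv h1 ?_
      simp
    have dYY : HasDerivAt (fun s => pdy u X s t - (A + B * (2 * s))) (pdyy u X Y t - B * 2) Y := by
      have h1 := (reg X Y hXL hYL).hyy.sub
        ((((hasDerivAt_id Y).const_mul 2).const_mul B).const_add A)
      refine HasDerivAt.congr_deriv h1 ?_
      simp
    have mX : ∀ᶠ s in nhds X, F (X, Y) ≤ F (s, Y) := nX.mono fun s hs => hmin' s Y hs hY
    have mY : ∀ᶠ s in nhds Y, F (X, Y) ≤ F (X, s) := nY.mono fun s hs => hmin' X s hX hs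
    have sX := aux_sd (f := fun s => F (s, Y)) (nX.mono dX)
      (IsLocalMin.hasDerivAt_eq_zero (f := fun s => F (s, Y)) mX (dX X hX)) dXX
      (mX.filter_mono nhdsWithin_le_nhds)
    have sY := aux_sd (f := fun s => F (X, s)) (nY.mono dY)
      (IsLocalMin.hasDerivAt_eq_zero (f := fun s => F (X, s)) mY (dY Y hY)) dYY
      (mY.filter_mono nhdsWithin_le_nhds)
    have p1 := hsol.pde (x := X) (y := Y) (t := t)
      (abs_lt.2 ⟨by linarith [hXL.1], by linarith [hXL.2]⟩) ⟨i1, by linarith [hYL.2]⟩ hto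
    have p2 : 0 ≤ gradNorm u X Y t ^ p := Real.rpow_nonneg (Real.sqrt_nonneg _) _
    have p3 := (abs_le.1 (ut_bound hsol hL hT hM0 hM X Y t
      (abs_le.2 ⟨by linarith [hXL.1], hXL.2⟩) hYL ht)).2
    linarith
  refine aux_right (reg x0 0 ⟨hx0.le, by linarith⟩ ⟨le_rfl, by linarith⟩).hy ?_
  filter_upwards [Ioo_mem_nhdsGT hδ] with s hs
  have h1 := key x0 s ⟨by linarith, by linarith⟩ ⟨hs.1.le, hs.2.le⟩
  simp only [F] at h1
  rw [hsol.bc (abs_lt.2 ⟨by linarith, by linarith⟩) hto]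
  have : 0 ≤ B * s ^ 2 := by positivity
  nlinarith

end

/-- Lemma 3.2: the final profile `v = u(·,·,T)` of the normal derivative on the
boundary satisfies `v_y(x,0) ≥ c₀ x^{-2/(p-2)}` for `0 < x < ρ`. -/
theorem normal_derivative_boundary_lower (p L T : ℝ) (hp : 2 < p)
    (hL : 0 < L) (hT : 0 < T) (u : ℝ → ℝ → ℝ → ℝ)
    (hsol : ClassicalSolution p L T u) (hgbu : IsolatedGBU L T u)
    (hext : ExtC21 L T u) (hmon : MonCond L T u) :
    ∃ c₀ ρ : ℝ, 0 < c₀ ∧ 0 < ρ ∧ ρ < L ∧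
      ∀ x : ℝ, 0 < x → x < ρ → c₀ * x ^ (-(2/(p-2))) ≤ pdy u x 0 T := by
  obtain ⟨M, hM0, hM⟩ := good_bound hL hT hext
  set C := M + 8 * M / L with hCdef
  have h8 : 0 < 8 * M / L := by positivity
  have hC : M ≤ C := by linarith
  have hC2 : 2 * M ≤ C * (L / 4) := by
    have : C * (L / 4) = M * L / 4 + 2 * M := by rw [hCdef]; field_simp; ring
    have : 0 < M * L := by positivity
    linarith
  have hC0 : 0 < C := by linarith
  set Λ := 9 * C + 8 with hΛ
  have hΛ0 : 0 < Λ := by positivity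
  set m0 := 1 + 16 * M + (M + 8) * Λ + 4 / L with hm0
  have hL4 : 0 < 4 / L := by positivity
  have hMΛ : 0 < (M + 8) * Λ := by positivity
  have hm01 : 1 ≤ m0 := by linarith
  have hm0p : 0 < m0 := by linarith
  have hp2 : 0 < p - 2 := by linarith
  have hq : 0 < m0 ^ (2 - p) / Λ := div_pos (Real.rpow_pos_of_pos hm0p _) hΛ0
  refine ⟨Λ ^ (-(1 / (p - 2))) / (2 * Λ), min (L / 8) (Real.sqrt (m0 ^ (2 - p) / Λ)),
    div_pos (Real.rpow_pos_of_pos hΛ0 _) (by positivity), by positivity,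
    lt_of_le_of_lt (min_le_left _ _) (by linarith), ?_⟩
  intro x0 hx0 hxρ
  have hx8 : x0 < L / 8 := hxρ.trans_le (min_le_left _ _)
  have hxs : x0 < Real.sqrt (m0 ^ (2 - p) / Λ) := hxρ.trans_le (min_le_right _ _)
  have hxs2 : Λ * x0 ^ 2 ≤ m0 ^ (2 - p) := by
    have h1 := (Real.lt_sqrt hx0.le).1 hxs
    rw [lt_div_iff₀ hΛ0] at h1
    linarith
  have hz : 0 < Λ * x0 ^ 2 := by positivity
  set m := (Λ * x0 ^ 2) ^ (-(1 / (p - 2))) with hm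
  have hmpos : 0 < m := Real.rpow_pos_of_pos hz _
  have hm2p : m ^ (2 - p) = Λ * x0 ^ 2 := by
    rw [hm, ← Real.rpow_mul hz.le]
    have : -(1 / (p - 2)) * (2 - p) = 1 := by field_simp; ring
    rw [this, Real.rpow_one]
  have hmm0 : m0 ≤ m := by
    have h1 : (m0 ^ (2 - p)) ^ (-(1 / (p - 2))) ≤ m :=
      Real.rpow_le_rpow_of_nonpos hz hxs2 (by
        have : 0 < 1 / (p - 2) := by positivity
        linarith)
    rw [← Real.rpow_mul hm0p.le] at h1
    have : (2 - p) * -(1 / (p - 2)) = 1 := by field_simp; ring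
    rwa [this, Real.rpow_one] at h1
  have hm1 : 1 ≤ m := hm01.trans hmm0
  have hmp : m ≤ m ^ p := by
    calc m = m ^ (1:ℝ) := (Real.rpow_one m).symm
      _ ≤ m ^ p := Real.rpow_le_rpow_of_exponent_le hm1 (by linarith)
  have hδL : m ^ (1 - p) < L / 4 := by
    calc m ^ (1 - p) ≤ m ^ (-1:ℝ) := Real.rpow_le_rpow_of_exponent_le hm1 (by linarith)
      _ = m⁻¹ := Real.rpow_neg_one m
      _ < (4 / L)⁻¹ := by
          apply inv_strictAnti₀ hL4
          linarith
      _ = L / 4 := inv_div 4 L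
  set δ := m ^ (1 - p) with hδ
  have hδ0 : 0 < δ := Real.rpow_pos_of_pos hmpos _
  have e2 : m * δ = Λ * x0 ^ 2 := by
    rw [← hm2p, show 2 - p = 1 + (1 - p) by ring, Real.rpow_add hmpos, Real.rpow_one]
  have e1 : m ^ p * δ = m := by
    rw [hδ, ← Real.rpow_add hmpos]; simp
  have htarget : Λ ^ (-(1 / (p - 2))) / (2 * Λ) * x0 ^ (-(2 / (p - 2))) = x0 ^ 2 / (2 * δ) := by
    have h1 : m = Λ ^ (-(1 / (p - 2))) * x0 ^ (-(2 / (p - 2))) := by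
      rw [hm, Real.mul_rpow hΛ0.le (by positivity), ← Real.rpow_natCast x0 2,
        ← Real.rpow_mul hx0.le]
      congr 2
      push_cast
      ring
    have h2 : x0 ^ 2 / (2 * δ) = m / (2 * Λ) := by
      rw [div_eq_div_iff (by positivity) (by positivity)]
      linarith
    rw [h2, h1]; ring
  rw [htarget]
  have hfreq := uy_freq hL hT hsol (uy_unbdd hp hsol hmon hgbu hL hT hM0 hM hC hC2)
  have hbig : M < x0 ^ 2 / δ ^ 2 - 8 * x0 ^ 2 / x0 ^ 2 := by
    have h1 : x0 ^ 2 / δ ^ 2 = m ^ p / Λ := by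
      rw [div_eq_div_iff (by positivity) (by positivity)]
      calc x0 ^ 2 * Λ = m * δ := by rw [e2]; ring
        _ = (m ^ p * δ) * δ := by rw [e1]
        _ = m ^ p * δ ^ 2 := by ring
    have h2 : 8 * x0 ^ 2 / x0 ^ 2 = 8 := by field_simp
    rw [h1, h2, lt_sub_iff_add_lt, lt_div_iff₀ hΛ0]
    linarith
  have hstep : ∀ τ < T, ∃ t, τ < t ∧ t < T ∧ x0 ^ 2 / (2 * δ) ≤ pdy u x0 0 t := by
    intro τ hτ
    obtain ⟨t, ht, h1, h2⟩ := hfreq m τ hτ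
    refine ⟨t, h1, ht.2, ?_⟩
    have h3 := ode_part hp hsol hmon hL hT hM0 hM m t hmpos (by linarith) hδL ht h2.le
    rw [hm2p] at h3
    refine barrier hsol hL hT hM0 hM t x0 δ (x0 ^ 2) ht hx0 hx8 hδ0 hδL (by positivity) ?_ hbig
    intro x hx
    have h4 := doubling hp hsol hmon hL hT hM0 hM hC hC2 x 0 δ t le_rfl (by linarith [hx.1])
      (by linarith [hx.2]) ⟨hδ0.le, hδL.le⟩ ht
    have h5 : x ^ 2 ≤ (3 * x0 / 2) ^ 2 := pow_le_pow_left₀ (by linarith [hx.1]) hx.2 2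
    have h6 := mul_le_mul_of_nonneg_left h5 hC0.le
    have h7 : Λ * x0 ^ 2 = 9 * (C * x0 ^ 2) + 8 * x0 ^ 2 := by rw [hΛ]; ring
    have h9 : C * (3 * x0 / 2) ^ 2 = 9 / 4 * (C * x0 ^ 2) := by ring
    have h10 : C / 2 * (0:ℝ) ^ 2 = 0 := by simp
    linarith
  have hcy : ContinuousAt (fun t => pdy u x0 0 t) T :=
    ContinuousAt.comp_of_eq (f := fun t : ℝ => (x0, (0:ℝ), t))
      (hext (x := x0) (y := 0) (t := T) (abs_le.2 ⟨by linarith, by linarith⟩)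
        ⟨le_rfl, by linarith⟩ ⟨by linarith, le_rfl⟩ (fun h => hx0.ne' h.1)).cy (by fun_prop) rfl
  by_contra hcon
  push Not at hcon
  have hev := hcy.eventually (gt_mem_nhds hcon)
  obtain ⟨e, he, hb⟩ := Metric.eventually_nhds_iff.1 hev
  obtain ⟨t, h1, h2, h3⟩ := hstep (T - e) (by linarith)
  have := hb (y := t) (by rw [Real.dist_eq, abs_lt]; constructor <;> linarith)
  linarith
end
end

section
/- Let D₁⊂ℝ² be a bounded domain with C² boundary such that (−1,1)×(0,2) ⊆ D₁ ⊆ (−2,2)×(0,2). For (x₀,y₀)∈ℝ² and λ>0 set D_λ := (x₀,y₀)+λD₁ and δ_{D_λ}(x,y) := dist((x,y),∂D_λ). Then there exists c₁>0 depending only on D₁ such that for every (x₀,y₀)∈ℝ², every λ>0 and every bounded nonnegative function f on D_λ, any solution z of −Δz=f in D_λ with z=0 on ∂D_λ (z continuous on the closure of D_λ, twice continuously differentiable in D_λ) satisfies z(x,y)/δ_{D_λ}(x,y) ≥ c₁·λ^{−2}·∬_{D_λ} f(x',y')·δ_{D_λ}(x',y') dx'dy' for all (x,y)∈D_λ. 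-/
open Real Set Filter MeasureTheory

noncomputable section

/-- The translated-dilated copy `(x₀,y₀) + λ·D` of a planar set `D`. -/
def dilateSet (x₀ y₀ lam : ℝ) (D : Set (ℝ × ℝ)) : Set (ℝ × ℝ) :=
  (fun r : ℝ × ℝ => (x₀ + lam * r.1, y₀ + lam * r.2)) '' D

/-- The two-dimensional Laplacian of `z`. -/
def lap2 (z : ℝ × ℝ → ℝ) (q : ℝ × ℝ) : ℝ :=
  deriv (fun s => deriv (fun s' => z (s', q.2)) s) q.1 +
  deriv (fun s => deriv (fun s' => z (q.1, s')) s) q.2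

/-- `D` has `C²` boundary: near every boundary point, `D` is the sublevel set of a
`C²` local defining function with nonvanishing differential. -/
def HasC2Boundary (D : Set (ℝ × ℝ)) : Prop :=
  ∀ q ∈ frontier D, ∃ (f : ℝ × ℝ → ℝ) (V : Set (ℝ × ℝ)),
    q ∈ V ∧ IsOpen V ∧ ContDiffOn ℝ 2 f V ∧ fderiv ℝ f q ≠ 0 ∧
    ∀ r ∈ V, (r ∈ D ↔ f r < 0)



open Topology

def ddx (u : ℝ × ℝ → ℝ) (p : ℝ × ℝ) : ℝ := fderiv ℝ u p (1, 0)
def ddy (u : ℝ × ℝ → ℝ) (p : ℝ × ℝ) : ℝ := fderiv ℝ u p (0, 1)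
def lapF (u : ℝ × ℝ → ℝ) (p : ℝ × ℝ) : ℝ := ddx (ddx u) p + ddy (ddy u) p
def grad2 (u : ℝ × ℝ → ℝ) (p : ℝ × ℝ) : ℝ := ddx u p ^ 2 + ddy u p ^ 2

lemma slice_x {u : ℝ × ℝ → ℝ} {p : ℝ × ℝ} (h : DifferentiableAt ℝ u p) :
    HasDerivAt (fun s => u (s, p.2)) (ddx u p) p.1 := by
  have h1 : HasDerivAt (fun s : ℝ => (s, p.2)) ((1 : ℝ), (0 : ℝ)) p.1 :=
    (hasDerivAt_id p.1).prodMk (hasDerivAt_const p.1 p.2)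
  exact HasFDerivAt.comp_hasDerivAt (l := u) p.1 (by simpa using h.hasFDerivAt) h1

lemma slice_y {u : ℝ × ℝ → ℝ} {p : ℝ × ℝ} (h : DifferentiableAt ℝ u p) :
    HasDerivAt (fun s => u (p.1, s)) (ddy u p) p.2 := by
  have h1 : HasDerivAt (fun s : ℝ => (p.1, s)) ((0 : ℝ), (1 : ℝ)) p.2 :=
    (hasDerivAt_const p.2 p.1).prodMk (hasDerivAt_id p.2)
  exact HasFDerivAt.comp_hasDerivAt (l := u) p.2 (by simpa using h.hasFDerivAt) h1

lemma C2_fderiv {u : ℝ × ℝ → ℝ} {p : ℝ × ℝ} (h : ContDiffAt ℝ 2 u p) (v : ℝ × ℝ) :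
    ContDiffAt ℝ 1 (fun x => fderiv ℝ u x v) p :=
  (h.fderiv_right (m := 1) (by norm_num)).clm_apply contDiffAt_const

lemma C2_ddx {u : ℝ × ℝ → ℝ} {p : ℝ × ℝ} (h : ContDiffAt ℝ 2 u p) :
    ContDiffAt ℝ 1 (ddx u) p := C2_fderiv h _
lemma C2_ddy {u : ℝ × ℝ → ℝ} {p : ℝ × ℝ} (h : ContDiffAt ℝ 2 u p) :
    ContDiffAt ℝ 1 (ddy u) p := C2_fderiv h _

lemma C1_ddx_cont {u : ℝ × ℝ → ℝ} {p : ℝ × ℝ} (h : ContDiffAt ℝ 1 u p) :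
    ContinuousAt (ddx u) p :=
  ((h.fderiv_right (m := 0) (by norm_num)).clm_apply contDiffAt_const).continuousAt
lemma C1_ddy_cont {u : ℝ × ℝ → ℝ} {p : ℝ × ℝ} (h : ContDiffAt ℝ 1 u p) :
    ContinuousAt (ddy u) p :=
  ((h.fderiv_right (m := 0) (by norm_num)).clm_apply contDiffAt_const).continuousAt

lemma lapF_cont {u : ℝ × ℝ → ℝ} {p : ℝ × ℝ} (h : ContDiffAt ℝ 2 u p) :
    ContinuousAt (lapF u) p :=
  (C1_ddx_cont (C2_ddx h)).add (C1_ddy_cont (C2_ddy h))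

lemma grad2_cont {u : ℝ × ℝ → ℝ} {p : ℝ × ℝ} (h : ContDiffAt ℝ 2 u p) :
    ContinuousAt (grad2 u) p :=
  ((C2_ddx h).continuousAt.pow 2).add ((C2_ddy h).continuousAt.pow 2)

lemma C2_ev_diff {u : ℝ × ℝ → ℝ} {p : ℝ × ℝ} (h : ContDiffAt ℝ 2 u p) :
    ∀ᶠ x in 𝓝 p, DifferentiableAt ℝ u x := by
  filter_upwards [h.eventually (by norm_num)] with x hx
  exact hx.differentiableAt (by norm_num)

lemma lap2_eq_lapF {u : ℝ × ℝ → ℝ} {p : ℝ × ℝ} (h : ContDiffAt ℝ 2 u p) :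
    lap2 u p = lapF u p := by
  have hd := C2_ev_diff h
  have hx : Tendsto (fun s : ℝ => (s, p.2)) (𝓝 p.1) (𝓝 p) := by
    have : Continuous (fun s : ℝ => (s, p.2)) := by fun_prop
    simpa using this.tendsto p.1
  have hy : Tendsto (fun s : ℝ => (p.1, s)) (𝓝 p.2) (𝓝 p) := by
    have : Continuous (fun s : ℝ => (p.1, s)) := by fun_prop
    simpa using this.tendsto p.2
  unfold lap2 lapF
  congr 1
  · have : (fun s => deriv (fun s' => u (s', p.2)) s) =ᶠ[𝓝 p.1] fun s => ddx u (s, p.2) := by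
      filter_upwards [hx.eventually hd] with s hs
      exact (slice_x hs).deriv
    rw [this.deriv_eq]
    exact (slice_x ((C2_ddx h).differentiableAt (by norm_num))).deriv
  · have : (fun s => deriv (fun s' => u (p.1, s')) s) =ᶠ[𝓝 p.2] fun s => ddy u (p.1, s) := by
      filter_upwards [hy.eventually hd] with s hs
      exact (slice_y hs).deriv
    rw [this.deriv_eq]
    exact (slice_y ((C2_ddy h).differentiableAt (by norm_num))).deriv

lemma deriv2_nonneg_of_min {g : ℝ → ℝ} {a : ℝ} (h : IsLocalMin g a) (hc : ContinuousAt g a) :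
    0 ≤ deriv (deriv g) a := by
  by_contra hlt
  push Not at hlt
  have hmax := isLocalMax_of_deriv_deriv_neg hlt h.deriv_eq_zero hc
  have hconst : g =ᶠ[𝓝 a] fun _ => g a := by
    filter_upwards [h, hmax] with x h1 h2
    exact le_antisymm h2 h1
  have h3 : deriv g =ᶠ[𝓝 a] fun _ => 0 := by
    filter_upwards [hconst.deriv] with x hx
    simp [hx]
  rw [h3.deriv_eq] at hlt
  simp at hlt

lemma lapF_nonneg_of_min {w : ℝ × ℝ → ℝ} {p : ℝ × ℝ} (h : IsLocalMin w p)
    (hc : ContDiffAt ℝ 2 w p) : 0 ≤ lapF w p := by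
  rw [← lap2_eq_lapF hc]
  have hx : Tendsto (fun s : ℝ => (s, p.2)) (𝓝 p.1) (𝓝 p) := by
    have : Continuous (fun s : ℝ => (s, p.2)) := by fun_prop
    simpa using this.tendsto p.1
  have hy : Tendsto (fun s : ℝ => (p.1, s)) (𝓝 p.2) (𝓝 p) := by
    have : Continuous (fun s : ℝ => (p.1, s)) := by fun_prop
    simpa using this.tendsto p.2
  have hd := C2_ev_diff hc
  refine add_nonneg (deriv2_nonneg_of_min (g := fun s => w (s, p.2)) (hx.eventually h) ?_)
    (deriv2_nonneg_of_min (g := fun s => w (p.1, s)) (hy.eventually h) ?_)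
  · exact (slice_x hd.self_of_nhds).continuousAt
  · exact (slice_y hd.self_of_nhds).continuousAt

lemma fderiv_sub_smul_gen {u w : ℝ × ℝ → ℝ} {p : ℝ × ℝ} (c : ℝ) (v : ℝ × ℝ)
    (hu : DifferentiableAt ℝ u p) (hw : DifferentiableAt ℝ w p) :
    fderiv ℝ (fun x => u x - c * w x) p v = fderiv ℝ u p v - c * fderiv ℝ w p v := by
  have := (hu.hasFDerivAt.sub (hw.hasFDerivAt.const_mul c)).fderiv
  rw [show (fun x => u x - c * w x) = (u - fun y => c * w y) from rfl, this]
  simp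

lemma lapF_sub_mul {u w : ℝ × ℝ → ℝ} {p : ℝ × ℝ} (c : ℝ)
    (hu : ContDiffAt ℝ 2 u p) (hw : ContDiffAt ℝ 2 w p) :
    lapF (fun x => u x - c * w x) p = lapF u p - c * lapF w p := by
  have hud := C2_ev_diff hu
  have hwd := C2_ev_diff hw
  have e (v : ℝ × ℝ) : (fun x => fderiv ℝ (fun x => u x - c * w x) x v) =ᶠ[𝓝 p]
      fun x => fderiv ℝ u x v - c * fderiv ℝ w x v := by
    filter_upwards [hud, hwd] with x h1 h2
    exact fderiv_sub_smul_gen c v h1 h2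
  have e2 (v : ℝ × ℝ) : fderiv ℝ (fun x => fderiv ℝ (fun x => u x - c * w x) x v) p v =
      fderiv ℝ (fun x => fderiv ℝ u x v) p v - c * fderiv ℝ (fun x => fderiv ℝ w x v) p v := by
    rw [(e v).fderiv_eq]
    exact fderiv_sub_smul_gen c v ((C2_fderiv hu v).differentiableAt (by norm_num))
      ((C2_fderiv hw v).differentiableAt (by norm_num))
  have a := e2 (1, 0)
  have b := e2 (0, 1)
  change fderiv ℝ (fun x => fderiv ℝ (fun x => u x - c * w x) x (1,0)) p (1,0) +
    fderiv ℝ (fun x => fderiv ℝ (fun x => u x - c * w x) x (0,1)) p (0,1) =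
    (fderiv ℝ (fun x => fderiv ℝ u x (1,0)) p (1,0) +
    fderiv ℝ (fun x => fderiv ℝ u x (0,1)) p (0,1)) -
    c * (fderiv ℝ (fun x => fderiv ℝ w x (1,0)) p (1,0) +
    fderiv ℝ (fun x => fderiv ℝ w x (0,1)) p (0,1))
  rw [a, b]; ring

/-- chain rule -/
lemma lapF_comp {u : ℝ × ℝ → ℝ} {p : ℝ × ℝ} {H H1 : ℝ → ℝ} {H2 : ℝ}
    (hu : ContDiffAt ℝ 2 u p) (hH : ∀ᶠ t in 𝓝 (u p), HasDerivAt H (H1 t) t)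
    (hH1 : HasDerivAt H1 H2 (u p)) :
    lapF (fun x => H (u x)) p = H2 * grad2 u p + H1 (u p) * lapF u p := by
  have hud := C2_ev_diff hu
  have e (v : ℝ × ℝ) : (fun x => fderiv ℝ (fun x => H (u x)) x v) =ᶠ[𝓝 p]
      fun x => H1 (u x) * fderiv ℝ u x v := by
    filter_upwards [hud, hu.continuousAt.eventually hH] with x h1 h2
    have := (h2.comp_hasFDerivAt x h1.hasFDerivAt).fderiv
    rw [show (fun x => H (u x)) = H ∘ u from rfl, this]
    simp
  have e2 (v : ℝ × ℝ) : fderiv ℝ (fun x => fderiv ℝ (fun x => H (u x)) x v) p v =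
      H2 * (fderiv ℝ u p v) ^ 2 + H1 (u p) * fderiv ℝ (fun x => fderiv ℝ u x v) p v := by
    rw [(e v).fderiv_eq]
    have h1 := hH1.comp_hasFDerivAt p hud.self_of_nhds.hasFDerivAt
    have h2 := ((C2_fderiv hu v).differentiableAt (by norm_num)).hasFDerivAt
    have := (h1.mul h2).fderiv
    rw [show (fun x => H1 (u x) * fderiv ℝ u x v) =
      ((H1 ∘ u) * fun x => fderiv ℝ u x v) from rfl, this]
    simp
    ring
  have a := e2 (1, 0)
  have b := e2 (0, 1)
  change fderiv ℝ (fun x => fderiv ℝ (fun x => H (u x)) x (1,0)) p (1,0) +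
    fderiv ℝ (fun x => fderiv ℝ (fun x => H (u x)) x (0,1)) p (0,1) =
    H2 * ((fderiv ℝ u p (1,0)) ^ 2 + (fderiv ℝ u p (0,1)) ^ 2) +
    H1 (u p) * (fderiv ℝ (fun x => fderiv ℝ u x (1,0)) p (1,0) +
    fderiv ℝ (fun x => fderiv ℝ u x (0,1)) p (0,1))
  rw [a, b]; ring

lemma grad2_comp {u : ℝ × ℝ → ℝ} {p : ℝ × ℝ} {H : ℝ → ℝ} {H1 : ℝ}
    (hu : DifferentiableAt ℝ u p) (hH : HasDerivAt H H1 (u p)) :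
    grad2 (fun x => H (u x)) p = H1 ^ 2 * grad2 u p := by
  have := (hH.comp_hasFDerivAt p hu.hasFDerivAt).fderiv
  unfold grad2 ddx ddy
  rw [show (fun x => H (u x)) = H ∘ u from rfl, this]
  simp
  ring

lemma cont_mul_of_tsupport {D : Set (ℝ × ℝ)} (hD : IsOpen D) {u g : ℝ × ℝ → ℝ}
    (hu : ContinuousOn u D) (hg : Continuous g) (hs : tsupport g ⊆ D) :
    Continuous (fun x => u x * g x) := by
  rw [continuous_iff_continuousAt]
  intro x
  by_cases hx : x ∈ tsupport g
  · exact (hu.continuousAt (hD.mem_nhds (hs hx))).mul hg.continuousAt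
  · have : (fun x => u x * g x) =ᶠ[𝓝 x] fun _ => 0 := by
      filter_upwards [notMem_tsupport_iff_eventuallyEq.mp hx] with y hy
      simp [hy]
    exact this.continuousAt

lemma integrable_mul_of_tsupport {D : Set (ℝ × ℝ)} (hD : IsOpen D) {u g : ℝ × ℝ → ℝ}
    (hu : ContinuousOn u D) (hg : Continuous g) (hc : HasCompactSupport g) (hs : tsupport g ⊆ D) :
    Integrable (fun x => u x * g x) :=
  (cont_mul_of_tsupport hD hu hg hs).integrable_of_hasCompactSupport hc.mul_left

lemma ibp_dir {D : Set (ℝ × ℝ)} (hD : IsOpen D) {z φ : ℝ × ℝ → ℝ}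
    (hz : ContDiffOn ℝ 2 z D) (hφ : ContDiff ℝ 2 φ) (hc : HasCompactSupport φ)
    (hs : tsupport φ ⊆ D) (v : ℝ × ℝ) :
    Integrable (fun x => z x * fderiv ℝ (fun x => fderiv ℝ φ x v) x v) ∧
    Integrable (fun x => fderiv ℝ (fun x => fderiv ℝ z x v) x v * φ x) ∧
    ∫ x, z x * fderiv ℝ (fun x => fderiv ℝ φ x v) x v =
      ∫ x, fderiv ℝ (fun x => fderiv ℝ z x v) x v * φ x := by
  have hzc : ∀ x ∈ D, ContDiffAt ℝ 2 z x := fun x hx => hz.contDiffAt (hD.mem_nhds hx)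
  have h1 : ∀ x ∈ D, ContDiffAt ℝ 1 (fun x => fderiv ℝ z x v) x := fun x hx => C2_fderiv (hzc x hx) v
  have h2 : ContinuousOn (fun x => fderiv ℝ (fun x => fderiv ℝ z x v) x v) D := fun x hx =>
    (((h1 x hx).fderiv_right (m := 0) (by norm_num)).clm_apply
      contDiffAt_const).continuousAt.continuousWithinAt
  have p1 : ContDiff ℝ 1 (fun x => fderiv ℝ φ x v) :=
    contDiff_iff_contDiffAt.2 fun x => C2_fderiv hφ.contDiffAt v
  have p2 : Continuous (fun x => fderiv ℝ (fun x => fderiv ℝ φ x v) x v) :=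
    ((p1.fderiv_right (m := 0) (by norm_num)).clm_apply contDiff_const).continuous
  have s1 : tsupport (fun x => fderiv ℝ φ x v) ⊆ tsupport φ := tsupport_fderiv_apply_subset ℝ v
  have s2 : tsupport (fun x => fderiv ℝ (fun x => fderiv ℝ φ x v) x v) ⊆ tsupport φ :=
    (tsupport_fderiv_apply_subset ℝ v).trans s1
  have c1 : HasCompactSupport (fun x => fderiv ℝ φ x v) := hc.of_isClosed_subset (isClosed_tsupport _) s1
  have c2 : HasCompactSupport (fun x => fderiv ℝ (fun x => fderiv ℝ φ x v) x v) :=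
    hc.of_isClosed_subset (isClosed_tsupport _) s2
  have hz0 : ContinuousOn z D := hz.continuousOn
  have hz1 : ContinuousOn (fun x => fderiv ℝ z x v) D := fun x hx =>
    (h1 x hx).continuousAt.continuousWithinAt
  have i1 := integrable_mul_of_tsupport hD hz0 p2 c2 (s2.trans hs)
  have i2 := integrable_mul_of_tsupport hD h2 hφ.continuous hc hs
  refine ⟨i1, i2, ?_⟩
  rw [integral_mul_fderiv_eq_neg_fderiv_mul_of_integrable (f := z) (g := fun x => fderiv ℝ φ x v)
    (integrable_mul_of_tsupport hD hz1 p1.continuous c1 (s1.trans hs)) i1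
    (integrable_mul_of_tsupport hD hz0 p1.continuous c1 (s1.trans hs))
    (fun x hx => (hzc x (hs (s1 hx))).differentiableAt (by norm_num))
    (fun x hx => p1.differentiable (by norm_num) x)]
  rw [integral_mul_fderiv_eq_neg_fderiv_mul_of_integrable (f := fun x => fderiv ℝ z x v) (g := φ)
    i2 (integrable_mul_of_tsupport hD hz1 p1.continuous c1 (s1.trans hs))
    (integrable_mul_of_tsupport hD hz1 hφ.continuous hc hs)
    (fun x hx => (h1 x (hs hx)).differentiableAt (by norm_num))
    (fun x hx => hφ.differentiable (by norm_num) x)]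
  simp

lemma ibp_lap {D : Set (ℝ × ℝ)} (hD : IsOpen D) {z φ : ℝ × ℝ → ℝ}
    (hz : ContDiffOn ℝ 2 z D) (hφ : ContDiff ℝ 2 φ) (hc : HasCompactSupport φ)
    (hs : tsupport φ ⊆ D) :
    Integrable (fun x => z x * lapF φ x) ∧
    Integrable (fun x => lapF z x * φ x) ∧
    ∫ x, z x * lapF φ x = ∫ x, lapF z x * φ x := by
  obtain ⟨a1, a2, a3⟩ := ibp_dir hD hz hφ hc hs (1, 0)
  obtain ⟨b1, b2, b3⟩ := ibp_dir hD hz hφ hc hs (0, 1)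
  have e1 : (fun x => z x * lapF φ x) = fun x => z x * fderiv ℝ (fun x => fderiv ℝ φ x (1,0)) x (1,0)
      + z x * fderiv ℝ (fun x => fderiv ℝ φ x (0,1)) x (0,1) := by
    funext x; rw [← mul_add]; rfl
  have e2 : (fun x => lapF z x * φ x) = fun x => fderiv ℝ (fun x => fderiv ℝ z x (1,0)) x (1,0) * φ x
      + fderiv ℝ (fun x => fderiv ℝ z x (0,1)) x (0,1) * φ x := by
    funext x; rw [← add_mul]; rfl
  rw [e1, e2]
  refine ⟨a1.add b1, a2.add b2, ?_⟩
  rw [integral_add a1 b1, integral_add a2 b2, a3, b3]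

open Topology

def GG (t : ℝ) : ℝ := if t ≤ 0 then 0 else t ^ 3 / (1 + t) ^ 2
def GG1 (t : ℝ) : ℝ := if t ≤ 0 then 0 else t ^ 2 * (t + 3) / (1 + t) ^ 3
def GG2 (t : ℝ) : ℝ := if t ≤ 0 then 0 else 6 * t / (1 + t) ^ 4

lemma piece_hasDerivAt {F F1 : ℝ → ℝ} {F0 : ℝ → ℝ} (hF : F = fun t => if t ≤ 0 then 0 else F0 t)
    (hneg : ∀ t < 0, F1 t = 0) (h0 : F1 0 = 0) (hpos : ∀ t, 0 < t → HasDerivAt F0 (F1 t) t)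
    (hb : ∀ t, 0 < t → |F0 t| ≤ 4 * t ^ 2) (t : ℝ) : HasDerivAt F (F1 t) t := by
  rcases lt_trichotomy t 0 with h | h | h
  · rw [hneg t h]
    have : F =ᶠ[𝓝 t] fun _ => 0 := by
      filter_upwards [Iio_mem_nhds h] with s hs
      have hs : s < 0 := hs
      simp [hF, le_of_lt hs]
    exact (hasDerivAt_const t (0 : ℝ)).congr_of_eventuallyEq this
  · subst h
    rw [h0]
    have hO : F =O[𝓝 0] fun x => ‖x - 0‖ ^ 2 := by
      apply Asymptotics.IsBigO.of_bound 4
      filter_upwards with s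
      by_cases hs : s ≤ 0
      · simp [hF, hs]; positivity
      · push Not at hs
        have := hb s hs
        simpa [hF, not_le.2 hs] using this
    have h1 : HasFDerivAt F (0 : ℝ →L[ℝ] ℝ) 0 := hO.hasFDerivAt (by norm_num)
    simpa using h1.hasDerivAt
  · have : F =ᶠ[𝓝 t] F0 := by
      filter_upwards [Ioi_mem_nhds h] with s hs
      have hs : 0 < s := hs
      simp [hF, not_le.2 hs]
    exact (hpos t h).congr_of_eventuallyEq this

lemma GG_deriv (t : ℝ) : HasDerivAt GG (GG1 t) t := by
  refine piece_hasDerivAt (F0 := fun t => t ^ 3 / (1 + t) ^ 2) rfl ?_ (by simp [GG1]) ?_ ?_ t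
  · intro t ht; simp [GG1, ht.le]
  · intro t ht
    have h1 : (1 + t) ≠ 0 := by positivity
    have := (hasDerivAt_pow 3 t).div (((hasDerivAt_id t).const_add 1).pow 2) (by simp; exact h1)
    refine this.congr_deriv ?_
    simp [GG1, not_le.2 ht]
    field_simp
    ring
  · intro t ht
    rw [abs_of_nonneg (by positivity), div_le_iff₀ (by positivity)]
    nlinarith [pow_pos ht 2, pow_pos ht 3, pow_pos ht 4]

lemma GG1_deriv (t : ℝ) : HasDerivAt GG1 (GG2 t) t := by
  refine piece_hasDerivAt (F0 := fun t => t ^ 2 * (t + 3) / (1 + t) ^ 3) rfl ?_ (by simp [GG2]) ?_ ?_ t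
  · intro t ht; simp [GG2, ht.le]
  · intro t ht
    have h1 : (1 + t) ≠ 0 := by positivity
    have := ((hasDerivAt_pow 2 t).mul ((hasDerivAt_id t).add_const 3)).div
      (((hasDerivAt_id t).const_add 1).pow 3) (by simp; exact h1)
    refine this.congr_deriv ?_
    simp [GG2, not_le.2 ht]
    field_simp
    ring
  · intro t ht
    rw [abs_of_nonneg (by positivity), div_le_iff₀ (by positivity)]
    nlinarith [pow_pos ht 2, pow_pos ht 3, pow_pos ht 4, pow_pos ht 5]

lemma GG2_cont : Continuous GG2 := by
  have : GG2 = fun t => 6 * max t 0 / (1 + max t 0) ^ 4 := by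
    funext t
    by_cases h : t ≤ 0
    · simp [GG2, h]
    · simp [GG2, h, (not_le.1 h).le]
  rw [this]
  refine Continuous.div (by fun_prop) (by fun_prop) ?_
  intro t
  have : 0 ≤ max t 0 := le_max_right _ _
  positivity

lemma GG_contDiff : ContDiff ℝ 2 GG := by
  have h1 : deriv GG = GG1 := funext fun t => (GG_deriv t).deriv
  have h2 : deriv GG1 = GG2 := funext fun t => (GG1_deriv t).deriv
  rw [show (2 : WithTop ℕ∞) = 1 + 1 by norm_num, contDiff_succ_iff_deriv]
  refine ⟨fun t => (GG_deriv t).differentiableAt, by simp, ?_⟩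
  rw [h1, contDiff_one_iff_deriv, h2]
  exact ⟨fun t => (GG1_deriv t).differentiableAt, GG2_cont⟩

lemma GG_nonneg (t : ℝ) : 0 ≤ GG t := by
  unfold GG; split_ifs with h
  · rfl
  · push Not at h; positivity
lemma GG1_nonneg (t : ℝ) : 0 ≤ GG1 t := by
  unfold GG1; split_ifs with h
  · rfl
  · push Not at h; positivity
lemma GG2_nonneg (t : ℝ) : 0 ≤ GG2 t := by
  unfold GG2; split_ifs with h
  · rfl
  · push Not at h; positivity
lemma GG1_le (t : ℝ) : GG1 t ≤ 1 := by
  unfold GG1; split_ifs with h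
  · norm_num
  · push Not at h
    rw [div_le_one (by positivity)]
    nlinarith
lemma GG_zero {t : ℝ} (h : t ≤ 0) : GG t = 0 := by simp [GG, h]
lemma GG1_zero {t : ℝ} (h : t ≤ 0) : GG1 t = 0 := by simp [GG1, h]
lemma GG_lower {t : ℝ} (h : 2 ≤ t) : t / 8 ≤ GG (t - 1) := by
  have : ¬ (t - 1 ≤ 0) := by linarith
  simp only [GG, this, if_false]
  rw [le_div_iff₀ (by ring_nf; positivity)]
  have h2 : (t / 2) ^ 3 ≤ (t - 1) ^ 3 := by gcongr; linarith
  calc t / 8 * (1 + (t - 1)) ^ 2 = (t / 2) ^ 3 := by ring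
    _ ≤ _ := h2

structure Adm (D : Set (ℝ × ℝ)) (f z : ℝ × ℝ → ℝ) : Prop where
  meas : Measurable f
  f0 : ∀ q ∈ D, 0 ≤ f q
  fb : ∃ M : ℝ, ∀ q ∈ D, f q ≤ M
  zc : ContinuousOn z (closure D)
  z2 : ContDiffOn ℝ 2 z D
  pde : ∀ q ∈ D, -lap2 z q = f q
  bc : ∀ q ∈ frontier D, z q = 0

lemma Adm.lap {D : Set (ℝ × ℝ)} {f z : ℝ × ℝ → ℝ} (h : Adm D f z) (hD : IsOpen D) {q : ℝ × ℝ}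
    (hq : q ∈ D) : lapF z q = - f q := by
  rw [← h.pde q hq, lap2_eq_lapF (h.z2.contDiffAt (hD.mem_nhds hq))]; ring

lemma sq_contDiff (a : ℝ × ℝ) : ContDiff ℝ 2 (fun p : ℝ × ℝ => (p.1 - a.1) ^ 2 + (p.2 - a.2) ^ 2) := by
  fun_prop

lemma sq_ddx (a p : ℝ × ℝ) : ddx (fun p : ℝ × ℝ => (p.1 - a.1) ^ 2 + (p.2 - a.2) ^ 2) p =
    2 * (p.1 - a.1) := by
  have h : DifferentiableAt ℝ (fun p : ℝ × ℝ => (p.1 - a.1) ^ 2 + (p.2 - a.2) ^ 2) p := by fun_prop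
  have h1 := slice_x h
  have h2 : HasDerivAt (fun s : ℝ => (s - a.1) ^ 2 + (p.2 - a.2) ^ 2) (2 * (p.1 - a.1)) p.1 := by
    have := (((hasDerivAt_id p.1).sub_const a.1).pow 2).add_const ((p.2 - a.2) ^ 2)
    refine this.congr_deriv ?_
    simp
  exact h1.unique h2
lemma sq_ddy (a p : ℝ × ℝ) : ddy (fun p : ℝ × ℝ => (p.1 - a.1) ^ 2 + (p.2 - a.2) ^ 2) p =
    2 * (p.2 - a.2) := by
  have h : DifferentiableAt ℝ (fun p : ℝ × ℝ => (p.1 - a.1) ^ 2 + (p.2 - a.2) ^ 2) p := by fun_prop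
  have h1 := slice_y h
  have h2 : HasDerivAt (fun s : ℝ => (p.1 - a.1) ^ 2 + (s - a.2) ^ 2) (2 * (p.2 - a.2)) p.2 := by
    have := (((hasDerivAt_id p.2).sub_const a.2).pow 2).const_add ((p.1 - a.1) ^ 2)
    refine this.congr_deriv ?_
    simp
  exact h1.unique h2

lemma sq_grad2 (a p : ℝ × ℝ) : grad2 (fun p : ℝ × ℝ => (p.1 - a.1) ^ 2 + (p.2 - a.2) ^ 2) p =
    4 * ((p.1 - a.1) ^ 2 + (p.2 - a.2) ^ 2) := by
  rw [grad2, sq_ddx, sq_ddy]; ring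

lemma sq_lapF (a p : ℝ × ℝ) : lapF (fun p : ℝ × ℝ => (p.1 - a.1) ^ 2 + (p.2 - a.2) ^ 2) p = 4 := by
  have hx : ddx (fun p : ℝ × ℝ => (p.1 - a.1) ^ 2 + (p.2 - a.2) ^ 2) = fun p => 2 * (p.1 - a.1) :=
    funext (sq_ddx a)
  have hy : ddy (fun p : ℝ × ℝ => (p.1 - a.1) ^ 2 + (p.2 - a.2) ^ 2) = fun p => 2 * (p.2 - a.2) :=
    funext (sq_ddy a)
  rw [lapF, hx, hy]
  have h1 : ddx (fun p : ℝ × ℝ => 2 * (p.1 - a.1)) p = 2 := by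
    have h1 := slice_x (u := fun p : ℝ × ℝ => 2 * (p.1 - a.1)) (p := p) (by fun_prop)
    have h2 : HasDerivAt (fun s : ℝ => 2 * (s - a.1)) 2 p.1 := by
      simpa using ((hasDerivAt_id p.1).sub_const a.1).const_mul 2
    exact h1.unique h2
  have h2 : ddy (fun p : ℝ × ℝ => 2 * (p.2 - a.2)) p = 2 := by
    have h1 := slice_y (u := fun p : ℝ × ℝ => 2 * (p.2 - a.2)) (p := p) (by fun_prop)
    have h2 : HasDerivAt (fun s : ℝ => 2 * (s - a.2)) 2 p.2 := by
      simpa using ((hasDerivAt_id p.2).sub_const a.2).const_mul 2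
    exact h1.unique h2
  rw [h1, h2]; norm_num

lemma mem_or_frontier {D : Set (ℝ × ℝ)} {p : ℝ × ℝ} (hp : p ∈ closure D) :
    p ∈ D ∨ p ∈ frontier D := by
  by_cases h : p ∈ interior D
  · exact Or.inl (interior_subset h)
  · exact Or.inr ⟨hp, h⟩

lemma Adm.nonneg {D : Set (ℝ × ℝ)} {f z : ℝ × ℝ → ℝ} (h : Adm D f z) (hD : IsOpen D)
    (hb : Bornology.IsBounded D) {q : ℝ × ℝ} (hq : q ∈ D) : 0 ≤ z q := by
  have hK : IsCompact (closure D) := hb.isCompact_closure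
  set s : ℝ × ℝ → ℝ := fun p => (p.1 - 0) ^ 2 + (p.2 - 0) ^ 2 with hs
  have hsc : Continuous s := by fun_prop
  obtain ⟨M, hM⟩ := hK.bddAbove_image hsc.continuousOn
  have hM' : ∀ p ∈ closure D, s p ≤ M := fun p hp => hM (mem_image_of_mem _ hp)
  have key : ∀ ε > 0, -(ε * M) ≤ z q := by
    intro ε hε
    have hwc : ContinuousOn (fun x => z x - ε * s x) (closure D) :=
      h.zc.sub (by fun_prop)
    obtain ⟨p, hp, hmin⟩ := hK.exists_isMinOn ⟨q, subset_closure hq⟩ hwc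
    have hs0 : 0 ≤ s q := by simp only [hs]; positivity
    have hpq : z p - ε * s p ≤ z q - ε * s q := hmin (subset_closure hq)
    rcases mem_or_frontier hp with hpD | hpF
    · exfalso
      have hzp := h.z2.contDiffAt (hD.mem_nhds hpD)
      have hsp : ContDiffAt ℝ 2 s p := (sq_contDiff (0,0)).contDiffAt
      have hloc : IsLocalMin (fun x => z x - ε * s x) p :=
        hmin.isLocalMin (mem_of_superset (hD.mem_nhds hpD) subset_closure)
      have h1 := lapF_nonneg_of_min hloc (hzp.sub (contDiffAt_const.mul hsp))
      rw [lapF_sub_mul ε hzp hsp, h.lap hD hpD, show lapF s p = 4 from sq_lapF (0,0) p] at h1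
      have := h.f0 p hpD
      nlinarith
    · rw [h.bc p hpF] at hpq
      have := mul_le_mul_of_nonneg_left (hM' p hp) hε.le
      have := mul_nonneg hε.le hs0
      linarith
  by_contra hneg
  push Not at hneg
  have hMnn : 0 ≤ M := le_trans (by simp only [hs]; positivity) (hM' q (subset_closure hq))
  have := key (-z q / (2 * (M + 1))) (by apply div_pos <;> linarith)
  have h2 : -z q / (2 * (M + 1)) * M ≤ -z q / 2 := by
    rw [div_mul_eq_mul_div, div_le_div_iff₀ (by linarith) (by norm_num)]
    nlinarith
  linarith

/-- Hopf comparison -/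
lemma Adm.hopf {D : Set (ℝ × ℝ)} {f z : ℝ × ℝ → ℝ} (h : Adm D f z) (hD : IsOpen D)
    (hb : Bornology.IsBounded D) {ψ : ℝ × ℝ → ℝ} (hψ : ContDiff ℝ 2 ψ)
    (hpos : ∀ x, 0 < ψ x → x ∈ D) {K : Set (ℝ × ℝ)}
    (hsubh : ∀ x, 0 ≤ ψ x → x ∉ K → 0 < lapF ψ x) {m I : ℝ} (hm : 0 < m) (hI : 0 ≤ I)
    (hψm : ∀ x ∈ K, ψ x ≤ m) (hzI : ∀ x ∈ K, I ≤ z x) {x : ℝ × ℝ} (hx : x ∈ D) :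
    I / m * ψ x ≤ z x := by
  have hK : IsCompact (closure D) := hb.isCompact_closure
  have hwc : ContinuousOn (fun x => z x - I / m * ψ x) (closure D) :=
    h.zc.sub (hψ.continuous.continuousOn.const_smul (I / m))
  obtain ⟨p, hp, hmin⟩ := hK.exists_isMinOn ⟨x, subset_closure hx⟩ hwc
  have hpx : z p - I / m * ψ p ≤ z x - I / m * ψ x := hmin (subset_closure hx)
  suffices 0 ≤ z p - I / m * ψ p by linarith
  have hIm : 0 ≤ I / m := by positivity
  by_contra hneg
  push Not at hneg
  rcases mem_or_frontier hp with hpD | hpF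
  · have hz0 := h.nonneg hD hb hpD
    have hIψ : 0 < I / m * ψ p := by linarith
    have hψp : 0 < ψ p := pos_of_mul_pos_right hIψ hIm
    have hIm' : 0 < I / m := pos_of_mul_pos_left hIψ hψp.le
    by_cases hpK : p ∈ K
    · have h1 := hψm p hpK
      have h2 := hzI p hpK
      have : I / m * ψ p ≤ I / m * m := by gcongr
      rw [div_mul_cancel₀ _ hm.ne'] at this
      linarith
    · have hzp := h.z2.contDiffAt (hD.mem_nhds hpD)
      have hloc : IsLocalMin (fun x => z x - I / m * ψ x) p :=
        hmin.isLocalMin (mem_of_superset (hD.mem_nhds hpD) subset_closure)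
      have h1 := lapF_nonneg_of_min hloc (hzp.sub (contDiffAt_const.mul hψ.contDiffAt))
      rw [lapF_sub_mul _ hzp hψ.contDiffAt, h.lap hD hpD] at h1
      have := h.f0 p hpD
      have := mul_pos hIm' (hsubh p hψp.le hpK)
      linarith
  · have hψp : ψ p ≤ 0 := by
      by_contra hc
      have := hpos p (not_le.1 hc)
      rw [hD.frontier_eq] at hpF
      exact hpF.2 this
    rw [h.bc p hpF] at hneg
    have := mul_nonneg hIm (neg_nonneg.2 hψp)
    linarith

lemma lapF_eq_zero {φ : ℝ × ℝ → ℝ} {x : ℝ × ℝ} (hx : x ∉ tsupport φ) : lapF φ x = 0 := by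
  have h (v : ℝ × ℝ) : fderiv ℝ (fun x => fderiv ℝ φ x v) x v = 0 := by
    have s1 : tsupport (fun x => fderiv ℝ φ x v) ⊆ tsupport φ := tsupport_fderiv_apply_subset ℝ v
    have s2 : tsupport (fun x => fderiv ℝ (fun x => fderiv ℝ φ x v) x v) ⊆ tsupport φ :=
      (tsupport_fderiv_apply_subset ℝ v).trans s1
    by_contra hne
    exact hx (s2 (subset_tsupport _ hne))
  have := h (1,0)
  have := h (0,1)
  change fderiv ℝ (fun x => fderiv ℝ φ x (1,0)) x (1,0) +
    fderiv ℝ (fun x => fderiv ℝ φ x (0,1)) x (0,1) = 0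
  rw [h, h]; simp

lemma Adm.dual {D : Set (ℝ × ℝ)} {f z : ℝ × ℝ → ℝ} (h : Adm D f z) (hD : IsOpen D)
    (hb : Bornology.IsBounded D) {φ : ℝ × ℝ → ℝ} (hφ : ContDiff ℝ 2 φ) (hc : HasCompactSupport φ)
    (hs : tsupport φ ⊆ D) (hφ0 : ∀ x, 0 ≤ φ x) {A B : ℝ × ℝ → ℝ} (hA : Measurable A)
    (hB : Measurable B) (hA0 : ∀ x, 0 ≤ A x) (hB0 : ∀ x, 0 ≤ B x)
    (hAB : ∀ x ∈ D, - lapF φ x ≤ A x - B x) :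
    (∫⁻ x in D, ENNReal.ofReal (f x * φ x)) + (∫⁻ x in D, ENNReal.ofReal (z x * B x)) ≤
      ∫⁻ x in D, ENNReal.ofReal (z x * A x) := by
  have hDm := hD.measurableSet
  have hz0 : ∀ x ∈ D, 0 ≤ z x := fun x hx => h.nonneg hD hb hx
  have hzm : AEStronglyMeasurable z (volume.restrict D) :=
    (h.z2.continuousOn).aestronglyMeasurable hDm
  by_cases hfin : ∫⁻ x in D, ENNReal.ofReal (z x * A x) = ⊤
  · rw [hfin]; exact le_top
  have ae0 : ∀ {P : ℝ × ℝ → Prop}, (∀ x ∈ D, P x) → ∀ᵐ x ∂(volume.restrict D), P x :=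
    fun hP => (ae_restrict_iff' hDm).2 (Eventually.of_forall hP)
  have iA : IntegrableOn (fun x => z x * A x) D := by
    refine ⟨hzm.mul hA.aestronglyMeasurable, ?_⟩
    rw [hasFiniteIntegral_iff_ofReal (ae0 fun x hx => mul_nonneg (hz0 x hx) (hA0 x))]
    exact lt_top_iff_ne_top.2 hfin
  obtain ⟨i1, i2, i3⟩ := ibp_lap hD h.z2 hφ hc hs
  have iφ : IntegrableOn (fun x => z x * lapF φ x) D := i1.integrableOn
  have hpt : ∀ x ∈ D, z x * B x ≤ z x * A x + z x * lapF φ x := by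
    intro x hx
    have := mul_le_mul_of_nonneg_left (hAB x hx) (hz0 x hx)
    nlinarith
  have iB : IntegrableOn (fun x => z x * B x) D := by
    refine Integrable.mono' (iA.add iφ) (hzm.mul hB.aestronglyMeasurable) (ae0 ?_)
    intro x hx
    rw [Real.norm_of_nonneg (mul_nonneg (hz0 x hx) (hB0 x))]
    exact hpt x hx
  have hfe : ∀ x ∈ D, lapF z x * φ x = - (f x * φ x) := by
    intro x hx; rw [h.lap hD hx]; ring
  have iF : IntegrableOn (fun x => f x * φ x) D := by
    have : IntegrableOn (fun x => -(lapF z x * φ x)) D := i2.integrableOn.neg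
    refine this.congr_fun ?_ hDm
    intro x hx; simp [hfe x hx]
  have e1 : ∫ x in D, z x * lapF φ x = ∫ x, z x * lapF φ x := by
    apply setIntegral_eq_integral_of_forall_compl_eq_zero
    intro x hx
    rw [lapF_eq_zero (fun h => hx (hs h)), mul_zero]
  have e2 : ∫ x in D, lapF z x * φ x = ∫ x, lapF z x * φ x := by
    apply setIntegral_eq_integral_of_forall_compl_eq_zero
    intro x hx
    rw [image_eq_zero_of_notMem_tsupport (fun h => hx (hs h)), mul_zero]
  have e3 : ∫ x in D, lapF z x * φ x = - ∫ x in D, f x * φ x := by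
    rw [← integral_neg]
    exact setIntegral_congr_fun hDm hfe
  have hmono : ∫ x in D, z x * B x ≤ ∫ x in D, (z x * A x + z x * lapF φ x) :=
    setIntegral_mono_on iB (iA.add iφ) hDm hpt
  rw [integral_add iA iφ] at hmono
  rw [← ofReal_integral_eq_lintegral_ofReal iF (ae0 fun x hx => mul_nonneg (h.f0 x hx) (hφ0 x)),
    ← ofReal_integral_eq_lintegral_ofReal iB (ae0 fun x hx => mul_nonneg (hz0 x hx) (hB0 x)),
    ← ofReal_integral_eq_lintegral_ofReal iA (ae0 fun x hx => mul_nonneg (hz0 x hx) (hA0 x)),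
    ← ENNReal.ofReal_add]
  · apply ENNReal.ofReal_le_ofReal
    linarith
  · exact setIntegral_nonneg hDm fun x hx => mul_nonneg (h.f0 x hx) (hφ0 x)
  · exact setIntegral_nonneg hDm fun x hx => mul_nonneg (hz0 x hx) (hB0 x)

open Topology
open scoped NNReal ENNReal

lemma barrier_dual {D : Set (ℝ × ℝ)} (hD : IsOpen D)
    (hb : Bornology.IsBounded D) {ψ : ℝ × ℝ → ℝ} (hψ : ContDiff ℝ 2 ψ)
    (hcomp : IsCompact {x | 0 ≤ ψ x})
    (hpos : ∀ x, 0 < ψ x → x ∈ D) {K : Set (ℝ × ℝ)} (hK : IsCompact K) (hKD : K ⊆ D)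
    (hsubh : ∀ x, 0 ≤ ψ x → x ∉ K → 0 < lapF ψ x) :
    ∃ C : ℝ≥0, ∀ f z, Adm D f z →
      ∫⁻ x in D, ENNReal.ofReal (f x * max (ψ x) 0) ≤ C * ∫⁻ x in K, ENNReal.ofReal (z x) := by
  have hlc : Continuous (lapF ψ) := continuous_iff_continuousAt.2 fun x => lapF_cont hψ.contDiffAt
  obtain ⟨M, hM⟩ := hK.bddAbove_image (hlc.abs.continuousOn)
  have hM' : ∀ x ∈ K, |lapF ψ x| ≤ max M 0 := fun x hx =>
    (hM (mem_image_of_mem _ hx)).trans (le_max_left _ _)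
  set N := max M 0 with hN
  have hN0 : 0 ≤ N := le_max_right _ _
  refine ⟨8 * N.toNNReal, fun f z h => ?_⟩
  have hKm := hK.measurableSet
  have step : ∀ n : ℕ, ∫⁻ x in D, ENNReal.ofReal (f x * ((1 / (n + 1 : ℝ)) *
      GG (ψ x / (1 / (n + 1 : ℝ)) - 1))) ≤ N.toNNReal * ∫⁻ x in K, ENNReal.ofReal (z x) := by
    intro n
    set ε : ℝ := 1 / (n + 1 : ℝ) with hε
    have hε0 : 0 < ε := by positivity
    set φ : ℝ × ℝ → ℝ := fun x => ε * GG (ψ x / ε - 1) with hφdef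
    have hφ : ContDiff ℝ 2 φ :=
      contDiff_const.mul (GG_contDiff.comp ((hψ.div_const ε).sub contDiff_const))
    have hsup : tsupport φ ⊆ {x | ε ≤ ψ x} := by
      apply closure_minimal _ (isClosed_le continuous_const hψ.continuous)
      intro x hx
      by_contra hlt
      simp only [mem_setOf_eq, not_le] at hlt
      apply hx
      have : ψ x / ε - 1 ≤ 0 := by
        rw [sub_nonpos, div_le_one hε0]; exact hlt.le
      simp [hφdef, GG_zero this]
    have hc : HasCompactSupport φ := by
      refine hcomp.of_isClosed_subset (isClosed_tsupport _) (hsup.trans ?_)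
      intro x hx
      exact hε0.le.trans hx
    have hs : tsupport φ ⊆ D := fun x hx => hpos x (hε0.trans_le (hsup hx))
    have hlap : ∀ x, lapF φ x = GG2 (ψ x / ε - 1) / ε * grad2 ψ x + GG1 (ψ x / ε - 1) * lapF ψ x := by
      intro x
      apply lapF_comp (H := fun t => ε * GG (t / ε - 1)) (H1 := fun t => GG1 (t / ε - 1)) hψ.contDiffAt
      · filter_upwards with t
        have := ((GG_deriv (t / ε - 1)).comp t (((hasDerivAt_id t).div_const ε).sub_const 1)).const_mul ε
        refine this.congr_deriv ?_
        field_simp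
      · have := (GG1_deriv (ψ x / ε - 1)).comp (ψ x) (((hasDerivAt_id (ψ x)).div_const ε).sub_const 1)
        refine this.congr_deriv ?_
        field_simp
    have := h.dual hD hb hφ hc hs (fun x => mul_nonneg hε0.le (GG_nonneg _))
      (A := K.indicator fun _ => N) (B := fun _ => 0) (measurable_const.indicator hKm)
      measurable_const (fun x => indicator_nonneg (fun _ _ => hN0) x) (fun _ => le_rfl) (by
        intro x hx
        rw [hlap x, sub_zero]
        have t1 : 0 ≤ GG2 (ψ x / ε - 1) / ε * grad2 ψ x :=
          mul_nonneg (div_nonneg (GG2_nonneg _) hε0.le) (by unfold grad2; positivity)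
        have g0 := GG1_nonneg (ψ x / ε - 1)
        have g1 := GG1_le (ψ x / ε - 1)
        by_cases hxK : x ∈ K
        · rw [indicator_of_mem hxK]
          have h1 := hM' x hxK
          have h2 := neg_abs_le (lapF ψ x)
          have h3 : GG1 (ψ x / ε - 1) * |lapF ψ x| ≤ 1 * N := by gcongr
          nlinarith
        · rw [indicator_of_notMem hxK]
          rcases le_or_gt 0 (ψ x) with h0 | h0
          · have := mul_nonneg g0 (hsubh x h0 hxK).le
            linarith
          · have : ψ x / ε - 1 ≤ 0 := by
              have : ψ x / ε ≤ 0 := div_nonpos_of_nonpos_of_nonneg h0.le hε0.le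
              linarith
            rw [GG1_zero this]
            linarith)
    refine (le_trans le_self_add this).trans ?_
    calc ∫⁻ x in D, ENNReal.ofReal (z x * K.indicator (fun _ => N) x)
        = ∫⁻ x in D, K.indicator (fun x => N.toNNReal * ENNReal.ofReal (z x)) x := by
          refine setLIntegral_congr_fun hD.measurableSet ?_
          intro x hx
          by_cases hxK : x ∈ K
          · simp only [indicator_of_mem hxK]
            rw [mul_comm, ENNReal.ofReal_mul hN0]
            rfl
          · simp [indicator_of_notMem hxK]
      _ ≤ ∫⁻ x, K.indicator (fun x => N.toNNReal * ENNReal.ofReal (z x)) x :=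
          setLIntegral_le_lintegral _ _
      _ = ∫⁻ x in K, N.toNNReal * ENNReal.ofReal (z x) := lintegral_indicator hKm _
      _ = _ := by
        rw [lintegral_const_mul' _ _ (by simp)]
  have hmeas : ∀ n : ℕ, Measurable (fun x => 8 * ENNReal.ofReal (f x * ((1 / (n + 1 : ℝ)) *
      GG (ψ x / (1 / (n + 1 : ℝ)) - 1)))) := by
    intro n
    have : Measurable fun x => GG (ψ x / (1 / (n + 1 : ℝ)) - 1) :=
      (GG_contDiff.continuous.comp ((hψ.continuous.div_const _).sub continuous_const)).measurable
    exact ((h.meas.mul (this.const_mul _)).ennreal_ofReal).const_mul _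
  calc ∫⁻ x in D, ENNReal.ofReal (f x * max (ψ x) 0)
      ≤ ∫⁻ x in D, liminf (fun n : ℕ => 8 * ENNReal.ofReal (f x * ((1 / (n + 1 : ℝ)) *
          GG (ψ x / (1 / (n + 1 : ℝ)) - 1)))) atTop := by
        refine setLIntegral_mono' hD.measurableSet ?_
        intro x hx
        refine le_liminf_of_le (by isBoundedDefault) ?_
        rcases le_or_gt (ψ x) 0 with h0 | h0
        · filter_upwards with n
          simp [max_eq_right h0]
        · have ht : Tendsto (fun n : ℕ => 1 / ((n : ℝ) + 1)) atTop (𝓝 0) :=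
            tendsto_one_div_add_atTop_nhds_zero_nat
          filter_upwards [ht.eventually (gt_mem_nhds (show (0:ℝ) < ψ x / 2 by positivity))] with n hn
          have hε0 : (0:ℝ) < 1 / (n + 1 : ℝ) := by positivity
          generalize 1 / (n + 1 : ℝ) = ε at hn hε0 ⊢
          rw [max_eq_left h0.le]
          have h8 : (8 : ℝ≥0∞) = ENNReal.ofReal 8 := by simp
          rw [h8, ← ENNReal.ofReal_mul (by norm_num)]
          apply ENNReal.ofReal_le_ofReal
          have hl := GG_lower (t := ψ x / ε) (by rw [le_div_iff₀ hε0]; linarith)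
          have h2 : ψ x ≤ 8 * (ε * GG (ψ x / ε - 1)) := by
            calc ψ x = 8 * (ε * (ψ x / ε / 8)) := by field_simp
              _ ≤ _ := by gcongr
          have := mul_le_mul_of_nonneg_left h2 (h.f0 x hx)
          linarith
    _ ≤ liminf (fun n : ℕ => ∫⁻ x in D, 8 * ENNReal.ofReal (f x * ((1 / (n + 1 : ℝ)) *
          GG (ψ x / (1 / (n + 1 : ℝ)) - 1)))) atTop := lintegral_liminf_le hmeas
    _ ≤ 8 * (N.toNNReal * ∫⁻ x in K, ENNReal.ofReal (z x)) := by
        refine liminf_le_of_frequently_le' (Frequently.of_forall fun n => ?_)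
        rw [lintegral_const_mul' _ _ (by simp)]
        gcongr
        exact step n
    _ = _ := by push_cast; ring

open Topology
open scoped NNReal ENNReal

def sqd (y p : ℝ × ℝ) : ℝ := (p.1 - y.1) ^ 2 + (p.2 - y.2) ^ 2

def kker (w : ℝ × ℝ) : ℝ := 1 / (1 + w.1 ^ 2 + w.2 ^ 2) ^ 2

lemma norm_sq_le (w : ℝ × ℝ) : ‖w‖ ^ 2 ≤ w.1 ^ 2 + w.2 ^ 2 := by
  rcases max_choice ‖w.1‖ ‖w.2‖ with h | h
  · rw [Prod.norm_def, h, Real.norm_eq_abs, sq_abs]; nlinarith [sq_nonneg w.2]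
  · rw [Prod.norm_def, h, Real.norm_eq_abs, sq_abs]; nlinarith [sq_nonneg w.1]

lemma kker_pos (w : ℝ × ℝ) : 0 < kker w := by unfold kker; positivity

lemma kker_le (w : ℝ × ℝ) : kker w ≤ 1 / (1 + ‖w‖ ^ 2) ^ 2 := by
  unfold kker
  have := norm_sq_le w
  gcongr 1 / ?_ ^ 2
  linarith

lemma kker_cont : Continuous kker := by
  unfold kker
  refine Continuous.div (by fun_prop) (by fun_prop) fun w => ?_
  positivity

lemma kker_integrable : Integrable kker := by
  have h := integrable_rpow_neg_one_add_norm_sq (E := ℝ × ℝ) (μ := volume) (r := 4)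
    (by simp; norm_num)
  refine h.mono' kker_cont.aestronglyMeasurable (Eventually.of_forall fun w => ?_)
  rw [Real.norm_of_nonneg (kker_pos w).le]
  refine (kker_le w).trans (le_of_eq ?_)
  rw [show (-4 / 2 : ℝ) = -(2 : ℕ) by norm_num, Real.rpow_neg (by positivity), Real.rpow_natCast]
  simp

lemma kker_int_pos : 0 < ∫ w, kker w := by
  rw [integral_pos_iff_support_of_nonneg (fun w => (kker_pos w).le) kker_integrable]
  have : Function.support kker = univ := by
    ext w; simp [(kker_pos w).ne']
  rw [this]; simp

lemma kker_decay : Tendsto (fun x : ℝ × ℝ => ‖x‖ ^ Module.finrank ℝ (ℝ × ℝ) *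
    (kker x / ∫ w, kker w)) (Bornology.cobounded (ℝ × ℝ)) (𝓝 0) := by
  have hI := kker_int_pos
  have h1 : Tendsto (fun x : ℝ × ℝ => ‖x‖⁻¹ * (∫ w, kker w)⁻¹) (Bornology.cobounded (ℝ × ℝ)) (𝓝 0) := by
    have := (tendsto_inv_atTop_zero.comp (tendsto_norm_cobounded_atTop (E := ℝ × ℝ))).mul_const
      (∫ w, kker w)⁻¹
    simpa using this
  refine squeeze_zero (fun x => ?_) (fun x => ?_) h1
  · have := (kker_pos x).le
    positivity
  · have hf : Module.finrank ℝ (ℝ × ℝ) = 2 := by simp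
    rw [hf, div_eq_mul_inv, ← mul_assoc]
    gcongr
    refine (mul_le_mul_of_nonneg_left (kker_le x) (by positivity)).trans ?_
    rcases (norm_nonneg x).eq_or_lt with h | h
    · rw [← h]; simp
    · rw [mul_one_div, div_le_iff₀ (by positivity), inv_mul_eq_div, le_div_iff₀ h]
      nlinarith [sq_nonneg (‖x‖ - 1), sq_nonneg (‖x‖ ^ 2), h, sq_nonneg (‖x‖ ^ 2 - ‖x‖)]

lemma GG2_lower {u : ℝ} (h1 : 1 / 4 ≤ u) (h2 : u ≤ 8) : 1 / 10000 ≤ GG2 u := by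
  have : ¬ u ≤ 0 := by linarith
  simp only [GG2, this, if_false]
  rw [div_le_div_iff₀ (by norm_num) (by positivity)]
  have : (1 + u) ^ 4 ≤ 9 ^ 4 := by gcongr; linarith
  nlinarith

lemma mv_eps {D : Set (ℝ × ℝ)} (hD : IsOpen D) (hb : Bornology.IsBounded D) {R : ℝ} (hR : 0 < R)
    {y : ℝ × ℝ} (hy : {p | sqd y p ≤ R ^ 2} ⊆ D) {f z : ℝ × ℝ → ℝ} (h : Adm D f z)
    {ε : ℝ} (hε : 0 < ε) (hεR : ε ≤ R / 4) :
    ∫⁻ x in D, ENNReal.ofReal (z x *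
      ({p | R ^ 2 / 16 ≤ sqd y p ∧ sqd y p ≤ R ^ 2 / 4}.indicator (fun _ => 1 / (20000 * R ^ 2)) x)) ≤
    ∫⁻ x in D, ENNReal.ofReal (z x *
      ({p | sqd y p ≤ R ^ 2}.indicator (fun p => 2 * ε ^ 2 / (sqd y p + ε ^ 2) ^ 2) x)) := by
  have hsc : Continuous (sqd y) := by unfold sqd; fun_prop
  have hs2 : ContDiff ℝ 2 (sqd y) := sq_contDiff y
  have hs0 : ∀ p, 0 ≤ sqd y p := fun p => by unfold sqd; positivity
  have hden : ∀ p, 0 < sqd y p + ε ^ 2 := fun p => by have := hs0 p; positivity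
  set u : ℝ × ℝ → ℝ := fun p => -(1 / 2) * Real.log ((sqd y p + ε ^ 2) / R ^ 2) with hu
  have hu2 : ContDiff ℝ 2 u := by
    refine contDiff_const.mul (ContDiff.log ((hs2.add contDiff_const).div_const _) fun p => ?_)
    have := hden p
    positivity
  have hupos : ∀ p, ¬ u p ≤ 0 → sqd y p + ε ^ 2 ≤ R ^ 2 := by
    intro p hp
    by_contra hlt
    apply hp
    push Not at hlt
    have : 0 ≤ Real.log ((sqd y p + ε ^ 2) / R ^ 2) :=
      Real.log_nonneg (by rw [le_div_iff₀ (by positivity)]; linarith)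
    simp only [hu]; linarith
  have hlogd : ∀ t : ℝ, 0 ≤ t →
      HasDerivAt (fun t => -(1 / 2) * Real.log ((t + ε ^ 2) / R ^ 2)) (-(1/2) * (t + ε ^ 2)⁻¹) t := by
    intro t ht
    have hp : 0 < t + ε ^ 2 := by positivity
    have := ((((hasDerivAt_id t).add_const (ε ^ 2)).div_const (R ^ 2)).log
      (by simp; constructor <;> positivity)).const_mul (-(1 / 2))
    refine this.congr_deriv ?_
    simp
    field_simp
  have hgr : ∀ p, grad2 u p = sqd y p / (sqd y p + ε ^ 2) ^ 2 := by
    intro p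
    rw [hu, grad2_comp (u := sqd y) (H := fun t => -(1 / 2) * Real.log ((t + ε ^ 2) / R ^ 2))
      (hs2.differentiable (by norm_num) p) (hlogd _ (hs0 p)),
      show grad2 (sqd y) p = 4 * sqd y p from sq_grad2 y p]
    have := hden p
    field_simp
    ring
  have hlogd' : ∀ t : ℝ, -ε ^ 2 < t →
      HasDerivAt (fun t => -(1 / 2) * Real.log ((t + ε ^ 2) / R ^ 2)) (-(1/2) * (t + ε ^ 2)⁻¹) t := by
    intro t ht
    have hp : 0 < t + ε ^ 2 := by linarith
    have := ((((hasDerivAt_id t).add_const (ε ^ 2)).div_const (R ^ 2)).log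
      (by simp; constructor <;> positivity)).const_mul (-(1 / 2))
    refine this.congr_deriv ?_
    simp
    field_simp
  have hlu : ∀ p, lapF u p = - (2 * ε ^ 2 / (sqd y p + ε ^ 2) ^ 2) := by
    intro p
    have hpd := hden p
    have hd2 : HasDerivAt (fun t => -(1/2) * (t + ε ^ 2)⁻¹) (1/2 * ((sqd y p + ε ^ 2) ^ 2)⁻¹) (sqd y p) := by
      have := ((((hasDerivAt_id (sqd y p)).add_const (ε ^ 2)).inv (by simpa using hpd.ne'))).const_mul (-(1/2))
      refine this.congr_deriv ?_
      simp
      field_simp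
    have := lapF_comp (u := sqd y) (p := p)
      (H := fun t => -(1 / 2) * Real.log ((t + ε ^ 2) / R ^ 2)) (H1 := fun t => -(1/2) * (t + ε ^ 2)⁻¹)
      hs2.contDiffAt (by
        filter_upwards [Ioi_mem_nhds (show -ε ^ 2 < sqd y p by nlinarith [hs0 p])] with t ht
        exact hlogd' t ht) hd2
    rw [hu, this, show grad2 (sqd y) p = 4 * sqd y p from sq_grad2 y p,
      show lapF (sqd y) p = 4 from sq_lapF y p]
    field_simp
    ring
  set φ : ℝ × ℝ → ℝ := fun p => GG (u p) with hφd
  have hφ : ContDiff ℝ 2 φ := GG_contDiff.comp hu2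
  have hlφ : ∀ p, lapF φ p = GG2 (u p) * grad2 u p + GG1 (u p) * lapF u p := fun p =>
    lapF_comp hu2.contDiffAt (Eventually.of_forall GG_deriv) (GG1_deriv _)
  have hsup : tsupport φ ⊆ {p | sqd y p ≤ R ^ 2} := by
    apply closure_minimal _ (isClosed_le hsc continuous_const)
    intro x hx
    have : ¬ u x ≤ 0 := fun hc => hx (by simp [hφd, GG_zero hc])
    have := hupos x this
    change sqd y x ≤ R ^ 2
    nlinarith
  have hcl : IsClosed {p | sqd y p ≤ R ^ 2} := isClosed_le hsc continuous_const
  have hcpt : IsCompact {p | sqd y p ≤ R ^ 2} :=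
    Metric.isCompact_of_isClosed_isBounded hcl (hb.subset hy)
  have hann : MeasurableSet {p | R ^ 2 / 16 ≤ sqd y p ∧ sqd y p ≤ R ^ 2 / 4} :=
    ((isClosed_le continuous_const hsc).inter (isClosed_le hsc continuous_const)).measurableSet
  refine le_trans le_add_self (h.dual hD hb hφ (hcpt.of_isClosed_subset (isClosed_tsupport _) hsup)
    (hsup.trans hy) (fun x => GG_nonneg _) ?_ (measurable_const.indicator hann) ?_ ?_ ?_)
  · refine Measurable.indicator ?_ hcl.measurableSet
    have := hsc.measurable
    fun_prop
  · intro x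
    exact indicator_nonneg (fun p _ => by positivity) x
  · intro x
    exact indicator_nonneg (fun p _ => by positivity) x
  · intro x _
    rw [hlφ, hgr, hlu]
    have hq0 : 0 ≤ 2 * ε ^ 2 / (sqd y x + ε ^ 2) ^ 2 := by positivity
    have hA : GG1 (u x) * (2 * ε ^ 2 / (sqd y x + ε ^ 2) ^ 2) ≤
        {p | sqd y p ≤ R ^ 2}.indicator (fun p => 2 * ε ^ 2 / (sqd y p + ε ^ 2) ^ 2) x := by
      by_cases hx : x ∈ {p | sqd y p ≤ R ^ 2}
      · rw [indicator_of_mem hx]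
        nlinarith [GG1_le (u x)]
      · rw [indicator_of_notMem hx, GG1_zero, zero_mul]
        by_contra hc
        have := hupos x hc
        apply hx
        change sqd y x ≤ R ^ 2
        nlinarith
    have hB : {p | R ^ 2 / 16 ≤ sqd y p ∧ sqd y p ≤ R ^ 2 / 4}.indicator
        (fun _ => 1 / (20000 * R ^ 2)) x ≤ GG2 (u x) * (sqd y x / (sqd y x + ε ^ 2) ^ 2) := by
      by_cases hx : x ∈ {p | R ^ 2 / 16 ≤ sqd y p ∧ sqd y p ≤ R ^ 2 / 4}
      · rw [indicator_of_mem hx]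
        obtain ⟨hx1, hx2⟩ : R ^ 2 / 16 ≤ sqd y x ∧ sqd y x ≤ R ^ 2 / 4 := hx
        have he2 : ε ^ 2 ≤ R ^ 2 / 16 := by nlinarith
        have hR2 : 0 < R ^ 2 := by positivity
        have hq : 0 < (sqd y x + ε ^ 2) / R ^ 2 := div_pos (hden x) hR2
        have hq1 : (sqd y x + ε ^ 2) / R ^ 2 ≤ 5 / 16 := by
          rw [div_le_iff₀ hR2]; linarith
        have hq2 : 1 / 16 ≤ (sqd y x + ε ^ 2) / R ^ 2 := by
          rw [le_div_iff₀ hR2]; nlinarith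
        have l1 := Real.log_le_sub_one_of_pos hq
        have l2 := Real.log_le_sub_one_of_pos (inv_pos.2 hq)
        rw [Real.log_inv] at l2
        have l3 : ((sqd y x + ε ^ 2) / R ^ 2)⁻¹ ≤ 16 := by
          rw [inv_le_comm₀ hq (by norm_num)]; linarith
        have g := GG2_lower (u := u x) (by simp only [hu]; linarith) (by simp only [hu]; linarith)
        have k : 1 / (2 * R ^ 2) ≤ sqd y x / (sqd y x + ε ^ 2) ^ 2 := by
          rw [div_le_div_iff₀ (by positivity) (by have := hden x; positivity)]
          have : (sqd y x + ε ^ 2) ≤ 5 / 16 * R ^ 2 := by linarith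
          have h3 : (sqd y x + ε ^ 2) ^ 2 ≤ (5 / 16 * R ^ 2) ^ 2 := by
            have := hden x
            gcongr
          nlinarith
        calc 1 / (20000 * R ^ 2) = 1 / 10000 * (1 / (2 * R ^ 2)) := by field_simp; norm_num
          _ ≤ _ := by
            gcongr
      · rw [indicator_of_notMem hx]
        exact mul_nonneg (GG2_nonneg _) (div_nonneg (hs0 x) (by positivity))
    linarith

lemma mean_value {D : Set (ℝ × ℝ)} (hD : IsOpen D) (hb : Bornology.IsBounded D) {R : ℝ} (hR : 0 < R) :
    ∃ C : ℝ≥0, ∀ y, {p | sqd y p ≤ R ^ 2} ⊆ D → ∀ f z, Adm D f z →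
      ∫⁻ x in {p | R ^ 2 / 16 ≤ sqd y p ∧ sqd y p ≤ R ^ 2 / 4}, ENNReal.ofReal (z x) ≤
        C * ENNReal.ofReal (z y) := by
  set I0 := ∫ w, kker w with hI0
  have hI := kker_int_pos
  rw [← hI0] at hI
  refine ⟨(20000 * R ^ 2 * (2 * I0)).toNNReal, fun y hy f z h => ?_⟩
  have hsc : Continuous (sqd y) := by unfold sqd; fun_prop
  have hs0 : ∀ p, 0 ≤ sqd y p := fun p => by unfold sqd; positivity
  have hyS : sqd y y < R ^ 2 := by unfold sqd; simp; positivity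
  have hyD : y ∈ D := hy (le_of_lt hyS)
  set S := {p | sqd y p ≤ R ^ 2} with hS
  set An := {p | R ^ 2 / 16 ≤ sqd y p ∧ sqd y p ≤ R ^ 2 / 4} with hAn
  have hcl : IsClosed S := isClosed_le hsc continuous_const
  have hcpt : IsCompact S := Metric.isCompact_of_isClosed_isBounded hcl (hb.subset hy)
  have hann : MeasurableSet An :=
    ((isClosed_le continuous_const hsc).inter (isClosed_le hsc continuous_const)).measurableSet
  have hAnD : An ⊆ D := fun x hx => hy (by
    have : sqd y x ≤ R ^ 2 / 4 := hx.2
    change sqd y x ≤ R ^ 2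
    nlinarith)
  set g : ℝ × ℝ → ℝ := S.indicator z with hg
  have hgi : Integrable g :=
    ((h.z2.continuousOn.mono hy).integrableOn_compact hcpt).integrable_indicator hcl.measurableSet
  have hgc : ContinuousAt g y := by
    have : g =ᶠ[𝓝 y] z := by
      filter_upwards [(isOpen_lt hsc continuous_const).mem_nhds hyS] with x hx
      have hx : sqd y x < R ^ 2 := hx
      exact indicator_of_mem (show x ∈ S from hx.le) _
    exact (h.z2.continuousOn.continuousAt (hD.mem_nhds hyD)).congr this.symm
  have hgy : g y = z y := indicator_of_mem (show y ∈ S from hyS.le) _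
  have hg0 : ∀ x, 0 ≤ g x := fun x => indicator_nonneg (fun p hp => h.nonneg hD hb (hy hp)) x
  have ht := tendsto_integral_comp_smul_smul_of_integrable' (μ := volume)
    (φ := fun w => kker w / I0) (fun w => div_nonneg (kker_pos w).le hI.le)
    (by rw [integral_div, ← hI0, div_self hI.ne']) kker_decay hgi hgc
  have ht2 := (ENNReal.continuous_ofReal.tendsto _).comp (ht.const_mul (20000 * R ^ 2 * (2 * I0)))
  rw [hgy, ENNReal.ofReal_mul (by positivity)] at ht2
  refine ge_of_tendsto ht2 ?_
  filter_upwards [eventually_ge_atTop (4 / R), eventually_gt_atTop 0] with c hc hc0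
  have hm := mv_eps hD hb hR hy h (ε := 1 / c) (by positivity) (by
    rw [div_le_iff₀ hR] at hc
    rw [div_le_div_iff₀ hc0 (by norm_num)]; linarith)
  have e1 : ∫⁻ x in D, ENNReal.ofReal (z x * (An.indicator (fun _ => 1 / (20000 * R ^ 2)) x)) =
      ENNReal.ofReal (1 / (20000 * R ^ 2)) * ∫⁻ x in An, ENNReal.ofReal (z x) := by
    rw [← lintegral_const_mul' _ _ (by simp), ← lintegral_indicator hD.measurableSet,
      ← lintegral_indicator hann]
    congr 1; funext x
    by_cases hx : x ∈ An
    · rw [indicator_of_mem hx, indicator_of_mem (hAnD hx), indicator_of_mem hx, mul_comm,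
        ENNReal.ofReal_mul (by positivity)]
    · by_cases hxD : x ∈ D
      · rw [indicator_of_notMem hx, indicator_of_mem hxD, indicator_of_notMem hx]; simp
      · rw [indicator_of_notMem hx, indicator_of_notMem hxD]
  have hker : ∀ x, 2 * (1 / c) ^ 2 / (sqd y x + (1 / c) ^ 2) ^ 2 =
      2 * I0 * (c ^ 2 * (kker (c • (y - x)) / I0)) := by
    intro x
    have e : (1 + (c • (y - x)).1 ^ 2 + (c • (y - x)).2 ^ 2) = c ^ 2 * (sqd y x + (1 / c) ^ 2) := by
      simp [sqd]; field_simp; ring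
    unfold kker
    rw [e]
    have h2 : 0 < sqd y x + (1 / c) ^ 2 := by have := hs0 x; positivity
    generalize sqd y x + (1 / c) ^ 2 = d at h2
    field_simp
  have hf2 : Module.finrank ℝ (ℝ × ℝ) = 2 := by simp
  have e2 : ∫⁻ x in D, ENNReal.ofReal (z x *
      (S.indicator (fun p => 2 * (1 / c) ^ 2 / (sqd y p + (1 / c) ^ 2) ^ 2) x)) ≤
      ENNReal.ofReal (2 * I0 * ∫ x, (c ^ Module.finrank ℝ (ℝ × ℝ) * (kker (c • (y - x)) / I0)) • g x) := by
    have hint : Integrable (fun x => (c ^ Module.finrank ℝ (ℝ × ℝ) * (kker (c • (y - x)) / I0)) • g x) := by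
      refine hgi.bdd_smul (φ := fun x => c ^ Module.finrank ℝ (ℝ × ℝ) * (kker (c • (y - x)) / I0))
        (c ^ 2 * (1 / I0)) ?_ (Eventually.of_forall fun x => ?_)
      · have : Continuous fun x : ℝ × ℝ => kker (c • (y - x)) := kker_cont.comp (by fun_prop)
        exact (continuous_const.mul (this.div_const _)).aestronglyMeasurable
      · rw [hf2, Real.norm_of_nonneg (mul_nonneg (by positivity) (div_nonneg (kker_pos _).le hI.le))]
        gcongr
        refine (kker_le _).trans ?_
        rw [div_le_one (by positivity)]
        have := sq_nonneg ‖c • (y - x)‖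
        nlinarith
    rw [← integral_const_mul, ofReal_integral_eq_lintegral_ofReal (hint.const_mul _)
      (Eventually.of_forall fun x => mul_nonneg (by positivity) (mul_nonneg (mul_nonneg (by positivity)
        (div_nonneg (kker_pos _).le hI.le)) (hg0 x)))]
    refine (setLIntegral_le_lintegral _ _).trans (lintegral_mono fun x => ?_)
    apply ENNReal.ofReal_le_ofReal
    by_cases hx : x ∈ S
    · rw [indicator_of_mem hx, hg, indicator_of_mem hx, hker, hf2, smul_eq_mul]
      apply le_of_eq; ring
    · rw [indicator_of_notMem hx, hg, indicator_of_notMem hx]; simp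
  rw [e1] at hm
  have hm2 := mul_le_mul_right (hm.trans e2) (ENNReal.ofReal (20000 * R ^ 2))
  rw [← mul_assoc, ← ENNReal.ofReal_mul (by positivity), ← ENNReal.ofReal_mul (by positivity),
    mul_one_div_cancel (by positivity), ENNReal.ofReal_one, one_mul] at hm2
  simp only [Function.comp]
  rw [mul_assoc (20000 * R ^ 2)]
  exact hm2

open Topology
open scoped NNReal ENNReal

def PP (D : Set (ℝ × ℝ)) (p q : ℝ × ℝ) : Prop :=
  ∃ r : ℝ, 0 < r ∧ ∃ C : ℝ≥0, ∀ y ∈ Metric.ball p r, ∀ f z, Adm D f z →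
    ∫⁻ x in Metric.ball q r, ENNReal.ofReal (z x) ≤ C * ENNReal.ofReal (z y)

lemma PP_near {D : Set (ℝ × ℝ)} (hD : IsOpen D) (hb : Bornology.IsBounded D) {p p' : ℝ × ℝ}
    (hne : p ≠ p') (hball : Metric.ball p (8 * ‖p' - p‖) ⊆ D) : PP D p p' := by
  set n := ‖p' - p‖ with hn
  have hn0 : 0 < n := norm_pos_iff.2 (sub_ne_zero.2 hne.symm)
  have hs1 : n ^ 2 ≤ sqd p p' := by simpa [sqd] using norm_sq_le (p' - p)
  have hs2 : sqd p p' ≤ 2 * n ^ 2 := by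
    have h1 : |p'.1 - p.1| ≤ n := norm_fst_le (p' - p)
    have h2 : |p'.2 - p.2| ≤ n := norm_snd_le (p' - p)
    have h3 : (p'.1 - p.1) ^ 2 ≤ n ^ 2 := sq_le_sq' (abs_le.1 h1).1 (abs_le.1 h1).2
    have h4 : (p'.2 - p.2) ^ 2 ≤ n ^ 2 := sq_le_sq' (abs_le.1 h2).1 (abs_le.1 h2).2
    unfold sqd; linarith
  set R := 3 * √(sqd p p') with hR
  have hsp : 0 < sqd p p' := lt_of_lt_of_le (by positivity) hs1
  have hR0 : 0 < R := by positivity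
  have hR2 : R ^ 2 = 9 * sqd p p' := by rw [hR, mul_pow, Real.sq_sqrt hsp.le]; norm_num
  have hRn : R ≤ 5 * n := by
    apply le_of_sq_le_sq _ (by positivity)
    rw [hR2]; nlinarith
  obtain ⟨C, hC⟩ := mean_value hD hb hR0
  have hc : Continuous (fun w : (ℝ × ℝ) × (ℝ × ℝ) => sqd w.1 w.2) := by unfold sqd; fun_prop
  have hev : ∀ᶠ w in 𝓝 (p, p'), R ^ 2 / 16 < sqd w.1 w.2 ∧ sqd w.1 w.2 < R ^ 2 / 4 := by
    have hmem : Ioo (R ^ 2 / 16) (R ^ 2 / 4) ∈ 𝓝 (sqd p p') :=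
      Ioo_mem_nhds (by rw [hR2]; linarith) (by rw [hR2]; linarith)
    exact (hc.tendsto (p, p')) hmem
  obtain ⟨r, hr, hrb⟩ := Metric.eventually_nhds_iff_ball.1 hev
  refine ⟨min r n, lt_min hr hn0, C, fun y hy f z h => ?_⟩
  have hyr : y ∈ Metric.ball p r := Metric.ball_subset_ball (min_le_left _ _) hy
  have hyn : y ∈ Metric.ball p n := Metric.ball_subset_ball (min_le_right _ _) hy
  refine le_trans (lintegral_mono_set ?_) (hC y ?_ f z h)
  · intro x hx
    have hxr : x ∈ Metric.ball p' r := Metric.ball_subset_ball (min_le_left _ _) hx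
    have := hrb (y, x) (by rw [← ball_prod_same]; exact ⟨hyr, hxr⟩)
    exact ⟨this.1.le, this.2.le⟩
  · intro x hx
    have hx : sqd y x ≤ R ^ 2 := hx
    apply hball
    have h1 : ‖x - y‖ ≤ R := by
      apply le_of_sq_le_sq _ hR0.le
      refine le_trans ?_ hx
      simpa [sqd] using norm_sq_le (x - y)
    rw [Metric.mem_ball] at hyn ⊢
    have := dist_triangle x y p
    rw [dist_eq_norm x y] at this
    linarith

lemma PP_mono_step {D : Set (ℝ × ℝ)} {p p' q : ℝ × ℝ} (h1 : PP D p p') (h2 : PP D p' q) :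
    PP D p q := by
  obtain ⟨r1, hr1, C1, H1⟩ := h1
  obtain ⟨r2, hr2, C2, H2⟩ := h2
  set r := min r1 r2 with hr
  have hr0 : 0 < r := lt_min hr1 hr2
  set V := volume (Metric.ball p' r) with hV
  have hV0 : V ≠ 0 := (Metric.measure_ball_pos _ _ hr0).ne'
  have hVt : V ≠ ⊤ := Metric.isBounded_ball.measure_lt_top.ne
  refine ⟨r, hr0, C2 * C1 / V.toNNReal, fun y hy f z h => ?_⟩
  set J := ∫⁻ x in Metric.ball q r, ENNReal.ofReal (z x) with hJ
  have hk : J * V ≤ C2 * (C1 * ENNReal.ofReal (z y)) := by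
    calc J * V = ∫⁻ x in Metric.ball p' r, J := by rw [setLIntegral_const]
      _ ≤ ∫⁻ x in Metric.ball p' r, C2 * ENNReal.ofReal (z x) := by
        refine setLIntegral_mono' Metric.isOpen_ball.measurableSet fun x hx => ?_
        refine le_trans (lintegral_mono_set (Metric.ball_subset_ball (min_le_right _ _))) (H2 x ?_ f z h)
        exact Metric.ball_subset_ball (min_le_right _ _) hx
      _ = C2 * ∫⁻ x in Metric.ball p' r, ENNReal.ofReal (z x) := lintegral_const_mul' _ _ (by simp)
      _ ≤ _ := by
        gcongr
        refine le_trans (lintegral_mono_set (Metric.ball_subset_ball (min_le_left _ _))) (H1 y ?_ f z h)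
        exact Metric.ball_subset_ball (min_le_left _ _) hy
  have h3 : J ≤ C2 * (C1 * ENNReal.ofReal (z y)) / V :=
    (ENNReal.le_div_iff_mul_le (Or.inl hV0) (Or.inl hVt)).2 hk
  refine h3.trans (le_of_eq ?_)
  rw [ENNReal.coe_div (by simp [ENNReal.toNNReal_eq_zero_iff, hV0, hVt]), ENNReal.coe_toNNReal hVt]
  push_cast
  simp only [div_eq_mul_inv]
  ring

lemma PP_all {D : Set (ℝ × ℝ)} (hD : IsOpen D) (hb : Bornology.IsBounded D)
    (hcn : IsPreconnected D) {q : ℝ × ℝ} (hq : q ∈ D) {p : ℝ × ℝ} (hp : p ∈ D) : PP D p q := by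
  have hopen : IsOpen {p | PP D p q} := by
    rw [Metric.isOpen_iff]
    rintro p ⟨r, hr, C, H⟩
    refine ⟨r / 2, by positivity, fun p1 hp1 => ⟨r / 2, by positivity, C, fun y hy f z h => ?_⟩⟩
    refine le_trans (lintegral_mono_set (Metric.ball_subset_ball (by linarith))) (H y ?_ f z h)
    rw [Metric.mem_ball] at *
    have := dist_triangle y p1 p
    linarith
  refine hcn.subset_of_closure_inter_subset hopen ?_ ?_ hp
  · obtain ⟨ρ, hρ, hρD⟩ := Metric.isOpen_iff.1 hD q hq
    set p1 : ℝ × ℝ := q + (ρ / 16, 0) with hp1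
    have hn : ‖q - p1‖ = ρ / 16 := by
      rw [hp1]; simp [Prod.norm_def, abs_of_pos hρ, hρ.le]
      positivity
    have hd : dist p1 q = ρ / 16 := by rw [dist_comm, dist_eq_norm, hn]
    refine ⟨p1, hρD (by rw [Metric.mem_ball, hd]; linarith), PP_near hD hb ?_ ?_⟩
    · intro he; rw [he] at hn; simp at hn; linarith
    · rw [hn]
      intro x hx
      apply hρD
      rw [Metric.mem_ball] at *
      have := dist_triangle x p1 q
      linarith
  · rintro p ⟨hpc, hpD⟩
    obtain ⟨ρ, hρ, hρD⟩ := Metric.isOpen_iff.1 hD p hpD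
    obtain ⟨p', hp', hd⟩ := Metric.mem_closure_iff.1 hpc (ρ / 8) (by positivity)
    by_cases he : p = p'
    · rw [he]; exact hp'
    refine PP_mono_step (PP_near hD hb he ?_) hp'
    rw [dist_comm, dist_eq_norm] at hd
    exact (Metric.ball_subset_ball (by linarith)).trans hρD

lemma weak_harnack {D : Set (ℝ × ℝ)} (hD : IsOpen D) (hb : Bornology.IsBounded D)
    (hcn : IsPreconnected D) {K : Set (ℝ × ℝ)} (hK : IsCompact K) (hKD : K ⊆ D) :
    ∃ C : ℝ≥0, ∀ f z, Adm D f z → ∀ y ∈ K,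
      ∫⁻ x in K, ENNReal.ofReal (z x) ≤ C * ENNReal.ofReal (z y) := by
  have h1 : ∀ q ∈ K, ∃ r : ℝ, 0 < r ∧ ∃ C : ℝ≥0, ∀ f z, Adm D f z → ∀ y ∈ K,
      ∫⁻ x in Metric.ball q r, ENNReal.ofReal (z x) ≤ C * ENNReal.ofReal (z y) := by
    intro q hq
    refine hK.induction_on (p := fun s => ∃ r : ℝ, 0 < r ∧ ∃ C : ℝ≥0, ∀ f z, Adm D f z → ∀ y ∈ s,
      ∫⁻ x in Metric.ball q r, ENNReal.ofReal (z x) ≤ C * ENNReal.ofReal (z y)) ?_ ?_ ?_ ?_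
    · exact ⟨1, one_pos, 0, by simp⟩
    · rintro s t hst ⟨r, hr, C, H⟩
      exact ⟨r, hr, C, fun f z h y hy => H f z h y (hst hy)⟩
    · rintro s t ⟨r, hr, C, H⟩ ⟨r', hr', C', H'⟩
      refine ⟨min r r', lt_min hr hr', C + C', fun f z h y hy => ?_⟩
      rcases hy with hy | hy
      · refine (lintegral_mono_set (Metric.ball_subset_ball (min_le_left _ _))).trans
          ((H f z h y hy).trans ?_)
        gcongr; simp
      · refine (lintegral_mono_set (Metric.ball_subset_ball (min_le_right _ _))).trans
          ((H' f z h y hy).trans ?_)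
        gcongr; simp
    · intro p hp
      obtain ⟨r, hr, C, H⟩ := PP_all hD hb hcn (hKD hq) (hKD hp)
      exact ⟨Metric.ball p r, mem_nhdsWithin_of_mem_nhds (Metric.ball_mem_nhds p hr), r, hr, C,
        fun f z h y hy => H y hy f z h⟩
  refine hK.induction_on (p := fun s => ∃ C : ℝ≥0, ∀ f z, Adm D f z → ∀ y ∈ K,
      ∫⁻ x in s, ENNReal.ofReal (z x) ≤ C * ENNReal.ofReal (z y)) ?_ ?_ ?_ ?_
  · exact ⟨0, by simp⟩
  · rintro s t hst ⟨C, H⟩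
    exact ⟨C, fun f z h y hy => (lintegral_mono_set hst).trans (H f z h y hy)⟩
  · rintro s t ⟨C, H⟩ ⟨C', H'⟩
    refine ⟨C + C', fun f z h y hy => (lintegral_union_le _ _ _).trans ?_⟩
    push_cast
    rw [add_mul]
    exact add_le_add (H f z h y hy) (H' f z h y hy)
  · intro q hq
    obtain ⟨r, hr, C, H⟩ := h1 q hq
    exact ⟨Metric.ball q r, mem_nhdsWithin_of_mem_nhds (Metric.ball_mem_nhds q hr), C, H⟩

open Topology
open scoped NNReal ENNReal

lemma infDist_frontier_le {D : Set (ℝ × ℝ)} {x y : ℝ × ℝ} (hx : x ∈ D) (hy : y ∉ D) :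
    Metric.infDist x (frontier D) ≤ dist x y := by
  have hne : D ≠ univ := fun h => hy (h ▸ mem_univ y)
  obtain ⟨w, hw, he⟩ := exists_mem_frontier_infDist_compl_eq_dist hx hne
  calc _ ≤ dist x w := Metric.infDist_le_dist_of_mem hw
    _ = Metric.infDist x Dᶜ := he.symm
    _ ≤ _ := Metric.infDist_le_dist_of_mem hy

structure Barrier (D : Set (ℝ × ℝ)) (ψ : ℝ × ℝ → ℝ) (K : Set (ℝ × ℝ)) : Prop where
  c2 : ContDiff ℝ 2 ψ
  comp : IsCompact {x | 0 ≤ ψ x}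
  pos : ∀ x, 0 < ψ x → x ∈ D
  hK : IsCompact K
  hKD : K ⊆ D
  subh : ∀ x, 0 ≤ ψ x → x ∉ K → 0 < lapF ψ x

lemma barrier_g {D : Set (ℝ × ℝ)} (hD : IsOpen D) {g : ℝ × ℝ → ℝ} (hg : ContDiff ℝ 2 g)
    (hcomp : IsCompact {x | g x ≤ 0}) (hneg : ∀ x, g x < 0 → x ∈ D)
    (hcrit : ∀ x, g x ≤ 0 → grad2 g x = 0 → x ∈ D) :
    ∃ α : ℝ, 0 < α ∧ ∃ ψ K, Barrier D ψ K ∧ ∀ x, - α * g x ≤ ψ x := by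
  have hgc : Continuous (grad2 g) := continuous_iff_continuousAt.2 fun x => grad2_cont hg.contDiffAt
  have hlc : Continuous (lapF g) := continuous_iff_continuousAt.2 fun x => lapF_cont hg.contDiffAt
  have hZ : IsCompact ({x | g x ≤ 0} ∩ {x | grad2 g x = 0}) :=
    hcomp.inter_right (isClosed_eq hgc continuous_const)
  obtain ⟨K, hK, hZK, hKD⟩ := exists_compact_between hZ hD (fun x hx => hcrit x hx.1 hx.2)
  have hT : IsCompact ({x | g x ≤ 0} \ interior K) := hcomp.diff isOpen_interior
  have hTpos : ∀ x ∈ {x | g x ≤ 0} \ interior K, 0 < grad2 g x := by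
    rintro x ⟨hx, hxK⟩
    have h0 : 0 ≤ grad2 g x := by unfold grad2; positivity
    refine lt_of_le_of_ne h0 fun h => hxK (hZK ⟨hx, h.symm⟩)
  have hq : ContinuousOn (fun x => lapF g x / grad2 g x) ({x | g x ≤ 0} \ interior K) :=
    hlc.continuousOn.div hgc.continuousOn fun x hx => (hTpos x hx).ne'
  obtain ⟨A, hA⟩ := hT.bddAbove_image hq
  set α := max A 0 + 1 with hα
  have hα0 : 0 < α := by positivity
  have hαA : A < α := by rw [hα]; linarith [le_max_left A 0]
  have hiff : ∀ x, 0 ≤ Real.exp (-α * g x) - 1 ↔ g x ≤ 0 := by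
    intro x
    rw [sub_nonneg, Real.one_le_exp_iff]
    constructor
    · intro h; by_contra hh; push Not at hh; nlinarith
    · intro h; nlinarith
  refine ⟨α, hα0, fun x => Real.exp (-α * g x) - 1, K, ⟨?_, ?_, ?_, hK, hKD, ?_⟩, ?_⟩
  · fun_prop
  · simp_rw [hiff]; exact hcomp
  · intro x hx
    apply hneg
    rw [sub_pos, Real.one_lt_exp_iff] at hx
    by_contra hh; push Not at hh; nlinarith
  · intro x hx hxK
    rw [hiff] at hx
    have hxT : x ∈ {x | g x ≤ 0} \ interior K := ⟨hx, fun h => hxK (interior_subset h)⟩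
    have h1 := hA (mem_image_of_mem _ hxT)
    have hG := hTpos x hxT
    rw [div_le_iff₀ hG] at h1
    have hH : ∀ t : ℝ, HasDerivAt (fun t => Real.exp (-α * t) - 1) (-α * Real.exp (-α * t)) t := by
      intro t
      have := (((hasDerivAt_id t).const_mul (-α)).exp).sub_const 1
      refine this.congr_deriv ?_
      simp; ring
    have hH1 : ∀ t : ℝ, HasDerivAt (fun t => -α * Real.exp (-α * t)) (α ^ 2 * Real.exp (-α * t)) t := by
      intro t
      have := (((hasDerivAt_id t).const_mul (-α)).exp).const_mul (-α)
      refine this.congr_deriv ?_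
      simp; ring
    rw [lapF_comp (H := fun t => Real.exp (-α * t) - 1) (H1 := fun t => -α * Real.exp (-α * t))
      hg.contDiffAt (Eventually.of_forall hH) (hH1 (g x))]
    have he := Real.exp_pos (-α * g x)
    have : lapF g x < α * grad2 g x := by nlinarith
    have h2 : 0 < α * Real.exp (-α * g x) * (α * grad2 g x - lapF g x) := by
      have := sub_pos.2 this
      positivity
    linarith
  · intro x
    have := Real.add_one_le_exp (-α * g x)
    simp only; linarith

def LocB (D : Set (ℝ × ℝ)) (q : ℝ × ℝ) : Prop :=
  ∃ ψ K, Barrier D ψ K ∧ ∃ r : ℝ, 0 < r ∧ ∃ c : ℝ, 0 < c ∧ ∀ x ∈ Metric.ball q r ∩ D,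
    c * Metric.infDist x (frontier D) ≤ ψ x

lemma locB_int {D : Set (ℝ × ℝ)} (hD : IsOpen D) (hb : Bornology.IsBounded D) {q : ℝ × ℝ} (hq : q ∈ D) :
    LocB D q := by
  obtain ⟨ρ, hρ, hρD⟩ := Metric.isOpen_iff.1 hD q hq
  let χ : ContDiffBump q := ⟨ρ / 2, ρ, by positivity, by linarith⟩
  have hχ : ContDiff ℝ 2 (χ : ℝ × ℝ → ℝ) := χ.contDiff (n := 2)
  have hin : ∀ x, 1 - 2 * χ x ≤ 0 → x ∈ Metric.ball q ρ := by
    intro x hx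
    by_contra hh
    rw [Metric.mem_ball, not_lt] at hh
    have := χ.zero_of_le_dist hh
    rw [this] at hx; norm_num at hx
  have hc2 : ContDiff ℝ 2 (fun x => 1 - 2 * χ x) := contDiff_const.sub (contDiff_const.mul hχ)
  obtain ⟨α, hα, ψ, K, hB, hlow⟩ := barrier_g hD (g := fun x => 1 - 2 * χ x) hc2
    (Metric.isCompact_of_isClosed_isBounded (isClosed_le hc2.continuous continuous_const)
      (Metric.isBounded_ball.subset hin)) (fun x hx => hρD (hin x hx.le)) (fun x hx _ => hρD (hin x hx))
  refine ⟨ψ, K, hB, ρ / 2, by positivity, ?_⟩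
  obtain ⟨y, hy⟩ : ∃ y, y ∉ D := by
    by_contra h; push Not at h
    exact (NormedSpace.noncompactSpace ℝ (ℝ × ℝ)).1 (by
      simpa [eq_univ_of_forall h] using hb.isCompact_closure)
  obtain ⟨M, hM⟩ := Metric.isBounded_iff.1 (hb.union (Bornology.isBounded_singleton (x := y)))
  have hM' : ∀ x ∈ D, Metric.infDist x (frontier D) ≤ max M 1 := fun x hx =>
    (infDist_frontier_le hx hy).trans ((hM (Or.inl hx) (Or.inr rfl)).trans (le_max_left _ _))
  have hM0 : 0 < max M 1 := by positivity
  refine ⟨α / max M 1, by positivity, fun x hx => ?_⟩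
  have h1 : χ x = 1 := χ.one_of_mem_closedBall (Metric.ball_subset_closedBall hx.1)
  have h2 := hlow x
  simp only [h1] at h2
  calc α / max M 1 * Metric.infDist x (frontier D) ≤ α / max M 1 * max M 1 := by
        gcongr; exact hM' x hx.2
    _ = α := by field_simp
    _ ≤ _ := by linarith

lemma locB_bdry {D : Set (ℝ × ℝ)} (hD : IsOpen D) (hC2 : HasC2Boundary D) {q : ℝ × ℝ}
    (hq : q ∈ frontier D) : LocB D q := by
  obtain ⟨f, V, hqV, hV, hf, hdf, hiff⟩ := hC2 q hq
  have hfa : ∀ x ∈ V, ContDiffAt ℝ 2 f x := fun x hx => hf.contDiffAt (hV.mem_nhds hx)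
  have hqD : q ∉ D := by
    rw [frontier, hD.interior_eq] at hq; exact hq.2
  have hfq : 0 ≤ f q := by
    by_contra h; push Not at h; exact hqD ((hiff q hqV).2 h)
  obtain ⟨v, hv⟩ : ∃ v, fderiv ℝ f q v = 1 := by
    obtain ⟨w, hw⟩ : ∃ w, fderiv ℝ f q w ≠ 0 := by
      by_contra h; push Not at h; exact hdf (ContinuousLinearMap.ext h)
    exact ⟨(fderiv ℝ f q w)⁻¹ • w, by simp [hw]⟩
  have hev : ∀ᶠ x in 𝓝 q, x ∈ V ∧ 1 / 2 < fderiv ℝ f x v := by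
    refine Filter.Eventually.and (hV.mem_nhds hqV) ?_
    have := (C2_fderiv (hfa q hqV) v).continuousAt
    exact this.eventually (lt_mem_nhds (by simp only [hv]; norm_num))
  obtain ⟨R, hR, hRb⟩ := Metric.eventually_nhds_iff_ball.1 hev
  set ρ := R / 4 with hρ
  have hρ0 : 0 < ρ := by positivity
  let χ : ContDiffBump q := ⟨ρ, 2 * ρ, hρ0, by linarith⟩
  let χ' : ContDiffBump q := ⟨ρ / 2, ρ, by positivity, by linarith⟩
  have hχ : ContDiff ℝ 2 (χ : ℝ × ℝ → ℝ) := χ.contDiff (n := 2)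
  have hχ' : ContDiff ℝ 2 (χ' : ℝ × ℝ → ℝ) := χ'.contDiff (n := 2)
  have hft : ContDiff ℝ 2 (fun x => χ x * f x) := by
    rw [contDiff_iff_contDiffAt]
    intro x
    by_cases hx : x ∈ Metric.ball q R
    · exact hχ.contDiffAt.mul (hfa x (hRb x hx).1)
    · have : (fun x => χ x * f x) =ᶠ[𝓝 x] fun _ => 0 := by
        rw [Metric.mem_ball, not_lt] at hx
        have hmem : (Metric.closedBall q (2 * ρ))ᶜ ∈ 𝓝 x :=
          Metric.isClosed_closedBall.isOpen_compl.mem_nhds (by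
            rw [mem_compl_iff, Metric.mem_closedBall]; linarith)
        filter_upwards [hmem] with y hy
        rw [mem_compl_iff, Metric.mem_closedBall, not_le] at hy
        rw [χ.zero_of_le_dist hy.le, zero_mul]
      exact contDiffAt_const.congr_of_eventuallyEq this
  obtain ⟨N0, hN0⟩ := (isCompact_closedBall q (2 * ρ)).bddBelow_image hft.continuous.continuousOn
  set N := |N0| + 1 with hN
  have hNpos : 0 < N := by positivity
  have hNlow : ∀ x, -N < χ x * f x := by
    intro x
    by_cases hx : x ∈ Metric.closedBall q (2 * ρ)
    · have := hN0 (mem_image_of_mem _ hx)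
      have := neg_abs_le N0
      linarith
    · rw [Metric.mem_closedBall, not_le] at hx
      rw [χ.zero_of_le_dist hx.le, zero_mul]; linarith
  set η : ℝ × ℝ → ℝ := fun x => N * (1 - χ' x) with hη
  have hη2 : ContDiff ℝ 2 η := contDiff_const.mul (contDiff_const.sub hχ')
  have hη0 : ∀ x, 0 ≤ η x := fun x => mul_nonneg hNpos.le (sub_nonneg.2 χ'.le_one)
  set g : ℝ × ℝ → ℝ := fun x => χ x * f x + η x with hg
  have hg2 : ContDiff ℝ 2 g := hft.add hη2
  have hin : ∀ x, g x ≤ 0 → x ∈ Metric.ball q ρ := by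
    intro x hx
    by_contra hh
    rw [Metric.mem_ball, not_lt] at hh
    have h1 : χ' x = 0 := χ'.zero_of_le_dist hh
    have h2 := hNlow x
    simp only [hg, hη, h1] at hx
    linarith
  have hχ1 : ∀ x ∈ Metric.ball q ρ, χ x = 1 := fun x hx =>
    χ.one_of_mem_closedBall (Metric.ball_subset_closedBall hx)
  have hbR : ∀ x ∈ Metric.ball q ρ, x ∈ Metric.ball q R :=
    fun x hx => Metric.ball_subset_ball (by linarith) hx
  have hgf : ∀ x ∈ Metric.ball q ρ, g x = f x + η x := fun x hx => by
    simp only [hg, hχ1 x hx, one_mul]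
  obtain ⟨α, hα, ψ, K, hB, hlow⟩ := barrier_g hD (g := g) hg2
    (Metric.isCompact_of_isClosed_isBounded (isClosed_le hg2.continuous continuous_const)
      (Metric.isBounded_ball.subset hin))
    (fun x hx => by
      have hxb := hin x hx.le
      rw [hgf x hxb] at hx
      exact (hiff x (hRb x (hbR x hxb)).1).2 (by linarith [hη0 x]))
    (fun x hx hcr => by
      have hxb := hin x hx
      have hxV := hRb x (hbR x hxb)
      rw [hgf x hxb] at hx
      rw [hiff x hxV.1]
      by_contra hh
      push Not at hh
      have hηx : η x = 0 := by linarith [hη0 x]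
      have hmin : IsLocalMin η x := Eventually.of_forall fun y => by rw [hηx]; exact hη0 y
      have hfd : fderiv ℝ g x = fderiv ℝ f x := by
        have : g =ᶠ[𝓝 x] fun y => f y + η y := by
          filter_upwards [Metric.isOpen_ball.mem_nhds hxb] with y hy using hgf y hy
        rw [this.fderiv_eq, fderiv_fun_add ((hfa x hxV.1).differentiableAt (by norm_num))
          (hη2.differentiable (by norm_num) x), hmin.fderiv_eq_zero, add_zero]
      have hd1 : ddx g x = 0 := by unfold grad2 at hcr; nlinarith [sq_nonneg (ddx g x), sq_nonneg (ddy g x)]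
      have hd2 : ddy g x = 0 := by unfold grad2 at hcr; nlinarith [sq_nonneg (ddx g x), sq_nonneg (ddy g x)]
      unfold ddx at hd1; unfold ddy at hd2
      rw [hfd] at hd1 hd2
      have hvv : v = v.1 • ((1:ℝ), (0:ℝ)) + v.2 • ((0:ℝ), (1:ℝ)) := by ext <;> simp
      have h3 := hxV.2
      rw [hvv, map_add, map_smul, map_smul, hd1, hd2] at h3
      norm_num at h3)
  refine ⟨ψ, K, hB, ?_⟩
  set ε := ρ / (8 * (‖v‖ + 1)) with hε
  have hε0 : 0 < ε := by positivity
  have hev2 : ∀ᶠ x in 𝓝 q, -ε < f x :=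
    (hfa q hqV).continuousAt.eventually (lt_mem_nhds (by linarith))
  obtain ⟨r, hr, hrb⟩ := Metric.eventually_nhds_iff_ball.1 hev2
  refine ⟨min r (ρ / 2), lt_min hr (by positivity), α / (2 * (‖v‖ + 1)), by positivity, ?_⟩
  rintro x ⟨hxb, hxD⟩
  have hxr := hrb x (Metric.ball_subset_ball (min_le_left _ _) hxb)
  have hxρ2 : x ∈ Metric.ball q (ρ / 2) := Metric.ball_subset_ball (min_le_right _ _) hxb
  have hxρ : x ∈ Metric.ball q ρ := Metric.ball_subset_ball (by linarith) hxρ2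
  have hxf : f x < 0 := (hiff x (hRb x (hbR x hxρ)).1).1 hxD
  have hgx : g x = f x := by
    rw [hgf x hxρ]
    have : χ' x = 1 := χ'.one_of_mem_closedBall (Metric.ball_subset_closedBall hxρ2)
    simp [hη, this]
  set t := -2 * f x with ht
  have ht0 : 0 < t := by linarith
  have htv : t * ‖v‖ ≤ ρ / 4 := by
    have h1 : t ≤ 2 * ε := by linarith
    have h2 : ε * (‖v‖ + 1) = ρ / 8 := by rw [hε]; field_simp
    have h3 := norm_nonneg v
    nlinarith
  have hseg : ∀ s ∈ Icc 0 t, x + s • v ∈ Metric.ball q ρ := by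
    intro s hs
    rw [Metric.mem_ball] at *
    have h1 := dist_triangle (x + s • v) x q
    have h2 : dist (x + s • v) x = s * ‖v‖ := by
      rw [dist_eq_norm, add_sub_cancel_left, norm_smul, Real.norm_of_nonneg hs.1]
    have h3 : s * ‖v‖ ≤ t * ‖v‖ := by gcongr; exact hs.2
    linarith
  have hder : ∀ s ∈ Icc 0 t, HasDerivAt (fun s : ℝ => f (x + s • v)) (fderiv ℝ f (x + s • v) v) s := by
    intro s hs
    have h1 : HasDerivAt (fun s : ℝ => x + s • v) v s := by
      have := ((hasDerivAt_id s).smul_const v).const_add x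
      simpa using this
    have h2 := (hfa _ (hRb _ (hbR _ (hseg s hs))).1).differentiableAt (by norm_num)
    exact h2.hasFDerivAt.comp_hasDerivAt s h1
  have hmv : 1 / 2 * (t - 0) ≤ f (x + t • v) - f (x + (0:ℝ) • v) := by
    refine Convex.mul_sub_le_image_sub_of_le_deriv (f := fun s : ℝ => f (x + s • v)) (convex_Icc 0 t)
      (fun s hs => (hder s hs).continuousAt.continuousWithinAt)
      (fun s hs => (hder s (interior_subset hs)).differentiableAt.differentiableWithinAt) ?_
      0 ⟨le_rfl, ht0.le⟩ t ⟨ht0.le, le_rfl⟩ ht0.le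
    intro s hs
    rw [(hder s (interior_subset hs)).deriv]
    exact (hRb _ (hbR _ (hseg s (interior_subset hs)))).2.le
  rw [zero_smul, add_zero] at hmv
  have hend : x + t • v ∉ D := by
    rw [hiff _ (hRb _ (hbR _ (hseg t ⟨ht0.le, le_rfl⟩))).1]
    rw [ht] at hmv ⊢; linarith
  have hδ := infDist_frontier_le hxD hend
  rw [dist_eq_norm, sub_add_cancel_left, norm_neg, norm_smul, Real.norm_of_nonneg ht0.le] at hδ
  have hl := hlow x
  rw [hgx] at hl
  calc α / (2 * (‖v‖ + 1)) * Metric.infDist x (frontier D) ≤ α / (2 * (‖v‖ + 1)) * (t * (‖v‖ + 1)) := by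
        gcongr; nlinarith
    _ = -α * f x := by rw [ht]; field_simp
    _ ≤ _ := hl

open Topology
open scoped NNReal ENNReal

def QQ (D s : Set (ℝ × ℝ)) : Prop :=
  ∃ K, IsCompact K ∧ K ⊆ D ∧ ∃ C : ℝ≥0,
    (∀ f z, Adm D f z → ∫⁻ x in s ∩ D, ENNReal.ofReal (f x * Metric.infDist x (frontier D)) ≤
      C * ∫⁻ x in K, ENNReal.ofReal (z x)) ∧
    (∀ f z, Adm D f z → ∀ I : ℝ, 0 ≤ I → (∀ x ∈ K, I ≤ z x) → ∀ x ∈ s ∩ D,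
      I * Metric.infDist x (frontier D) ≤ C * z x)

lemma QQ_loc {D : Set (ℝ × ℝ)} (hD : IsOpen D) (hb : Bornology.IsBounded D) {q : ℝ × ℝ}
    (h : LocB D q) : ∃ r : ℝ, 0 < r ∧ QQ D (Metric.ball q r) := by
  obtain ⟨ψ, K, hB, r, hr, c, hc, hlow⟩ := h
  refine ⟨r, hr, K, hB.hK, hB.hKD, ?_⟩
  obtain ⟨C1, hC1⟩ := barrier_dual hD hb hB.c2 hB.comp hB.pos hB.hK hB.hKD hB.subh
  obtain ⟨m0, hm0⟩ := hB.hK.bddAbove_image hB.c2.continuous.continuousOn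
  set m := max m0 1 with hm
  have hmpos : 0 < m := by positivity
  refine ⟨(1 / c).toNNReal * C1 + (m / c).toNNReal, ?_, ?_⟩
  · intro f z h
    have h1 : ∀ x ∈ Metric.ball q r ∩ D, ENNReal.ofReal (f x * Metric.infDist x (frontier D)) ≤
        ((1 / c).toNNReal : ℝ≥0∞) * ENNReal.ofReal (f x * max (ψ x) 0) := by
      intro x hx
      have h2 := hlow x hx
      have hf := h.f0 x hx.2
      change _ ≤ ENNReal.ofReal (1 / c) * _
      rw [← ENNReal.ofReal_mul (by positivity)]
      apply ENNReal.ofReal_le_ofReal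
      have h3 : Metric.infDist x (frontier D) ≤ 1 / c * max (ψ x) 0 := by
        rw [one_div, ← div_eq_inv_mul, le_div_iff₀ hc]
        linarith [le_max_left (ψ x) 0]
      calc _ ≤ f x * (1 / c * max (ψ x) 0) := by gcongr
        _ = _ := by ring
    calc _ ≤ ∫⁻ x in Metric.ball q r ∩ D, ((1 / c).toNNReal : ℝ≥0∞) * ENNReal.ofReal (f x * max (ψ x) 0) :=
          setLIntegral_mono' (Metric.isOpen_ball.inter hD).measurableSet h1
      _ = ((1 / c).toNNReal : ℝ≥0∞) * ∫⁻ x in Metric.ball q r ∩ D, ENNReal.ofReal (f x * max (ψ x) 0) :=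
          lintegral_const_mul' _ _ (by simp)
      _ ≤ ((1 / c).toNNReal : ℝ≥0∞) * (C1 * ∫⁻ x in K, ENNReal.ofReal (z x)) := by
          gcongr
          exact (lintegral_mono_set inter_subset_right).trans (hC1 f z h)
      _ ≤ _ := by
          rw [← mul_assoc]
          push_cast
          gcongr
          exact le_self_add
  · intro f z h I hI hIz x hx
    have h1 := h.hopf hD hb hB.c2 hB.pos hB.subh hmpos hI
      (fun x hx => (hm0 (mem_image_of_mem _ hx)).trans (le_max_left _ _)) hIz hx.2
    have hz := h.nonneg hD hb hx.2
    have h2 := hlow x hx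
    have h3 : I * Metric.infDist x (frontier D) ≤ m / c * z x := by
      calc I * Metric.infDist x (frontier D) = I / c * (c * Metric.infDist x (frontier D)) := by field_simp
        _ ≤ I / c * ψ x := by gcongr
        _ = m / c * (I / m * ψ x) := by field_simp
        _ ≤ _ := by gcongr
    refine h3.trans ?_
    gcongr
    push_cast
    rw [Real.coe_toNNReal (m / c) (by positivity)]
    have : (0:ℝ) ≤ (1 / c).toNNReal * C1 := by positivity
    linarith

lemma QQ_all {D : Set (ℝ × ℝ)} (hD : IsOpen D) (hb : Bornology.IsBounded D) (hC2 : HasC2Boundary D) :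
    QQ D (closure D) := by
  refine hb.isCompact_closure.induction_on (p := QQ D) ?_ ?_ ?_ ?_
  · exact ⟨∅, isCompact_empty, empty_subset _, 0, by simp, by simp⟩
  · rintro s t hst ⟨K, hK, hKD, C, h1, h2⟩
    refine ⟨K, hK, hKD, C, fun f z h => ?_, fun f z h I hI hIz x hx => ?_⟩
    · exact (lintegral_mono_set (inter_subset_inter_left _ hst)).trans (h1 f z h)
    · exact h2 f z h I hI hIz x ⟨hst hx.1, hx.2⟩
  · rintro s t ⟨K, hK, hKD, C, h1, h2⟩ ⟨K', hK', hKD', C', h1', h2'⟩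
    refine ⟨K ∪ K', hK.union hK', union_subset hKD hKD', C + C', fun f z h => ?_,
      fun f z h I hI hIz x hx => ?_⟩
    · rw [union_inter_distrib_right]
      refine (lintegral_union_le _ _ _).trans ?_
      push_cast
      rw [add_mul]
      refine add_le_add ((h1 f z h).trans ?_) ((h1' f z h).trans ?_)
      · gcongr; exact subset_union_left
      · gcongr; exact subset_union_right
    · have hz := h.nonneg hD hb hx.2
      push_cast
      have e1 : 0 ≤ (C : ℝ) * z x := by positivity
      have e2 : 0 ≤ (C' : ℝ) * z x := by positivity
      rcases hx with ⟨hx | hx, hxD⟩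
      · have := h2 f z h I hI (fun y hy => hIz y (Or.inl hy)) x ⟨hx, hxD⟩
        linarith
      · have := h2' f z h I hI (fun y hy => hIz y (Or.inr hy)) x ⟨hx, hxD⟩
        linarith
  · intro q hq
    have hl : LocB D q := by
      rcases mem_or_frontier hq with h | h
      · exact locB_int hD hb h
      · exact locB_bdry hD hC2 h
    obtain ⟨r, hr, hQ⟩ := QQ_loc hD hb hl
    exact ⟨Metric.ball q r, mem_nhdsWithin_of_mem_nhds (Metric.ball_mem_nhds q hr), hQ⟩

lemma unscaled {D : Set (ℝ × ℝ)} (hD : IsOpen D) (hb : Bornology.IsBounded D)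
    (hcn : IsPreconnected D) (hC2 : HasC2Boundary D) :
    ∃ c : ℝ, 0 < c ∧ ∀ f z, Adm D f z → ∀ x ∈ D,
      c * (∫ r in D, f r * Metric.infDist r (frontier D)) * Metric.infDist x (frontier D) ≤ z x := by
  obtain ⟨K, hK, hKD, C, h1, h2⟩ := QQ_all hD hb hC2
  obtain ⟨C', hC'⟩ := weak_harnack hD hb hcn hK hKD
  refine ⟨1 / ((C * C' + 1) * (C + 1)), by positivity, fun f z h x hx => ?_⟩
  set J := ∫ r in D, f r * Metric.infDist r (frontier D) with hJ
  have hnn : 0 ≤ᵐ[volume.restrict D] fun r => f r * Metric.infDist r (frontier D) := by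
    filter_upwards [ae_restrict_mem hD.measurableSet] with r hr
    exact mul_nonneg (h.f0 r hr) Metric.infDist_nonneg
  have hJ0 : 0 ≤ J := integral_nonneg_of_ae hnn
  have hJe : J = (∫⁻ r in D, ENNReal.ofReal (f r * Metric.infDist r (frontier D))).toReal :=
    integral_eq_lintegral_of_nonneg_ae hnn
      (h.meas.mul (Metric.continuous_infDist_pt _).measurable).aestronglyMeasurable
  have hJK : ∀ y ∈ K, J ≤ C * C' * z y := by
    intro y hy
    have hz := h.nonneg hD hb (hKD hy)
    have h3 := h1 f z h
    rw [inter_eq_right.2 subset_closure] at h3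
    have h4 : ∫⁻ r in D, ENNReal.ofReal (f r * Metric.infDist r (frontier D)) ≤
        C * (C' * ENNReal.ofReal (z y)) := h3.trans (by gcongr; exact hC' f z h y hy)
    rw [hJe]
    refine (ENNReal.toReal_mono (by finiteness) h4).trans (le_of_eq ?_)
    simp [ENNReal.toReal_ofReal hz, mul_assoc]
  have hz := h.nonneg hD hb hx
  have h5 := h2 f z h (J / (C * C' + 1)) (by positivity) (fun y hy => by
    rw [div_le_iff₀ (by positivity)]
    have := hJK y hy
    have hz := h.nonneg hD hb (hKD hy)
    linarith) x ⟨subset_closure hx, hx⟩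
  calc _ = (J / (C * C' + 1) * Metric.infDist x (frontier D)) / (C + 1) := by field_simp
    _ ≤ _ := by
      rw [div_le_iff₀ (by positivity)]
      linarith

open Topology
open scoped NNReal ENNReal

def TT (x₀ y₀ lam : ℝ) (r : ℝ × ℝ) : ℝ × ℝ := (x₀ + lam * r.1, y₀ + lam * r.2)

def TH (x₀ y₀ lam : ℝ) (h : 0 < lam) : (ℝ × ℝ) ≃ₜ (ℝ × ℝ) where
  toFun := TT x₀ y₀ lam
  invFun := fun p => ((p.1 - x₀) / lam, (p.2 - y₀) / lam)
  left_inv := fun p => by ext <;> simp [TT, h.ne']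
  right_inv := fun p => by
    have := h.ne'
    ext <;> simp [TT] <;> field_simp <;> ring
  continuous_toFun := by unfold TT; fun_prop
  continuous_invFun := by fun_prop

lemma TT_infDist {x₀ y₀ lam : ℝ} (h : 0 < lam) (S : Set (ℝ × ℝ)) (r : ℝ × ℝ) :
    Metric.infDist (TT x₀ y₀ lam r) (TT x₀ y₀ lam '' S) = lam * Metric.infDist r S := by
  have hT : ∀ r, TT x₀ y₀ lam r = (x₀, y₀) + lam • r := fun r => by ext <;> simp [TT]
  have e : TT x₀ y₀ lam '' S = (fun p => (x₀, y₀) + p) '' ((fun p => lam • p) '' S) := by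
    rw [image_image]; exact image_congr fun r _ => hT r
  rw [e, hT, Metric.infDist_image (isometry_add_left (x₀, y₀))]
  have := infDist_smul₀ h.ne' S r
  rw [Real.norm_of_nonneg h.le] at this
  exact this

lemma TT_integral {x₀ y₀ lam : ℝ} (h : 0 < lam) {S : Set (ℝ × ℝ)} (hS : MeasurableSet S)
    (u : ℝ × ℝ → ℝ) :
    ∫ p in TT x₀ y₀ lam '' S, u p = lam ^ 2 * ∫ r in S, u (TT x₀ y₀ lam r) := by
  have hT : TT x₀ y₀ lam = fun r => (x₀, y₀) + lam • r := funext fun r => by ext <;> simp [TT]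
  have hd : ∀ r ∈ S, HasFDerivWithinAt (TT x₀ y₀ lam) (lam • ContinuousLinearMap.id ℝ (ℝ × ℝ)) S r := by
    intro r _
    rw [hT]
    exact (((hasFDerivAt_id r).const_smul lam).const_add (x₀, y₀)).hasFDerivWithinAt
  rw [integral_image_eq_integral_abs_det_fderiv_smul volume hS hd
    ((TH x₀ y₀ lam h).injective.injOn)]
  have : (lam • ContinuousLinearMap.id ℝ (ℝ × ℝ)).det = lam ^ 2 := by
    rw [ContinuousLinearMap.det]
    simp
  rw [this, abs_of_pos (by positivity)]
  simp only [smul_eq_mul]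
  rw [integral_const_mul]

lemma TT_lap {x₀ y₀ lam : ℝ} (z : ℝ × ℝ → ℝ) (r : ℝ × ℝ) :
    lap2 (fun r => z (TT x₀ y₀ lam r)) r = lam ^ 2 * lap2 z (TT x₀ y₀ lam r) := by
  have key : ∀ (w : ℝ → ℝ) (a s : ℝ), deriv (fun s => w (a + lam * s)) s = lam * deriv w (a + lam * s) := by
    intro w a s
    have h1 := deriv_comp_mul_left lam (fun s => w (a + s)) s
    rw [smul_eq_mul, deriv_comp_const_add] at h1
    exact h1
  unfold lap2 TT
  simp only
  have e1 : (fun s => deriv (fun s' => z (x₀ + lam * s', y₀ + lam * r.2)) s) =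
      fun s => lam * deriv (fun s' => z (s', y₀ + lam * r.2)) (x₀ + lam * s) :=
    funext fun s => key (fun s' => z (s', y₀ + lam * r.2)) x₀ s
  have e2 : (fun s => deriv (fun s' => z (x₀ + lam * r.1, y₀ + lam * s')) s) =
      fun s => lam * deriv (fun s' => z (x₀ + lam * r.1, s')) (y₀ + lam * s) :=
    funext fun s => key (fun s' => z (x₀ + lam * r.1, s')) y₀ s
  rw [e1, e2, deriv_const_mul_field, deriv_const_mul_field,
    key (deriv fun s' => z (s', y₀ + lam * r.2)), key (deriv fun s' => z (x₀ + lam * r.1, s'))]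
  ring

/-- Lemma 3.3: scale-invariant quantitative Hopf / boundary Harnack inequality:
there is `c₁ > 0` depending only on `D₁` such that for every translate-dilate
`D_λ = (x₀,y₀) + λD₁` and every solution `z` of `-Δz = f ≥ 0` in `D_λ`, `z = 0`
on `∂D_λ`, one has
`z(x,y)/δ(x,y) ≥ c₁ λ⁻² ∬_{D_λ} f δ` where `δ = dist(·, ∂D_λ)`. -/
theorem boundary_harnack (D₁ : Set (ℝ × ℝ)) (hopen : IsOpen D₁)
    (hconn : IsConnected D₁) (hbdd : Bornology.IsBounded D₁)
    (hC2 : HasC2Boundary D₁)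
    (hsub : Ioo (-1:ℝ) 1 ×ˢ Ioo (0:ℝ) 2 ⊆ D₁)
    (hsup : D₁ ⊆ Ioo (-2:ℝ) 2 ×ˢ Ioo (0:ℝ) 2) :
    ∃ c₁ : ℝ, 0 < c₁ ∧ ∀ x₀ y₀ lam : ℝ, 0 < lam →
      ∀ f z : ℝ × ℝ → ℝ,
        Measurable f →
        (∀ q ∈ dilateSet x₀ y₀ lam D₁, 0 ≤ f q) →
        (∃ M : ℝ, ∀ q ∈ dilateSet x₀ y₀ lam D₁, f q ≤ M) →
        ContinuousOn z (closure (dilateSet x₀ y₀ lam D₁)) →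
        ContDiffOn ℝ 2 z (dilateSet x₀ y₀ lam D₁) →
        (∀ q ∈ dilateSet x₀ y₀ lam D₁, -lap2 z q = f q) →
        (∀ q ∈ frontier (dilateSet x₀ y₀ lam D₁), z q = 0) →
        ∀ q ∈ dilateSet x₀ y₀ lam D₁,
          c₁ * lam⁻¹ ^ 2 *
              ∫ r in dilateSet x₀ y₀ lam D₁,
                f r * Metric.infDist r (frontier (dilateSet x₀ y₀ lam D₁)) ≤
            z q / Metric.infDist q (frontier (dilateSet x₀ y₀ lam D₁)) := by
  obtain ⟨c, hc, H⟩ := unscaled hopen hbdd hconn.isPreconnected hC2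
  refine ⟨c, hc, ?_⟩
  intro x₀ y₀ lam hlam f z hfm hf0 hfb hzc hz2 hpde hbc q hq
  have hdil : dilateSet x₀ y₀ lam D₁ = TT x₀ y₀ lam '' D₁ := rfl
  have hcl : closure (TT x₀ y₀ lam '' D₁) = TT x₀ y₀ lam '' closure D₁ :=
    ((TH x₀ y₀ lam hlam).image_closure D₁).symm
  have hfr : frontier (TT x₀ y₀ lam '' D₁) = TT x₀ y₀ lam '' frontier D₁ :=
    ((TH x₀ y₀ lam hlam).image_frontier D₁).symm
  rw [hdil] at hf0 hfb hzc hz2 hpde hbc hq ⊢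
  rw [hcl] at hzc
  rw [hfr] at hbc ⊢
  have hTc : Continuous (TT x₀ y₀ lam) := (TH x₀ y₀ lam hlam).continuous
  have hT2 : ContDiff ℝ 2 (TT x₀ y₀ lam) := by unfold TT; fun_prop
  have hA : Adm D₁ (fun r => lam ^ 2 * f (TT x₀ y₀ lam r)) (fun r => z (TT x₀ y₀ lam r)) := by
    refine ⟨(hfm.comp hTc.measurable).const_mul _, ?_, ?_, ?_, ?_, ?_, ?_⟩
    · intro r hr
      exact mul_nonneg (by positivity) (hf0 _ (mem_image_of_mem _ hr))
    · obtain ⟨M, hM⟩ := hfb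
      exact ⟨lam ^ 2 * M, fun r hr => by
        have := hM _ (mem_image_of_mem _ hr)
        gcongr⟩
    · exact hzc.comp hTc.continuousOn (mapsTo_image _ _)
    · exact hz2.comp hT2.contDiffOn (mapsTo_image _ _)
    · intro r hr
      rw [TT_lap, ← hpde _ (mem_image_of_mem _ hr)]; ring
    · intro r hr
      exact hbc _ (mem_image_of_mem _ hr)
  obtain ⟨x, hx, rfl⟩ := hq
  have h1 := H _ _ hA x hx
  have hfne : (frontier D₁).Nonempty := by
    rw [nonempty_frontier_iff]
    refine ⟨⟨x, hx⟩, fun he => ?_⟩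
    have : ((3:ℝ), (0:ℝ)) ∈ D₁ := he ▸ mem_univ _
    have := (hsup this).1.2
    norm_num at this
  have hδ : 0 < Metric.infDist x (frontier D₁) := by
    rw [← isClosed_frontier.notMem_iff_infDist_pos hfne]
    intro hxf
    rw [frontier, hopen.interior_eq] at hxf
    exact hxf.2 hx
  rw [TT_infDist hlam, le_div_iff₀ (by positivity), TT_integral hlam hopen.measurableSet]
  simp only [TT_infDist hlam]
  have e1 : ∫ r in D₁, lam ^ 2 * f (TT x₀ y₀ lam r) * Metric.infDist r (frontier D₁) =
      lam ^ 2 * ∫ r in D₁, f (TT x₀ y₀ lam r) * Metric.infDist r (frontier D₁) := by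
    rw [← integral_const_mul]; simp only [mul_assoc]
  have e2 : ∫ r in D₁, f (TT x₀ y₀ lam r) * (lam * Metric.infDist r (frontier D₁)) =
      lam * ∫ r in D₁, f (TT x₀ y₀ lam r) * Metric.infDist r (frontier D₁) := by
    rw [← integral_const_mul]; congr 1; ext r; ring
  rw [e1] at h1
  rw [e2]
  refine le_trans (le_of_eq ?_) h1
  field_simp
end
end
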